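/- Let h : ℂᴺ → ℂᵏ be a holomorphic submersion (entire, with surjective derivative at every point), K ⊆ ℂᵏ a compact O(ℂᵏ)-convex set, P ⊆ ℝⁿ ⊆ ℂⁿ compact, and f : P × ℂᵏ → ℂᴺ continuous with h(f(p,x)) = x for all (p,x) and with x ↦ f(p,x) holomorphic for every p ∈ P. Set V_p = f(p, ℂᵏ) ⊆ ℂᴺ for p ∈ P, and Σ = {(p, f(p,x)) : p ∈ P, x ∈ K} ⊆ ℂⁿ × ℂᴺ, with fibers Σ_p = f(p, K). Let S ⊆ P × ℂᴺ ⊆ ℂⁿ × ℂᴺ be a compact set with fibers S_p (p ∈ P) such that: (i) for each p ∈ P, S_p ∩ V_p ⊆ Σ_p and the image h(S_p ∩ V_p) is O(ℂᵏ)-convex; and (ii) there exists an open Stein set Θ ⊆ ℂⁿ × ℂᴺ with S ⊆ Θ in which S is O(Θ)-convex. Then Σ ∪ S is a Stein compactum in ℂⁿ × ℂᴺ. -/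

import Mathlib

open Set Topology

noncomputable section

/-- The `𝒪(Ω)`-hull of a set `K` inside `Ω`: points of `Ω` where every function
holomorphic on `Ω` is bounded by its sup over `K`. -/
def hullO {E : Type*} [NormedAddCommGroup E] [NormedSpace ℂ E] (Ω K : Set E) : Set E :=
  {z ∈ Ω | ∀ f : E → ℂ, DifferentiableOn ℂ f Ω → ‖f z‖ ≤ ⨆ w ∈ K, ‖f w‖}

/-- An open set is Stein if the `𝒪(Ω)`-hull of every compact subset is compact. -/
def IsSteinOpen {E : Type*} [NormedAddCommGroup E] [NormedSpace ℂ E] (Ω : Set E) : Prop :=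
  IsOpen Ω ∧ ∀ K : Set E, K ⊆ Ω → IsCompact K → IsCompact (hullO Ω K)

/-- A compact set is a Stein compactum if every open neighborhood contains a
Stein open neighborhood. -/
def IsSteinCompactum {E : Type*} [NormedAddCommGroup E] [NormedSpace ℂ E] (S : Set E) : Prop :=
  ∀ U : Set E, IsOpen U → S ⊆ U → ∃ Ω : Set E, IsSteinOpen Ω ∧ S ⊆ Ω ∧ Ω ⊆ U

/-- `ℝⁿ` viewed as the real subspace of `ℂⁿ`. -/
def realSlice (n : ℕ) : Set (EuclideanSpace ℂ (Fin n)) := {x | ∀ i, (x i).im = 0}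

/-- The fiber of a subset of a product over a point of the first factor. -/
def fiberOf {α β : Type*} (S : Set (α × β)) (u : α) : Set β := {z | (u, z) ∈ S}

/-- A subset of `ℝⁿ × ℂᵐ` that is open in the subspace topology of `ℝⁿ × ℂᵐ ⊆ ℂⁿ × ℂᵐ`. -/
def OpenInSlice {n m : ℕ}
    (U : Set (EuclideanSpace ℂ (Fin n) × EuclideanSpace ℂ (Fin m))) : Prop :=
  ∃ W, IsOpen W ∧ U = W ∩ (realSlice n ×ˢ (univ : Set (EuclideanSpace ℂ (Fin m))))

open scoped ContDiff

/-- complex coordinate space -/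
abbrev CN (M : ℕ) := Fin M → ℂ

/-- Wirtinger derivative `∂/∂z_j`. -/
def dz {M : ℕ} (j : Fin M) (v : CN M → ℂ) (x : CN M) : ℂ :=
  (fderiv ℝ v x (Pi.single j 1) - Complex.I * fderiv ℝ v x (Pi.single j Complex.I)) / 2

/-- Wirtinger derivative `∂/∂z̄_j`. -/
def dzb {M : ℕ} (j : Fin M) (v : CN M → ℂ) (x : CN M) : ℂ :=
  (fderiv ℝ v x (Pi.single j 1) + Complex.I * fderiv ℝ v x (Pi.single j Complex.I)) / 2

section wirt
variable {M : ℕ}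

lemma contDiffAt_fderiv_apply {E : Type*} [NormedAddCommGroup E] [NormedSpace ℝ E]
    {F : Type*} [NormedAddCommGroup F] [NormedSpace ℝ F]
    {v : E → F} {x : E} (hv : ContDiffAt ℝ ∞ v x) (e : E) :
    ContDiffAt ℝ ∞ (fun y => fderiv ℝ v y e) x :=
  (hv.fderiv_right (m := ∞) (by simp)).clm_apply contDiffAt_const

lemma dz_contDiffAt {v : CN M → ℂ} {x} (hv : ContDiffAt ℝ ∞ v x) (j) :
    ContDiffAt ℝ ∞ (dz j v) x := by
  have h1 := contDiffAt_fderiv_apply hv (Pi.single j 1)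
  have h2 := contDiffAt_fderiv_apply hv (Pi.single j Complex.I)
  unfold dz
  exact (h1.sub (contDiffAt_const.mul h2)).div_const 2

lemma dzb_contDiffAt {v : CN M → ℂ} {x} (hv : ContDiffAt ℝ ∞ v x) (j) :
    ContDiffAt ℝ ∞ (dzb j v) x := by
  have h1 := contDiffAt_fderiv_apply hv (Pi.single j 1)
  have h2 := contDiffAt_fderiv_apply hv (Pi.single j Complex.I)
  unfold dzb
  exact (h1.add (contDiffAt_const.mul h2)).div_const 2

lemma dz_contDiff {v : CN M → ℂ} (hv : ContDiff ℝ ∞ v) (j) : ContDiff ℝ ∞ (dz j v) :=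
  contDiff_iff_contDiffAt.2 fun _ => dz_contDiffAt hv.contDiffAt j

lemma dzb_contDiff {v : CN M → ℂ} (hv : ContDiff ℝ ∞ v) (j) : ContDiff ℝ ∞ (dzb j v) :=
  contDiff_iff_contDiffAt.2 fun _ => dzb_contDiffAt hv.contDiffAt j

lemma dz_mul {u v : CN M → ℂ} {x} (hu : DifferentiableAt ℝ u x) (hv : DifferentiableAt ℝ v x)
    (j) : dz j (fun y => u y * v y) x = dz j u x * v x + u x * dz j v x := by
  simp only [dz, fderiv_fun_mul hu hv]
  simp
  ring

lemma dzb_mul {u v : CN M → ℂ} {x} (hu : DifferentiableAt ℝ u x) (hv : DifferentiableAt ℝ v x)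
    (j) : dzb j (fun y => u y * v y) x = dzb j u x * v x + u x * dzb j v x := by
  simp only [dzb, fderiv_fun_mul hu hv]
  simp
  ring

lemma dz_add {u v : CN M → ℂ} {x} (hu : DifferentiableAt ℝ u x) (hv : DifferentiableAt ℝ v x)
    (j) : dz j (fun y => u y + v y) x = dz j u x + dz j v x := by
  simp only [dz, fderiv_fun_add hu hv]
  simp
  ring

lemma dzb_add {u v : CN M → ℂ} {x} (hu : DifferentiableAt ℝ u x) (hv : DifferentiableAt ℝ v x)
    (j) : dzb j (fun y => u y + v y) x = dzb j u x + dzb j v x := by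
  simp only [dzb, fderiv_fun_add hu hv]
  simp
  ring

lemma dz_sub {u v : CN M → ℂ} {x} (hu : DifferentiableAt ℝ u x) (hv : DifferentiableAt ℝ v x)
    (j) : dz j (fun y => u y - v y) x = dz j u x - dz j v x := by
  simp only [dz, fderiv_fun_sub hu hv]
  simp
  ring

lemma dzb_sub {u v : CN M → ℂ} {x} (hu : DifferentiableAt ℝ u x) (hv : DifferentiableAt ℝ v x)
    (j) : dzb j (fun y => u y - v y) x = dzb j u x - dzb j v x := by
  simp only [dzb, fderiv_fun_sub hu hv]
  simp
  ring

lemma fderiv_conj {v : CN M → ℂ} {x} (e : CN M) :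
    fderiv ℝ (fun y => (starRingEnd ℂ) (v y)) x e = (starRingEnd ℂ) (fderiv ℝ v x e) := by
  have := (Complex.conjCLE : ℂ ≃L[ℝ] ℂ).comp_fderiv (f := v) (x := x)
  have h2 := DFunLike.congr_fun this e
  simpa [Function.comp_def] using h2

lemma dz_conj {v : CN M → ℂ} {x} (j) :
    dz j (fun y => (starRingEnd ℂ) (v y)) x = (starRingEnd ℂ) (dzb j v x) := by
  simp [dz, dzb, fderiv_conj, sub_eq_add_neg, Complex.conj_ofNat]

lemma dzb_conj {v : CN M → ℂ} {x} (j) :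
    dzb j (fun y => (starRingEnd ℂ) (v y)) x = (starRingEnd ℂ) (dz j v x) := by
  simp [dz, dzb, fderiv_conj, sub_eq_add_neg, Complex.conj_ofNat]

lemma dz_congr {u v : CN M → ℂ} {x} (h : u =ᶠ[𝓝 x] v) (j) : dz j u x = dz j v x := by
  simp [dz, h.fderiv_eq]

lemma dzb_congr {u v : CN M → ℂ} {x} (h : u =ᶠ[𝓝 x] v) (j) : dzb j u x = dzb j v x := by
  simp [dzb, h.fderiv_eq]

lemma dz_congr' {u v : CN M → ℂ} {x} (h : u =ᶠ[𝓝 x] v) (j) : dz j u =ᶠ[𝓝 x] dz j v := by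
  filter_upwards [h.eventuallyEq_nhds] with y hy using dz_congr hy j

lemma dzb_congr' {u v : CN M → ℂ} {x} (h : u =ᶠ[𝓝 x] v) (j) : dzb j u =ᶠ[𝓝 x] dzb j v := by
  filter_upwards [h.eventuallyEq_nhds] with y hy using dzb_congr hy j

lemma fderiv_fderiv_apply {v : CN M → ℂ} {x} (hv : ContDiffAt ℝ ∞ v x) (e f : CN M) :
    fderiv ℝ (fun y => fderiv ℝ v y e) x f = fderiv ℝ (fderiv ℝ v) x f e := by
  have h : DifferentiableAt ℝ (fderiv ℝ v) x :=
    (hv.fderiv_right (m := ∞) (by simp)).differentiableAt (by simp)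
  rw [fderiv_clm_apply h (differentiableAt_const _)]
  simp

lemma fderiv2_symm {v : CN M → ℂ} {x} (hv : ContDiffAt ℝ ∞ v x) (e f : CN M) :
    fderiv ℝ (fderiv ℝ v) x f e = fderiv ℝ (fderiv ℝ v) x e f := by
  have : IsSymmSndFDerivAt ℝ v x := hv.isSymmSndFDerivAt (by simp; exact WithTop.coe_le_coe.2 (le_top : (2 : ℕ∞) ≤ ⊤))
  exact this f e

lemma dz_dzb_expand {v : CN M → ℂ} {x} (hv : ContDiffAt ℝ ∞ v x) (j k : Fin M) :
    dz j (dzb k v) x =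
      (fderiv ℝ (fderiv ℝ v) x (Pi.single j 1) (Pi.single k 1)
       + Complex.I * fderiv ℝ (fderiv ℝ v) x (Pi.single j 1) (Pi.single k Complex.I)
       - Complex.I * fderiv ℝ (fderiv ℝ v) x (Pi.single j Complex.I) (Pi.single k 1)
       + fderiv ℝ (fderiv ℝ v) x (Pi.single j Complex.I) (Pi.single k Complex.I)) / 4 := by
  have hd : ∀ e, DifferentiableAt ℝ (fun y => fderiv ℝ v y e) x := fun e =>
    (contDiffAt_fderiv_apply hv e).differentiableAt (by simp)
  have key : ∀ e, fderiv ℝ (dzb k v) x e = (fderiv ℝ (fderiv ℝ v) x e (Pi.single k 1)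
      + Complex.I * fderiv ℝ (fderiv ℝ v) x e (Pi.single k Complex.I)) / 2 := by
    intro e
    have : dzb k v = fun y => (2:ℂ)⁻¹ * (fderiv ℝ v y (Pi.single k 1) +
      Complex.I * fderiv ℝ v y (Pi.single k Complex.I)) := by
      funext y; simp [dzb]; ring
    rw [this, fderiv_const_mul ((hd _).fun_add ((hd _).const_mul _)), fderiv_fun_add (hd _) ((hd _).const_mul _),
      fderiv_const_mul (hd _)]
    simp [fderiv_fderiv_apply hv]
    ring
  rw [dz, key, key]
  linear_combination (-1/4 * fderiv ℝ (fderiv ℝ v) x (Pi.single j Complex.I) (Pi.single k Complex.I)) * Complex.I_sq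

lemma dzb_dz_expand {v : CN M → ℂ} {x} (hv : ContDiffAt ℝ ∞ v x) (j k : Fin M) :
    dzb k (dz j v) x =
      (fderiv ℝ (fderiv ℝ v) x (Pi.single j 1) (Pi.single k 1)
       + Complex.I * fderiv ℝ (fderiv ℝ v) x (Pi.single j 1) (Pi.single k Complex.I)
       - Complex.I * fderiv ℝ (fderiv ℝ v) x (Pi.single j Complex.I) (Pi.single k 1)
       + fderiv ℝ (fderiv ℝ v) x (Pi.single j Complex.I) (Pi.single k Complex.I)) / 4 := by
  have hd : ∀ e, DifferentiableAt ℝ (fun y => fderiv ℝ v y e) x := fun e =>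
    (contDiffAt_fderiv_apply hv e).differentiableAt (by simp)
  have key : ∀ e, fderiv ℝ (dz j v) x e = (fderiv ℝ (fderiv ℝ v) x (Pi.single j 1) e
      - Complex.I * fderiv ℝ (fderiv ℝ v) x (Pi.single j Complex.I) e) / 2 := by
    intro e
    have : dz j v = fun y => (2:ℂ)⁻¹ * (fderiv ℝ v y (Pi.single j 1) -
      Complex.I * fderiv ℝ v y (Pi.single j Complex.I)) := by
      funext y; simp [dz]; ring
    rw [this, fderiv_const_mul ((hd _).fun_sub ((hd _).const_mul _)), fderiv_fun_sub (hd _) ((hd _).const_mul _),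
      fderiv_const_mul (hd _)]
    simp [fderiv_fderiv_apply hv, fderiv2_symm hv _ e]
    ring
  rw [dzb, key, key]
  linear_combination (-1/4 * fderiv ℝ (fderiv ℝ v) x (Pi.single j Complex.I) (Pi.single k Complex.I)) * Complex.I_sq

lemma dzb_dz_comm {v : CN M → ℂ} {x} (hv : ContDiffAt ℝ ∞ v x) (j k : Fin M) :
    dzb k (dz j v) x = dz j (dzb k v) x := by
  rw [dzb_dz_expand hv, dz_dzb_expand hv]

lemma tsupport_dz_subset (v : CN M → ℂ) (j) : tsupport (dz j v) ⊆ tsupport v := by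
  apply closure_minimal _ (isClosed_tsupport v)
  intro x hx
  by_contra h
  apply hx
  have : v =ᶠ[𝓝 x] fun _ => 0 := by
    simpa [Filter.EventuallyEq] using (notMem_tsupport_iff_eventuallyEq.1 h)
  rw [dz_congr this]; simp [dz]

lemma tsupport_dzb_subset (v : CN M → ℂ) (j) : tsupport (dzb j v) ⊆ tsupport v := by
  apply closure_minimal _ (isClosed_tsupport v)
  intro x hx
  by_contra h
  apply hx
  have : v =ᶠ[𝓝 x] fun _ => 0 := by
    simpa [Filter.EventuallyEq] using (notMem_tsupport_iff_eventuallyEq.1 h)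
  rw [dzb_congr this]; simp [dzb]

lemma hcs_dz {v : CN M → ℂ} (hv : HasCompactSupport v) (j) : HasCompactSupport (dz j v) :=
  hv.of_isClosed_subset (isClosed_tsupport _) (tsupport_dz_subset v j)
lemma hcs_dzb {v : CN M → ℂ} (hv : HasCompactSupport v) (j) : HasCompactSupport (dzb j v) :=
  hv.of_isClosed_subset (isClosed_tsupport _) (tsupport_dzb_subset v j)

open MeasureTheory

lemma fderiv_ibp {u v : CN M → ℂ} (hu : ContDiff ℝ ∞ u) (hv : ContDiff ℝ ∞ v)
    (hc : HasCompactSupport v) (e : CN M) :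
    ∫ x, u x * fderiv ℝ v x e = - ∫ x, fderiv ℝ u x e * v x := by
  have hv' : Continuous (fun x => fderiv ℝ v x e) :=
    (hv.continuous_fderiv (by simp)).clm_apply continuous_const
  have hu' : Continuous (fun x => fderiv ℝ u x e) :=
    (hu.continuous_fderiv (by simp)).clm_apply continuous_const
  have hcv : HasCompactSupport (fun x => fderiv ℝ v x e) := hc.fderiv_apply ℝ e
  apply integral_mul_fderiv_eq_neg_fderiv_mul_of_integrable
  · exact (hu'.mul hv.continuous).integrable_of_hasCompactSupport hc.mul_left
  · exact (hu.continuous.mul hv').integrable_of_hasCompactSupport hcv.mul_left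
  · exact (hu.continuous.mul hv.continuous).integrable_of_hasCompactSupport hc.mul_left
  · exact fun x _ => hu.differentiable (by simp) x
  · exact fun x _ => hv.differentiable (by simp) x

lemma dz_ibp {u v : CN M → ℂ} (hu : ContDiff ℝ ∞ u) (hv : ContDiff ℝ ∞ v)
    (hc : HasCompactSupport v) (j) :
    ∫ x, u x * dz j v x = - ∫ x, dz j u x * v x := by
  have hv' : ∀ e, Continuous (fun x => fderiv ℝ v x e) := fun e =>
    (hv.continuous_fderiv (by simp)).clm_apply continuous_const
  have hu' : ∀ e, Continuous (fun x => fderiv ℝ u x e) := fun e =>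
    (hu.continuous_fderiv (by simp)).clm_apply continuous_const
  have hcv : ∀ e, HasCompactSupport (fun x => fderiv ℝ v x e) := fun e => hc.fderiv_apply ℝ e
  have i1 : ∀ e, Integrable (fun x => u x * fderiv ℝ v x e) := fun e =>
    (hu.continuous.mul (hv' e)).integrable_of_hasCompactSupport (hcv e).mul_left
  have i2 : ∀ e, Integrable (fun x => fderiv ℝ u x e * v x) := fun e =>
    ((hu' e).mul hv.continuous).integrable_of_hasCompactSupport hc.mul_left
  have e1 : ∀ x, u x * dz j v x = (1/2:ℂ) * (u x * fderiv ℝ v x (Pi.single j 1)) -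
    (Complex.I/2) * (u x * fderiv ℝ v x (Pi.single j Complex.I)) := fun x => by rw [dz]; ring
  have e2 : ∀ x, dz j u x * v x = (1/2:ℂ) * (fderiv ℝ u x (Pi.single j 1) * v x) -
    (Complex.I/2) * (fderiv ℝ u x (Pi.single j Complex.I) * v x) := fun x => by rw [dz]; ring
  simp_rw [e1, e2]
  rw [integral_sub ((i1 _).const_mul _) ((i1 _).const_mul _),
    integral_sub ((i2 _).const_mul _) ((i2 _).const_mul _)]
  simp_rw [integral_const_mul, fderiv_ibp hu hv hc]
  ring

lemma dzb_ibp {u v : CN M → ℂ} (hu : ContDiff ℝ ∞ u) (hv : ContDiff ℝ ∞ v)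
    (hc : HasCompactSupport v) (j) :
    ∫ x, u x * dzb j v x = - ∫ x, dzb j u x * v x := by
  have hv' : ∀ e, Continuous (fun x => fderiv ℝ v x e) := fun e =>
    (hv.continuous_fderiv (by simp)).clm_apply continuous_const
  have hu' : ∀ e, Continuous (fun x => fderiv ℝ u x e) := fun e =>
    (hu.continuous_fderiv (by simp)).clm_apply continuous_const
  have hcv : ∀ e, HasCompactSupport (fun x => fderiv ℝ v x e) := fun e => hc.fderiv_apply ℝ e
  have i1 : ∀ e, Integrable (fun x => u x * fderiv ℝ v x e) := fun e =>
    (hu.continuous.mul (hv' e)).integrable_of_hasCompactSupport (hcv e).mul_left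
  have i2 : ∀ e, Integrable (fun x => fderiv ℝ u x e * v x) := fun e =>
    ((hu' e).mul hv.continuous).integrable_of_hasCompactSupport hc.mul_left
  have e1 : ∀ x, u x * dzb j v x = (1/2:ℂ) * (u x * fderiv ℝ v x (Pi.single j 1)) +
    (Complex.I/2) * (u x * fderiv ℝ v x (Pi.single j Complex.I)) := fun x => by rw [dzb]; ring
  have e2 : ∀ x, dzb j u x * v x = (1/2:ℂ) * (fderiv ℝ u x (Pi.single j 1) * v x) +
    (Complex.I/2) * (fderiv ℝ u x (Pi.single j Complex.I) * v x) := fun x => by rw [dzb]; ring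
  simp_rw [e1, e2]
  rw [integral_add ((i1 _).const_mul _) ((i1 _).const_mul _),
    integral_add ((i2 _).const_mul _) ((i2 _).const_mul _)]
  simp_rw [integral_const_mul, fderiv_ibp hu hv hc]
  ring

end wirt

section mkh
open MeasureTheory
variable {M : ℕ}


lemma contDiff_conj {v : CN M → ℂ} (hv : ContDiff ℝ ∞ v) :
    ContDiff ℝ ∞ (fun y => (starRingEnd ℂ) (v y)) :=
  Complex.conjCLE.contDiff.comp hv

lemma hcs_conj {v : CN M → ℂ} (hv : HasCompactSupport v) :
    HasCompactSupport (fun y => (starRingEnd ℂ) (v y)) :=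
  hv.comp_left (g := (starRingEnd ℂ)) (by simp)

/-- twisted derivative -/
def dlt (Φ : CN M → ℂ) (j : Fin M) (v : CN M → ℂ) (x : CN M) : ℂ := dz j v x - dz j Φ x * v x

lemma dlt_contDiff {Φ v : CN M → ℂ} (hΦ : ContDiff ℝ ∞ Φ) (hv : ContDiff ℝ ∞ v) (j) :
    ContDiff ℝ ∞ (dlt Φ j v) :=
  (dz_contDiff hv j).sub ((dz_contDiff hΦ j).mul hv)

lemma hcs_dlt {Φ v : CN M → ℂ} (hv : HasCompactSupport v) (j) : HasCompactSupport (dlt Φ j v) :=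
  (hcs_dz hv j).sub hv.mul_left

/-- complex valued weight -/
def cW (φ : CN M → ℝ) (x : CN M) : ℂ := ((Real.exp (-φ x) : ℝ) : ℂ)

lemma cW_contDiff {φ : CN M → ℝ} (hφ : ContDiff ℝ ∞ φ) : ContDiff ℝ ∞ (cW φ) :=
  Complex.ofRealCLM.contDiff.comp (Real.contDiff_exp.comp hφ.neg)

lemma ofReal_contDiff {φ : CN M → ℝ} (hφ : ContDiff ℝ ∞ φ) :
    ContDiff ℝ ∞ (fun x => (φ x : ℂ)) :=
  Complex.ofRealCLM.contDiff.comp hφ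

lemma fderiv_ofReal {φ : CN M → ℝ} {x} (hφ : DifferentiableAt ℝ φ x) (e : CN M) :
    fderiv ℝ (fun y => (φ y : ℂ)) x e = ((fderiv ℝ φ x e : ℝ) : ℂ) := by
  have := (Complex.ofRealCLM.hasFDerivAt.comp x hφ.hasFDerivAt).fderiv
  have h2 := DFunLike.congr_fun this e
  simpa [Function.comp_def] using h2

lemma dz_cW {φ : CN M → ℝ} (hφ : ContDiff ℝ ∞ φ) (j x) :
    dz j (cW φ) x = - cW φ x * dz j (fun x => (φ x : ℂ)) x := by
  have hd : DifferentiableAt ℝ φ x := hφ.differentiable (by simp) x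
  have h1 : ∀ e, fderiv ℝ (cW φ) x e = - cW φ x * ((fderiv ℝ φ x e : ℝ) : ℂ) := by
    intro e
    have : fderiv ℝ (cW φ) x e = ((fderiv ℝ (fun y => Real.exp (-φ y)) x e : ℝ) : ℂ) := by
      have := fderiv_ofReal (φ := fun y => Real.exp (-φ y)) (x := x) (hd.neg.exp) e
      exact this
    rw [this, fderiv_exp hd.fun_neg, fderiv_fun_neg]
    simp [cW]
  rw [dz, dz, h1, h1, fderiv_ofReal hd, fderiv_ofReal hd]
  ring

lemma cW_conj (φ : CN M → ℝ) (x) : (starRingEnd ℂ) (cW φ x) = cW φ x := by simp [cW, -Complex.ofReal_exp]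

lemma cW_mul_dlt {φ : CN M → ℝ} (hφ : ContDiff ℝ ∞ φ) {v : CN M → ℂ} (hv : ContDiff ℝ ∞ v) (j x) :
    cW φ x * dlt (fun x => (φ x : ℂ)) j v x = dz j (fun y => cW φ y * v y) x := by
  rw [dz_mul ((cW_contDiff hφ).differentiable (by simp) x) (hv.differentiable (by simp) x),
    dz_cW hφ, dlt]
  ring

lemma mkh_pair {φ : CN M → ℝ} (hφ : ContDiff ℝ ∞ φ) {a b : CN M → ℂ} (ha : ContDiff ℝ ∞ a)
    (hb : ContDiff ℝ ∞ b) (hac : HasCompactSupport a) (hbc : HasCompactSupport b) (j k : Fin M) :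
    ∫ x, cW φ x * (dlt (fun x => (φ x : ℂ)) j a x * (starRingEnd ℂ) (dlt (fun x => (φ x : ℂ)) k b x)) =
    (∫ x, cW φ x * (dzb k a x * (starRingEnd ℂ) (dzb j b x))) +
    ∫ x, cW φ x * (dz j (dzb k (fun x => (φ x : ℂ))) x * a x * (starRingEnd ℂ) (b x)) := by
  set Φ : CN M → ℂ := fun x => (φ x : ℂ) with hΦdef
  have hΦ : ContDiff ℝ ∞ Φ := ofReal_contDiff hφ
  have hW := cW_contDiff hφ
  have hX : ContDiff ℝ ∞ (fun x => (starRingEnd ℂ) (dlt Φ k b x)) := contDiff_conj (dlt_contDiff hΦ hb k)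
  have hXc : HasCompactSupport (fun x => (starRingEnd ℂ) (dlt Φ k b x)) := hcs_conj (hcs_dlt hbc k)
  have hv := dzb_contDiff hb j
  -- commutator
  have hcomm : ∀ x, dz j (fun x => (starRingEnd ℂ) (dlt Φ k b x)) x =
      (starRingEnd ℂ) (dlt Φ k (dzb j b) x) - dz j (dzb k Φ) x * (starRingEnd ℂ) (b x) := by
    intro x
    rw [dz_conj]
    have e1 : dzb j (dlt Φ k b) x = dlt Φ k (dzb j b) x - dzb j (dz k Φ) x * b x := by
      have hd1 := (dz_contDiff hb k).differentiable (by simp) x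
      have hd2 := (dz_contDiff hΦ k).differentiable (by simp) x
      have hd3 := hb.differentiable (by simp) x
      change dzb j (fun y => dz k b y - dz k Φ y * b y) x = _
      rw [dzb_sub hd1 (hd2.fun_mul hd3), dzb_mul hd2 hd3, dzb_dz_comm hb.contDiffAt, dlt]
      ring
    rw [e1]
    have e2 : (starRingEnd ℂ) (dzb j (dz k Φ) x) = dz j (dzb k Φ) x := by
      rw [← dz_conj]
      congr 1
      funext y
      rw [← dzb_conj]
      congr 1
      funext z
      simp [Φ]
    rw [map_sub, map_mul, e2]
  have s1 : ∫ x, cW φ x * (dlt Φ j a x * (starRingEnd ℂ) (dlt Φ k b x)) =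
      ∫ x, dz j (fun y => cW φ y * a y) x * (starRingEnd ℂ) (dlt Φ k b x) := by
    congr 1; funext x; rw [← mul_assoc, cW_mul_dlt hφ ha]
  have s2 := dz_ibp (hW.mul ha) hX hXc j
  have s3 : ∫ x, (cW φ x * a x) * dz j (fun x => (starRingEnd ℂ) (dlt Φ k b x)) x =
      (∫ x, a x * dzb k (fun y => cW φ y * (starRingEnd ℂ) (dzb j b y)) x) -
      ∫ x, cW φ x * (dz j (dzb k Φ) x * a x * (starRingEnd ℂ) (b x)) := by
    rw [← integral_sub]
    · congr 1; funext x
      rw [hcomm]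
      have : dzb k (fun y => cW φ y * (starRingEnd ℂ) (dzb j b y)) x = cW φ x * (starRingEnd ℂ) (dlt Φ k (dzb j b) x) := by
        have : (fun y => cW φ y * (starRingEnd ℂ) (dzb j b y)) = fun y => (starRingEnd ℂ) (cW φ y * dzb j b y) := by
          funext y; rw [map_mul, cW_conj]
        rw [this, dzb_conj, ← cW_mul_dlt hφ hv, map_mul, cW_conj]
      rw [this]; ring
    · refine (Continuous.integrable_of_hasCompactSupport ?_ hac.mul_right)
      exact ha.continuous.mul (dzb_contDiff (hW.mul (contDiff_conj hv)) k).continuous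
    · refine (Continuous.integrable_of_hasCompactSupport ?_ ?_)
      · exact hW.continuous.mul (((dz_contDiff (dzb_contDiff hΦ k) j).continuous.mul ha.continuous).mul
          (contDiff_conj hb).continuous)
      · exact ((hcs_conj hbc).mul_left).mul_left
  have s4 := dzb_ibp ha (hW.mul (contDiff_conj hv)) ((hcs_conj (hcs_dzb hbc j)).mul_left) k
  rw [s1]
  have s2' : ∫ x, dz j (fun y => cW φ y * a y) x * (starRingEnd ℂ) (dlt Φ k b x) =
    - ∫ x, (cW φ x * a x) * dz j (fun x => (starRingEnd ℂ) (dlt Φ k b x)) x := by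
    rw [s2, neg_neg]
  rw [s2', s3, s4]
  have : ∀ x, dzb k a x * (cW φ x * (starRingEnd ℂ) (dzb j b x)) = cW φ x * (dzb k a x * (starRingEnd ℂ) (dzb j b x)) := by
    intro x; ring
  simp_rw [this]
  ring

lemma antisym_alg (A : Fin M → Fin M → ℂ) :
    -(∑ j, ∑ k, (A k j * (starRingEnd ℂ) (A j k)).re) ≤ (∑ j, ∑ k, ‖A j k - A k j‖ ^ 2) / 2 := by
  have h : ∀ j k, ‖A j k - A k j‖ ^ 2 = ‖A j k‖ ^ 2 + ‖A k j‖ ^ 2 - 2 * (A k j * (starRingEnd ℂ) (A j k)).re := by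
    intro j k
    simp only [← Complex.normSq_eq_norm_sq, Complex.normSq_apply, Complex.mul_re, Complex.conj_re,
      Complex.conj_im, Complex.sub_re, Complex.sub_im]
    ring
  simp_rw [h]
  simp only [Finset.sum_sub_distrib, Finset.sum_add_distrib, ← Finset.mul_sum]
  have : 0 ≤ ∑ j, ∑ k, ‖A j k‖ ^ 2 := by positivity
  have h2 : 0 ≤ ∑ j, ∑ k, ‖A k j‖ ^ 2 := by positivity
  linarith

/-- Morrey-Kohn-Hörmander inequality. -/
lemma mkh_ineq {φ : CN M → ℝ} (hφ : ContDiff ℝ ∞ φ) {a : Fin M → CN M → ℂ}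
    (ha : ∀ j, ContDiff ℝ ∞ (a j)) (hac : ∀ j, HasCompactSupport (a j)) :
    ∫ x, Real.exp (-φ x) *
      (∑ j, ∑ k, dz j (dzb k (fun x => (φ x : ℂ))) x * a j x * (starRingEnd ℂ) (a k x)).re ≤
    (∫ x, Real.exp (-φ x) * ‖∑ j, dlt (fun x => (φ x : ℂ)) j (a j) x‖ ^ 2) +
    (∫ x, Real.exp (-φ x) * ((∑ j, ∑ k, ‖dzb j (a k) x - dzb k (a j) x‖ ^ 2) / 2)) := by
  set Φ : CN M → ℂ := fun x => (φ x : ℂ) with hΦdef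
  have hΦ : ContDiff ℝ ∞ Φ := ofReal_contDiff hφ
  have hW := (cW_contDiff hφ).continuous
  have hE : Continuous (fun x => Real.exp (-φ x)) := Real.continuous_exp.comp hφ.continuous.neg
  have i1 : ∀ j k, Integrable (fun x => cW φ x * (dlt Φ j (a j) x * (starRingEnd ℂ) (dlt Φ k (a k) x))) := by
    intro j k
    refine Continuous.integrable_of_hasCompactSupport ?_ ((hcs_conj (hcs_dlt (hac k) k)).mul_left.mul_left)
    exact hW.mul ((dlt_contDiff hΦ (ha j) j).continuous.mul (contDiff_conj (dlt_contDiff hΦ (ha k) k)).continuous)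
  have i2 : ∀ j k, Integrable (fun x => cW φ x * (dzb k (a j) x * (starRingEnd ℂ) (dzb j (a k) x))) := by
    intro j k
    refine Continuous.integrable_of_hasCompactSupport ?_ ((hcs_conj (hcs_dzb (hac k) j)).mul_left.mul_left)
    exact hW.mul ((dzb_contDiff (ha j) k).continuous.mul (contDiff_conj (dzb_contDiff (ha k) j)).continuous)
  have i3 : ∀ j k, Integrable (fun x => cW φ x * (dz j (dzb k Φ) x * a j x * (starRingEnd ℂ) (a k x))) := by
    intro j k
    refine Continuous.integrable_of_hasCompactSupport ?_ ((hcs_conj (hac k)).mul_left.mul_left)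
    exact hW.mul (((dz_contDiff (dzb_contDiff hΦ k) j).continuous.mul (ha j).continuous).mul
          (contDiff_conj (ha k)).continuous)
  have key : (∫ x, ∑ j, ∑ k, cW φ x * (dlt Φ j (a j) x * (starRingEnd ℂ) (dlt Φ k (a k) x))) =
     (∫ x, ∑ j, ∑ k, cW φ x * (dzb k (a j) x * (starRingEnd ℂ) (dzb j (a k) x))) +
     ∫ x, ∑ j, ∑ k, cW φ x * (dz j (dzb k Φ) x * a j x * (starRingEnd ℂ) (a k x)) := by
    rw [integral_finsetSum _ (fun j _ => integrable_finsetSum _ fun k _ => i1 j k),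
      integral_finsetSum _ (fun j _ => integrable_finsetSum _ fun k _ => i2 j k),
      integral_finsetSum _ (fun j _ => integrable_finsetSum _ fun k _ => i3 j k),
      ← Finset.sum_add_distrib]
    refine Finset.sum_congr rfl fun j _ => ?_
    rw [integral_finsetSum _ (fun k _ => i1 j k), integral_finsetSum _ (fun k _ => i2 j k),
      integral_finsetSum _ (fun k _ => i3 j k), ← Finset.sum_add_distrib]
    exact Finset.sum_congr rfl fun k _ => mkh_pair hφ (ha j) (ha k) (hac j) (hac k) j k
  have I1 := integrable_finsetSum Finset.univ (fun j _ => integrable_finsetSum Finset.univ fun k _ => i1 j k)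
  have I2 := integrable_finsetSum Finset.univ (fun j _ => integrable_finsetSum Finset.univ fun k _ => i2 j k)
  have I3 := integrable_finsetSum Finset.univ (fun j _ => integrable_finsetSum Finset.univ fun k _ => i3 j k)
  have key' := congrArg Complex.re key
  rw [Complex.add_re] at key'
  have cv : ∀ f : CN M → ℂ, Integrable f → (∫ x, f x).re = ∫ x, (f x).re := by
    intro f hf
    exact (integral_re hf).symm
  rw [cv _ I1, cv _ I2, cv _ I3] at key'
  have r1 : ∀ x, (∑ j, ∑ k, cW φ x * (dlt Φ j (a j) x * (starRingEnd ℂ) (dlt Φ k (a k) x))).re =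
      Real.exp (-φ x) * ‖∑ j, dlt Φ j (a j) x‖ ^ 2 := by
    intro x
    simp_rw [← Finset.mul_sum]
    rw [← Finset.sum_mul, ← map_sum, Complex.mul_conj, ← Complex.normSq_eq_norm_sq, cW,
      ← Complex.ofReal_mul, Complex.ofReal_re]
  have r3 : ∀ x, (∑ j, ∑ k, cW φ x * (dz j (dzb k Φ) x * a j x * (starRingEnd ℂ) (a k x))).re =
      Real.exp (-φ x) * (∑ j, ∑ k, (dz j (dzb k Φ) x * a j x * (starRingEnd ℂ) (a k x))).re := by
    intro x
    simp_rw [← Finset.mul_sum]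
    rw [cW, Complex.re_ofReal_mul]
  simp_rw [r1, r3] at key'
  have i4 : Integrable (fun x => Real.exp (-φ x) * ((∑ j, ∑ k, ‖dzb j (a k) x - dzb k (a j) x‖ ^ 2) / 2)) := by
    have : (fun x => Real.exp (-φ x) * ((∑ j, ∑ k, ‖dzb j (a k) x - dzb k (a j) x‖ ^ 2) / 2)) =
      fun x => ∑ j, ∑ k, Real.exp (-φ x) / 2 * ‖dzb j (a k) x - dzb k (a j) x‖ ^ 2 := by
      funext x; simp_rw [← Finset.mul_sum]; ring
    rw [this]
    refine integrable_finsetSum _ fun j _ => integrable_finsetSum _ fun k _ => ?_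
    refine Continuous.integrable_of_hasCompactSupport ?_ ?_
    · exact (hE.div_const 2).mul ((((dzb_contDiff (ha k) j).continuous.sub (dzb_contDiff (ha j) k).continuous).norm).pow 2)
    · refine HasCompactSupport.mul_left ?_
      exact ((hcs_dzb (hac k) j).sub (hcs_dzb (hac j) k)).comp_left (g := fun z => ‖z‖ ^ 2) (by simp)
  have h5 : -(∫ x, (∑ j, ∑ k, cW φ x * (dzb k (a j) x * (starRingEnd ℂ) (dzb j (a k) x))).re) ≤
     (∫ x, Real.exp (-φ x) * ((∑ j, ∑ k, ‖dzb j (a k) x - dzb k (a j) x‖ ^ 2) / 2)) := by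
    rw [← integral_neg]
    refine integral_mono I2.re.neg i4 fun x => ?_
    simp only
    simp_rw [← Finset.mul_sum]
    rw [cW, Complex.re_ofReal_mul, neg_mul_eq_mul_neg]
    refine mul_le_mul_of_nonneg_left ?_ (Real.exp_pos _).le
    have := antisym_alg (fun j k => dzb j (a k) x)
    simpa [Complex.re_sum] using this
  linarith

end mkh

section basicest
open MeasureTheory
variable {M : ℕ}

lemma dz_eq_zero_of_notMem {v : CN M → ℂ} {x} (h : x ∉ tsupport v) (j) : dz j v x = 0 := by
  by_contra h0
  exact h (tsupport_dz_subset v j (subset_tsupport _ h0))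

lemma dzb_eq_zero_of_notMem {v : CN M → ℂ} {x} (h : x ∉ tsupport v) (j) : dzb j v x = 0 := by
  by_contra h0
  exact h (tsupport_dzb_subset v j (subset_tsupport _ h0))

lemma int_of_cont_zero {f : CN M → ℝ} (hf : Continuous f) {K : Set (CN M)} (hK : IsCompact K)
    (h : ∀ x, x ∉ K → f x = 0) : Integrable f :=
  hf.integrable_of_hasCompactSupport (HasCompactSupport.intro hK h)

lemma norm_sq_sum_mul_le {ι : Type*} (s : Finset ι) (b a : ι → ℂ) :
    ‖∑ j ∈ s, b j * a j‖ ^ 2 ≤ (∑ j ∈ s, ‖b j‖ ^ 2) * ∑ j ∈ s, ‖a j‖ ^ 2 := by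
  have h1 : ‖∑ j ∈ s, b j * a j‖ ≤ ∑ j ∈ s, ‖b j‖ * ‖a j‖ := by
    refine (norm_sum_le _ _).trans (le_of_eq ?_)
    simp
  calc ‖∑ j ∈ s, b j * a j‖ ^ 2 ≤ (∑ j ∈ s, ‖b j‖ * ‖a j‖) ^ 2 := by gcongr
    _ ≤ _ := Finset.sum_mul_sq_le_sq_mul_sq s _ _

lemma norm_sub_sq_le_two (a b : ℂ) : ‖a - b‖ ^ 2 ≤ 2 * ‖a‖ ^ 2 + 2 * ‖b‖ ^ 2 := by
  have := norm_sub_le a b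
  nlinarith [norm_nonneg (a - b), norm_nonneg a, norm_nonneg b, sq_nonneg (‖a‖ - ‖b‖)]

lemma basic_est {φ ψ : CN M → ℝ} (hφ : ContDiff ℝ ∞ φ) (hψ : ContDiff ℝ ∞ ψ)
    {a : Fin M → CN M → ℂ}
    (ha : ∀ j, ContDiff ℝ ∞ (a j)) (hac : ∀ j, HasCompactSupport (a j))
    (hL : ∀ x, 2 * ((∑ j, ‖dz j (fun x => (ψ x : ℂ)) x‖ ^ 2) + Real.exp (ψ x)) * ∑ j, ‖a j x‖ ^ 2 ≤
      (∑ j, ∑ k, dz j (dzb k (fun x => (φ x : ℂ))) x * a j x * (starRingEnd ℂ) (a k x)).re) :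
    ∫ x, Real.exp (-φ x + ψ x) * ∑ j, ‖a j x‖ ^ 2 ≤
    (∫ x, Real.exp (-φ x) * ‖∑ j, (dz j (a j) x + (- dz j (fun x => (φ x : ℂ)) x +
        dz j (fun x => (ψ x : ℂ)) x) * a j x)‖ ^ 2) +
    (∫ x, Real.exp (-φ x) * (∑ j, ∑ k, ‖dzb j (a k) x - dzb k (a j) x‖ ^ 2)) / 4 := by
  have key := mkh_ineq hφ ha hac
  set Φ : CN M → ℂ := fun x => (φ x : ℂ) with hΦdef
  set Ψ : CN M → ℂ := fun x => (ψ x : ℂ) with hΨdef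
  have hΦ : ContDiff ℝ ∞ Φ := ofReal_contDiff hφ
  have hΨ : ContDiff ℝ ∞ Ψ := ofReal_contDiff hψ
  set K : Set (CN M) := ⋃ j, tsupport (a j)
  have hK : IsCompact K := isCompact_iUnion fun j => hac j
  have z0 : ∀ x, x ∉ K → ∀ j, x ∉ tsupport (a j) := fun x hx j hj => hx (mem_iUnion.2 ⟨j, hj⟩)
  have z1 : ∀ x, x ∉ K → ∀ j, a j x = 0 := fun x hx j => image_eq_zero_of_notMem_tsupport (z0 x hx j)
  have z2 : ∀ x, x ∉ K → ∀ i j, dz i (a j) x = 0 := fun x hx i j => dz_eq_zero_of_notMem (z0 x hx j) i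
  have z3 : ∀ x, x ∉ K → ∀ i j, dzb i (a j) x = 0 := fun x hx i j => dzb_eq_zero_of_notMem (z0 x hx j) i
  have cφ := hφ.continuous
  have cψ := hψ.continuous
  have ca := fun j => (ha j).continuous
  have c1 := fun i j => (dz_contDiff (ha j) i).continuous
  have c2 := fun i j => (dzb_contDiff (ha j) i).continuous
  have c3 := fun i => (dz_contDiff hΦ i).continuous
  have c4 := fun i => (dz_contDiff hΨ i).continuous
  have c5 := fun i j => (dz_contDiff (dzb_contDiff hΦ j) i).continuous
  have hdd : ∀ x, ∑ j, dlt Φ j (a j) x =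
      (∑ j, (dz j (a j) x + (- dz j Φ x + dz j Ψ x) * a j x)) - ∑ j, dz j Ψ x * a j x := by
    intro x
    rw [← Finset.sum_sub_distrib]
    refine Finset.sum_congr rfl fun j _ => ?_
    simp only [dlt]; ring
  -- integrabilities
  have I1 : Integrable (fun x => Real.exp (-φ x) * (2 * ((∑ j, ‖dz j Ψ x‖ ^ 2) + Real.exp (ψ x)) * ∑ j, ‖a j x‖ ^ 2)) := by
    refine int_of_cont_zero (by fun_prop) hK fun x hx => ?_
    simp [z1 x hx]
  have I2 : Integrable (fun x => Real.exp (-φ x) *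
      (∑ j, ∑ k, dz j (dzb k Φ) x * a j x * (starRingEnd ℂ) (a k x)).re) := by
    refine int_of_cont_zero ?_ hK fun x hx => ?_
    · have : ∀ k, Continuous fun x => (starRingEnd ℂ) (a k x) := fun k => (contDiff_conj (ha k)).continuous
      have h3 : Continuous fun x => (∑ j, ∑ k, dz j (dzb k Φ) x * a j x * (starRingEnd ℂ) (a k x)) := by fun_prop
      exact (by fun_prop : Continuous fun x => Real.exp (-φ x)).mul (Complex.continuous_re.comp h3)
    · simp [z1 x hx]
  have I3 : Integrable (fun x => Real.exp (-φ x) * ‖∑ j, (dz j (a j) x + (- dz j Φ x + dz j Ψ x) * a j x)‖ ^ 2) := by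
    refine int_of_cont_zero (by fun_prop) hK fun x hx => ?_
    simp [z1 x hx, z2 x hx]
  have I4 : Integrable (fun x => Real.exp (-φ x) * ((∑ j, ‖dz j Ψ x‖ ^ 2) * ∑ j, ‖a j x‖ ^ 2)) := by
    refine int_of_cont_zero (by fun_prop) hK fun x hx => ?_
    simp [z1 x hx]
  have I5 : Integrable (fun x => Real.exp (-φ x) * ‖∑ j, dlt Φ j (a j) x‖ ^ 2) := by
    simp only [dlt]
    refine int_of_cont_zero (by fun_prop) hK fun x hx => ?_
    simp [z1 x hx, z2 x hx]
  have I6 : Integrable (fun x => Real.exp (-φ x + ψ x) * ∑ j, ‖a j x‖ ^ 2) := by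
    refine int_of_cont_zero (by fun_prop) hK fun x hx => ?_
    simp [z1 x hx]
  have s1 : ∫ x, Real.exp (-φ x) * (2 * ((∑ j, ‖dz j Ψ x‖ ^ 2) + Real.exp (ψ x)) * ∑ j, ‖a j x‖ ^ 2) ≤
      ∫ x, Real.exp (-φ x) * (∑ j, ∑ k, dz j (dzb k Φ) x * a j x * (starRingEnd ℂ) (a k x)).re := by
    refine integral_mono I1 I2 fun x => ?_
    exact mul_le_mul_of_nonneg_left (hL x) (Real.exp_pos _).le
  have s2 : ∫ x, Real.exp (-φ x) * (2 * ((∑ j, ‖dz j Ψ x‖ ^ 2) + Real.exp (ψ x)) * ∑ j, ‖a j x‖ ^ 2) =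
     2 * (∫ x, Real.exp (-φ x) * ((∑ j, ‖dz j Ψ x‖ ^ 2) * ∑ j, ‖a j x‖ ^ 2)) +
     2 * ∫ x, Real.exp (-φ x + ψ x) * ∑ j, ‖a j x‖ ^ 2 := by
    rw [← integral_const_mul, ← integral_const_mul, ← integral_add (I4.const_mul 2) (I6.const_mul 2)]
    congr 1; funext x
    rw [Real.exp_add]; ring
  have s3 : ∫ x, Real.exp (-φ x) * ‖∑ j, dlt Φ j (a j) x‖ ^ 2 ≤
     2 * (∫ x, Real.exp (-φ x) * ‖∑ j, (dz j (a j) x + (- dz j Φ x + dz j Ψ x) * a j x)‖ ^ 2) +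
     2 * (∫ x, Real.exp (-φ x) * ((∑ j, ‖dz j Ψ x‖ ^ 2) * ∑ j, ‖a j x‖ ^ 2)) := by
    rw [← integral_const_mul, ← integral_const_mul, ← integral_add (I3.const_mul 2) (I4.const_mul 2)]
    refine integral_mono I5 ((I3.const_mul 2).add (I4.const_mul 2)) fun x => ?_
    simp only [hdd]
    have h1 := norm_sub_sq_le_two (∑ j, (dz j (a j) x + (- dz j Φ x + dz j Ψ x) * a j x)) (∑ j, dz j Ψ x * a j x)
    have h2 := norm_sq_sum_mul_le Finset.univ (fun j => dz j Ψ x) (fun j => a j x)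
    have h3 := (Real.exp_pos (-φ x))
    nlinarith
  have s4 : ∫ x, Real.exp (-φ x) * ((∑ j, ∑ k, ‖dzb j (a k) x - dzb k (a j) x‖ ^ 2) / 2) =
     (∫ x, Real.exp (-φ x) * (∑ j, ∑ k, ‖dzb j (a k) x - dzb k (a j) x‖ ^ 2)) / 2 := by
    rw [← integral_div]; congr 1; funext x; ring
  rw [s4] at key
  linarith

end basicest

section molker
open MeasureTheory
variable {M : ℕ}

/-- squared Euclidean norm -/
def nsq (z : CN M) : ℝ := ∑ i, ‖z i‖ ^ 2

lemma nsq_contDiff : ContDiff ℝ ∞ (nsq : CN M → ℝ) := by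
  unfold nsq
  refine ContDiff.sum fun i _ => ?_
  exact (contDiff_norm_sq ℝ).comp (contDiff_apply ℝ ℂ i)

lemma nsq_smul (c : ℂ) (z : CN M) : nsq (c • z) = ‖c‖ ^ 2 * nsq z := by
  simp [nsq, mul_pow, Finset.mul_sum]

lemma nsq_nonneg (z : CN M) : 0 ≤ nsq z := by unfold nsq; positivity

lemma nsq_zero : nsq (0 : CN M) = 0 := by simp [nsq]

lemma norm_sq_le_nsq (z : CN M) : ‖z‖ ^ 2 ≤ nsq z := by
  have h : ‖z‖ ≤ Real.sqrt (nsq z) := by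
    refine (pi_norm_le_iff_of_nonneg (Real.sqrt_nonneg _)).2 fun i => ?_
    refine Real.le_sqrt_of_sq_le ?_
    exact Finset.single_le_sum (f := fun i => ‖z i‖ ^ 2) (fun i _ => by positivity) (Finset.mem_univ i)
  calc ‖z‖ ^ 2 ≤ (Real.sqrt (nsq z)) ^ 2 := by gcongr
    _ = nsq z := Real.sq_sqrt (nsq_nonneg z)

lemma nsq_le_norm_sq (z : CN M) : nsq z ≤ M * ‖z‖ ^ 2 := by
  unfold nsq
  calc ∑ i, ‖z i‖ ^ 2 ≤ ∑ i : Fin M, ‖z‖ ^ 2 := by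
        refine Finset.sum_le_sum fun i _ => ?_
        have := norm_le_pi_norm z i
        gcongr
    _ = _ := by simp

/-- unnormalised kernel -/
def ker0 (ε : ℝ) (z : CN M) : ℝ := Real.smoothTransition (1 - nsq z / ε ^ 2)

lemma ker0_contDiff (ε : ℝ) : ContDiff ℝ ∞ (ker0 ε : CN M → ℝ) :=
  Real.smoothTransition.contDiff.comp (contDiff_const.sub (nsq_contDiff.div_const _))

lemma ker0_nonneg (ε : ℝ) (z : CN M) : 0 ≤ ker0 ε z := Real.smoothTransition.nonneg _

lemma ker0_zero_of {ε : ℝ} (hε : 0 < ε) {z : CN M} (h : ε ≤ ‖z‖) : ker0 ε z = 0 := by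
  refine Real.smoothTransition.zero_of_nonpos ?_
  have h1 := norm_sq_le_nsq z
  have h2 : ε ^ 2 ≤ ‖z‖ ^ 2 := by gcongr
  have : 1 ≤ nsq z / ε ^ 2 := by rw [le_div_iff₀ (by positivity)]; linarith
  linarith

lemma ker0_hcs {ε : ℝ} (hε : 0 < ε) : HasCompactSupport (ker0 ε : CN M → ℝ) := by
  refine HasCompactSupport.intro (isCompact_closedBall (0 : CN M) ε) fun x hx => ?_
  refine ker0_zero_of hε ?_
  simp at hx; exact hx.le

lemma ker0_int_pos {ε : ℝ} (hε : 0 < ε) : 0 < ∫ z : CN M, ker0 ε z := by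
  refine (ker0_contDiff ε).continuous.integral_pos_of_hasCompactSupport_nonneg_nonzero (ker0_hcs hε)
    (ker0_nonneg ε) (x := 0) ?_
  simp [ker0, nsq_zero, Real.smoothTransition.one_of_one_le]

/-- mollifier kernel, circle invariant -/
def ker (ε : ℝ) (z : CN M) : ℝ := ker0 ε z / ∫ z : CN M, ker0 ε z

lemma ker_contDiff (ε : ℝ) : ContDiff ℝ ∞ (ker ε : CN M → ℝ) := (ker0_contDiff ε).div_const _

lemma ker_nonneg (ε : ℝ) (z : CN M) : 0 ≤ ker ε z :=
  div_nonneg (ker0_nonneg ε z) (integral_nonneg (ker0_nonneg ε))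

lemma ker_zero_of {ε : ℝ} (hε : 0 < ε) {z : CN M} (h : ε ≤ ‖z‖) : ker ε z = 0 := by
  simp [ker, ker0_zero_of hε h]

lemma ker_hcs {ε : ℝ} (hε : 0 < ε) : HasCompactSupport (ker ε : CN M → ℝ) := by
  refine HasCompactSupport.intro (isCompact_closedBall (0 : CN M) ε) fun x hx => ?_
  refine ker_zero_of hε ?_
  simp at hx; exact hx.le

lemma ker_integral {ε : ℝ} (hε : 0 < ε) : ∫ z : CN M, ker ε z = 1 := by
  unfold ker
  rw [integral_div, div_self (ker0_int_pos hε).ne']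

lemma ker_smul (ε : ℝ) {c : ℂ} (hc : ‖c‖ = 1) (z : CN M) : ker ε (c • z) = ker ε z := by
  simp [ker, ker0, nsq_smul, hc]

lemma ker_neg (ε : ℝ) (z : CN M) : ker ε (-z) = ker ε z := by
  simpa using ker_smul ε (c := -1) (by simp) z

lemma ker_integrable {ε : ℝ} (hε : 0 < ε) : Integrable (ker ε : CN M → ℝ) :=
  (ker_contDiff ε).continuous.integrable_of_hasCompactSupport (ker_hcs hε)

/-- complex valued kernel -/
def kerC (ε : ℝ) (z : CN M) : ℂ := (ker ε z : ℂ)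

lemma kerC_contDiff (ε : ℝ) : ContDiff ℝ ∞ (kerC ε : CN M → ℂ) := ofReal_contDiff (ker_contDiff ε)

lemma kerC_zero_of {ε : ℝ} (hε : 0 < ε) {z : CN M} (h : ε ≤ ‖z‖) : kerC ε z = 0 := by
  simp [kerC, ker_zero_of hε h]

lemma kerC_hcs {ε : ℝ} (hε : 0 < ε) : HasCompactSupport (kerC ε : CN M → ℂ) :=
  HasCompactSupport.intro (isCompact_closedBall (0 : CN M) ε) fun x hx =>
    kerC_zero_of hε (by simp at hx; exact hx.le)

/-- mollification -/
def mol (ε : ℝ) (f : CN M → ℂ) (x : CN M) : ℂ := ∫ y, f y * kerC ε (x - y)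

lemma mol_eq_conv (ε : ℝ) (f : CN M → ℂ) :
    mol ε f = convolution f (kerC ε) (ContinuousLinearMap.mul ℝ ℂ) volume := rfl

lemma mol_contDiff {ε : ℝ} (hε : 0 < ε) {f : CN M → ℂ} (hf : LocallyIntegrable f) :
    ContDiff ℝ ∞ (mol ε f) := by
  rw [mol_eq_conv]
  exact (kerC_hcs hε).contDiff_convolution_right _ hf (kerC_contDiff ε)

lemma conv_fderiv {g : CN M → ℂ} (hg : ContDiff ℝ ∞ g) (hgc : HasCompactSupport g) {f : CN M → ℂ}
    (hf : LocallyIntegrable f) (x e : CN M) :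
    fderiv ℝ (fun x => ∫ y, f y * g (x - y)) x e = ∫ y, f y * fderiv ℝ g (x - y) e := by
  have h := hgc.hasFDerivAt_convolution_right (ContinuousLinearMap.mul ℝ ℂ) hf
    (hg.of_le (by exact_mod_cast le_top)) x
  have h2 := h.fderiv
  have h3 := DFunLike.congr_fun h2 e
  rw [convolution_precompR_apply _ hf (hgc.fderiv ℝ) (hg.continuous_fderiv (by simp))] at h3
  exact h3

lemma int_conv {g : CN M → ℂ} (hg : Continuous g) (hgc : HasCompactSupport g) {f : CN M → ℂ}
    (hf : LocallyIntegrable f) (x : CN M) : Integrable (fun y => f y * g (x - y)) :=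
  hgc.convolutionExists_right (ContinuousLinearMap.mul ℝ ℂ) hf hg x

lemma conv_dz {g : CN M → ℂ} (hg : ContDiff ℝ ∞ g) (hgc : HasCompactSupport g) {f : CN M → ℂ}
    (hf : LocallyIntegrable f) (x : CN M) (j) :
    dz j (fun x => ∫ y, f y * g (x - y)) x = ∫ y, f y * dz j g (x - y) := by
  have hc : ∀ e, Continuous fun x => fderiv ℝ g x e := fun e =>
    (hg.continuous_fderiv (by simp)).clm_apply continuous_const
  have hs : ∀ e, HasCompactSupport fun x => fderiv ℝ g x e := fun e => hgc.fderiv_apply ℝ e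
  rw [dz, conv_fderiv hg hgc hf, conv_fderiv hg hgc hf, ← integral_const_mul, ← integral_sub
    (int_conv (hc _) (hs _) hf x) ((int_conv (hc _) (hs _) hf x).const_mul _), ← integral_div]
  congr 1; funext y; simp only [dz]; ring

lemma conv_dzb {g : CN M → ℂ} (hg : ContDiff ℝ ∞ g) (hgc : HasCompactSupport g) {f : CN M → ℂ}
    (hf : LocallyIntegrable f) (x : CN M) (j) :
    dzb j (fun x => ∫ y, f y * g (x - y)) x = ∫ y, f y * dzb j g (x - y) := by
  have hc : ∀ e, Continuous fun x => fderiv ℝ g x e := fun e =>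
    (hg.continuous_fderiv (by simp)).clm_apply continuous_const
  have hs : ∀ e, HasCompactSupport fun x => fderiv ℝ g x e := fun e => hgc.fderiv_apply ℝ e
  rw [dzb, conv_fderiv hg hgc hf, conv_fderiv hg hgc hf, ← integral_const_mul, ← integral_add
    (int_conv (hc _) (hs _) hf x) ((int_conv (hc _) (hs _) hf x).const_mul _), ← integral_div]
  congr 1; funext y; simp only [dzb]; ring

lemma fderiv_reflect {g : CN M → ℂ} (hg : ContDiff ℝ ∞ g) (x y e : CN M) :
    fderiv ℝ (fun y => g (x - y)) y e = - fderiv ℝ g (x - y) e := by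
  have h := ((hg.differentiable (by simp)) (x - y)).hasFDerivAt.comp y
    ((hasFDerivAt_id y).const_sub x)
  have h3 := DFunLike.congr_fun h.fderiv e
  simpa [Function.comp_def] using h3

lemma dz_reflect {g : CN M → ℂ} (hg : ContDiff ℝ ∞ g) (x y : CN M) (j) :
    dz j (fun y => g (x - y)) y = - dz j g (x - y) := by
  simp only [dz, fderiv_reflect hg]; ring

lemma dzb_reflect {g : CN M → ℂ} (hg : ContDiff ℝ ∞ g) (x y : CN M) (j) :
    dzb j (fun y => g (x - y)) y = - dzb j g (x - y) := by
  simp only [dzb, fderiv_reflect hg]; ring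

lemma reflect_contDiff {g : CN M → ℂ} (hg : ContDiff ℝ ∞ g) (x : CN M) :
    ContDiff ℝ ∞ (fun y => g (x - y)) := hg.comp (contDiff_const.sub contDiff_id)

lemma reflect_hcs {g : CN M → ℂ} (hg : HasCompactSupport g) (x : CN M) :
    HasCompactSupport (fun y => g (x - y)) := hg.comp_homeomorph (Homeomorph.subLeft x)

lemma mol_dz {ε : ℝ} (hε : 0 < ε) {f : CN M → ℂ} (hf : LocallyIntegrable f) (x : CN M) (j) :
    dz j (mol ε f) x = - ∫ y, f y * dz j (fun y => kerC ε (x - y)) y := by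
  have := conv_dz (kerC_contDiff ε) (kerC_hcs hε) hf x j
  rw [show mol ε f = fun x => ∫ y, f y * kerC ε (x - y) from rfl, this, ← integral_neg]
  congr 1; funext y; rw [dz_reflect (kerC_contDiff ε)]; ring

lemma mol_dzb {ε : ℝ} (hε : 0 < ε) {f : CN M → ℂ} (hf : LocallyIntegrable f) (x : CN M) (j) :
    dzb j (mol ε f) x = - ∫ y, f y * dzb j (fun y => kerC ε (x - y)) y := by
  have := conv_dzb (kerC_contDiff ε) (kerC_hcs hε) hf x j
  rw [show mol ε f = fun x => ∫ y, f y * kerC ε (x - y) from rfl, this, ← integral_neg]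
  congr 1; funext y; rw [dzb_reflect (kerC_contDiff ε)]; ring

lemma mol_eq_translate (ε : ℝ) (f : CN M → ℂ) (x : CN M) :
    mol ε f x = ∫ t, f (x - t) * kerC ε t := by
  rw [mol, ← integral_sub_left_eq_self (fun y => f y * kerC ε (x - y)) volume x]
  simp

lemma mol_zero_of {ε : ℝ} (hε : 0 < ε) {f : CN M → ℂ} {x : CN M}
    (h : ∀ y, ‖x - y‖ < ε → f y = 0) : mol ε f x = 0 := by
  unfold mol
  rw [← integral_zero (CN M) ℂ]
  congr 1; funext y
  by_cases hy : ‖x - y‖ < ε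
  · simp [h y hy]
  · simp [kerC_zero_of hε (not_lt.1 hy)]

end molker

section l2conv
open MeasureTheory Filter
open scoped ENNReal
variable {M : ℕ}

lemma eLpNorm_two_sq {α : Type*} {m : MeasurableSpace α} (μ : Measure α) (f : α → ℂ) :
    eLpNorm f 2 μ ^ 2 = ∫⁻ x, ‖f x‖ₑ ^ 2 ∂μ := by
  rw [eLpNorm_eq_lintegral_rpow_enorm_toReal (by norm_num) (by norm_num), ← ENNReal.rpow_natCast,
    ← ENNReal.rpow_mul]
  simp

lemma trans_cont {f : CN M → ℂ} (hf : MemLp f 2) :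
    Tendsto (fun t : CN M => eLpNorm (fun x => f (x - t) - f x) 2 volume) (𝓝 0) (𝓝 0) := by
  set G : C(CN M, C(CN M, CN M)) :=
    (ContinuousMap.mk (fun a : CN M × CN M => a.2 - a.1) (by fun_prop)).curry with hG
  have hmp : ∀ t : CN M, MeasurePreserving (G t) (volume : Measure (CN M)) volume := fun t =>
    measurePreserving_sub_right volume t
  have h1 : Continuous fun t : CN M => Lp.compMeasurePreserving (G t) (hmp t) (hf.toLp f) :=
    Continuous.compMeasurePreservingLp continuous_const G.continuous hmp (by norm_num)
  have h3 : ∀ t : CN M, Lp.compMeasurePreserving (G t) (hmp t) (hf.toLp f) =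
      (hf.comp_measurePreserving (hmp t)).toLp (f ∘ G t) := fun t =>
    Lp.toLp_compMeasurePreserving hf (hmp t)
  have h2 : Tendsto (fun t : CN M => Lp.compMeasurePreserving (G t) (hmp t) (hf.toLp f))
      (𝓝 0) (𝓝 (hf.toLp f)) := by
    have := h1.tendsto 0
    have e : Lp.compMeasurePreserving (G 0) (hmp 0) (hf.toLp f) = hf.toLp f := by
      rw [h3]
      refine MemLp.toLp_congr _ _ (ae_of_all _ fun x => ?_)
      simp [hG, ContinuousMap.curry]
    rwa [e] at this
  simp_rw [h3] at h2
  rw [Lp.tendsto_Lp_iff_tendsto_eLpNorm''] at h2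
  exact h2

lemma mol_congr_ae {f g : CN M → ℂ} (h : f =ᵐ[volume] g) (ε : ℝ) : mol ε f = mol ε g := by
  funext x
  refine integral_congr_ae ?_
  filter_upwards [h] with y hy
  rw [hy]

lemma mol_l2_bound_aux {ε : ℝ} (hε : 0 < ε) {f : CN M → ℂ} (hfm : Measurable f) (hf : LocallyIntegrable f)
    {δ : ℝ≥0∞} (h : ∀ t : CN M, ‖t‖ < ε → eLpNorm (fun x => f (x - t) - f x) 2 volume ≤ δ) :
    eLpNorm (mol ε f - f) 2 volume ≤ δ := by
  set ν : Measure (CN M) := volume.withDensity (fun t => ‖kerC ε t‖ₑ) with hν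
  have hkm : Measurable (fun t : CN M => ‖kerC ε t‖ₑ) := (kerC_contDiff ε).continuous.enorm.measurable
  have hk1 : ∫⁻ t : CN M, ‖kerC ε t‖ₑ = 1 := by
    have : ∀ t : CN M, ‖kerC ε t‖ₑ = ENNReal.ofReal (ker ε t) := by
      intro t
      rw [kerC, ← ofReal_norm, Complex.norm_real, Real.norm_of_nonneg (ker_nonneg ε t)]
    simp_rw [this]
    rw [← ofReal_integral_eq_lintegral_ofReal (ker_integrable hε) (ae_of_all _ (ker_nonneg ε)),
      ker_integral hε]; simp
  have : IsProbabilityMeasure ν := ⟨by rw [hν, withDensity_apply _ MeasurableSet.univ]; simpa using hk1⟩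
  have hpt : ∀ x, ‖mol ε f x - f x‖ₑ ^ 2 ≤ ∫⁻ t, ‖f (x - t) - f x‖ₑ ^ 2 ∂ν := by
    intro x
    have hm : Measurable fun t => f (x - t) - f x := (hfm.comp (measurable_const.sub measurable_id)).sub_const _
    have i1 : Integrable (fun t => f (x - t) * kerC ε t) := by
      have := (int_conv (kerC_contDiff (M := M) ε).continuous (kerC_hcs hε) hf x).comp_sub_left x
      simpa using this
    have i2 : Integrable (fun t => f x * kerC ε t) :=
      ((kerC_contDiff (M := M) ε).continuous.integrable_of_hasCompactSupport (kerC_hcs hε)).const_mul _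
    have e1 : mol ε f x - f x = ∫ t, (f (x - t) - f x) * kerC ε t := by
      have : ∫ t : CN M, kerC ε t = 1 := by
        unfold kerC
        rw [integral_complex_ofReal, ker_integral hε]; simp
      rw [mol_eq_translate]
      simp_rw [sub_mul]
      rw [integral_sub i1 i2, integral_const_mul, this, mul_one]
    have e2 : ‖mol ε f x - f x‖ₑ ≤ ∫⁻ t, ‖f (x - t) - f x‖ₑ ∂ν := by
      rw [e1]
      refine (enorm_integral_le_lintegral_enorm _).trans (le_of_eq ?_)
      rw [hν, lintegral_withDensity_eq_lintegral_mul _ hkm hm.enorm]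
      congr 1; funext t; simp [mul_comm]
    have e3 := eLpNorm_le_eLpNorm_of_exponent_le (p := 1) (q := 2) (μ := ν) (by norm_num) hm.aestronglyMeasurable
    rw [eLpNorm_one_eq_lintegral_enorm] at e3
    calc ‖mol ε f x - f x‖ₑ ^ 2 ≤ (eLpNorm (fun t => f (x - t) - f x) 2 ν) ^ 2 := by
          gcongr; exact e2.trans e3
      _ = _ := eLpNorm_two_sq _ _
  have hsq : eLpNorm (mol ε f - f) 2 volume ^ 2 ≤ δ ^ 2 := by
    rw [eLpNorm_two_sq]
    calc ∫⁻ x, ‖(mol ε f - f) x‖ₑ ^ 2 ≤ ∫⁻ x, ∫⁻ t, ‖f (x - t) - f x‖ₑ ^ 2 ∂ν := lintegral_mono hpt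
      _ = ∫⁻ t, (∫⁻ x, ‖f (x - t) - f x‖ₑ ^ 2 ∂volume) ∂ν := by
        refine lintegral_lintegral_swap (Measurable.aemeasurable ?_)
        refine Measurable.pow_const (Measurable.enorm ?_) 2
        exact (hfm.comp (measurable_fst.sub measurable_snd)).sub (hfm.comp measurable_fst)
      _ = ∫⁻ t, ‖kerC ε t‖ₑ * ∫⁻ x, ‖f (x - t) - f x‖ₑ ^ 2 := by
        rw [hν, lintegral_withDensity_eq_lintegral_mul _ hkm]
        · rfl
        · refine Measurable.lintegral_prod_right' (f := fun p : CN M × CN M => ‖f (p.2 - p.1) - f p.2‖ₑ ^ 2) ?_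
          refine Measurable.pow_const (Measurable.enorm ?_) 2
          exact (hfm.comp (measurable_snd.sub measurable_fst)).sub (hfm.comp measurable_snd)
      _ ≤ ∫⁻ t : CN M, ‖kerC ε t‖ₑ * δ ^ 2 := by
        refine lintegral_mono fun t => ?_
        simp only
        by_cases ht : ‖t‖ < ε
        · rw [← eLpNorm_two_sq]
          gcongr
          exact h t ht
        · simp [kerC_zero_of hε (not_lt.1 ht)]
      _ = δ ^ 2 := by rw [lintegral_mul_const _ hkm, hk1, one_mul]
  exact (ENNReal.pow_le_pow_left_iff (by norm_num)).1 hsq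

lemma mol_l2_bound {ε : ℝ} (hε : 0 < ε) {f : CN M → ℂ} (hf : MemLp f 2)
    {δ : ℝ≥0∞} (h : ∀ t : CN M, ‖t‖ < ε → eLpNorm (fun x => f (x - t) - f x) 2 volume ≤ δ) :
    eLpNorm (mol ε f - f) 2 volume ≤ δ := by
  obtain ⟨g, hg, hfg⟩ := hf.1.aemeasurable
  have hg2 : MemLp g 2 := (memLp_congr_ae hfg).1 hf
  have e1 : eLpNorm (mol ε f - f) 2 volume = eLpNorm (mol ε g - g) 2 volume := by
    rw [mol_congr_ae hfg]
    exact eLpNorm_congr_ae (hfg.mono fun x hx => by simp [hx])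
  rw [e1]
  refine mol_l2_bound_aux hε hg (hg2.locallyIntegrable (by norm_num)) fun t ht => ?_
  refine le_trans (le_of_eq ?_) (h t ht)
  refine eLpNorm_congr_ae ?_
  have := (measurePreserving_sub_right volume t).quasiMeasurePreserving.ae_eq_comp hfg
  filter_upwards [hfg, this] with x hx hx2
  simp only [Function.comp] at hx2
  rw [hx, hx2]

/-- mollification scales -/
def eps (n : ℕ) : ℝ := 1 / ((n : ℝ) + 1)

lemma eps_pos (n : ℕ) : 0 < eps n := by unfold eps; positivity

lemma eps_tendsto : Tendsto eps atTop (𝓝 0) := tendsto_one_div_add_atTop_nhds_zero_nat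

/-- L2 convergence -/
def L2c (fn : ℕ → CN M → ℂ) (f : CN M → ℂ) : Prop :=
  (∀ n, MemLp (fn n) 2) ∧ MemLp f 2 ∧ Tendsto (fun n => eLpNorm (fn n - f) 2 volume) atTop (𝓝 0)

lemma L2c_mol {f : CN M → ℂ} (hf : MemLp f 2) : L2c (fun n => mol (eps n) f) f := by
  have hloc := hf.locallyIntegrable (by norm_num)
  have key : ∀ δ : ℝ≥0∞, 0 < δ → ∃ r > 0, ∀ ε : ℝ, 0 < ε → ε ≤ r → eLpNorm (mol ε f - f) 2 volume ≤ δ := by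
    intro δ hδ
    have := (ENNReal.tendsto_nhds_zero.1 (trans_cont hf)) δ hδ
    obtain ⟨r, hr, h⟩ := Metric.eventually_nhds_iff.1 this
    refine ⟨r, hr, fun ε hε hεr => mol_l2_bound hε hf fun t ht => h ?_⟩
    simpa using ht.trans_le hεr
  refine ⟨fun n => ?_, hf, ?_⟩
  · have hn : eLpNorm f 2 volume < ⊤ := hf.2
    have hb : eLpNorm (mol (eps n) f - f) 2 volume ≤ 2 * eLpNorm f 2 volume := by
      refine mol_l2_bound (eps_pos n) hf fun t _ => ?_
      have mp := measurePreserving_sub_right (volume : Measure (CN M)) t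
      have h1 : MemLp (fun x => f (x - t)) 2 := hf.comp_measurePreserving mp
      refine (eLpNorm_sub_le h1.1 hf.1 (by norm_num)).trans ?_
      have : eLpNorm (fun x => f (x - t)) 2 volume = eLpNorm f 2 volume :=
        eLpNorm_comp_measurePreserving hf.1 mp
      rw [this, two_mul]
    have hm : MemLp (mol (eps n) f - f) 2 :=
      ⟨(mol_contDiff (eps_pos n) hloc).continuous.aestronglyMeasurable.sub hf.1,
        hb.trans_lt (ENNReal.mul_lt_top (by norm_num) hn)⟩
    have := hm.add hf
    simpa using this
  · rw [ENNReal.tendsto_nhds_zero]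
    intro δ hδ
    obtain ⟨r, hr, h⟩ := key δ hδ
    filter_upwards [eps_tendsto.eventually (Iic_mem_nhds hr)] with n hn
    exact h _ (eps_pos n) hn

lemma L2c.add {fn gn : ℕ → CN M → ℂ} {f g} (hf : L2c fn f) (hg : L2c gn g) :
    L2c (fun n x => fn n x + gn n x) (fun x => f x + g x) := by
  refine ⟨fun n => (hf.1 n).add (hg.1 n), hf.2.1.add hg.2.1, ?_⟩
  have h0 := hf.2.2.add hg.2.2
  rw [add_zero] at h0
  refine tendsto_of_tendsto_of_tendsto_of_le_of_le tendsto_const_nhds h0 (fun _ => zero_le) fun n => ?_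
  have := eLpNorm_add_le ((hf.1 n).sub hf.2.1).1 ((hg.1 n).sub hg.2.1).1 (p := 2) (by norm_num)
  refine le_trans (le_of_eq ?_) this
  congr 1; funext x; simp; ring

lemma memLp_bdd_mul {b f : CN M → ℂ} (hb : Continuous b) {C : ℝ} (hC : ∀ x, ‖b x‖ ≤ C) (hf : MemLp f 2) :
    MemLp (fun x => b x * f x) 2 := by
  refine MemLp.of_le_mul (c := C) hf (hb.aestronglyMeasurable.mul hf.1) (ae_of_all _ fun x => ?_)
  rw [norm_mul]
  exact mul_le_mul_of_nonneg_right (hC x) (norm_nonneg _)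

lemma L2c.bdd_mul {fn : ℕ → CN M → ℂ} {f b} (hf : L2c fn f) (hb : Continuous b) {C : ℝ}
    (hC : ∀ x, ‖b x‖ ≤ C) : L2c (fun n x => b x * fn n x) (fun x => b x * f x) := by
  refine ⟨fun n => memLp_bdd_mul hb hC (hf.1 n), memLp_bdd_mul hb hC hf.2.1, ?_⟩
  have h0 := ENNReal.Tendsto.const_mul (a := ENNReal.ofReal C) hf.2.2 (Or.inr (by simp))
  rw [mul_zero] at h0
  refine tendsto_of_tendsto_of_tendsto_of_le_of_le tendsto_const_nhds h0 (fun _ => zero_le) fun n => ?_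
  refine eLpNorm_le_mul_eLpNorm_of_ae_le_mul (ae_of_all _ fun x => ?_) 2
  simp only [Pi.sub_apply]
  rw [← mul_sub, norm_mul]
  exact mul_le_mul_of_nonneg_right (hC x) (norm_nonneg _)

lemma L2c_zero : L2c (fun _ (_ : CN M) => 0) (fun _ => 0) := by
  refine ⟨fun n => MemLp.zero', MemLp.zero', ?_⟩
  have : ∀ n : ℕ, eLpNorm ((fun _ => (0 : ℂ)) - (fun _ : CN M => (0 : ℂ))) 2 volume = 0 := by
    intro n; rw [sub_self]; simp
  exact tendsto_const_nhds.congr fun n => (this n).symm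

lemma L2c_sum {ι : Type*} (s : Finset ι) {fn : ι → ℕ → CN M → ℂ} {f : ι → CN M → ℂ}
    (h : ∀ i, L2c (fn i) (f i)) : L2c (fun n x => ∑ i ∈ s, fn i n x) (fun x => ∑ i ∈ s, f i x) := by
  classical
  induction s using Finset.induction_on with
  | empty => simpa using L2c_zero
  | insert a s ha ih =>
    simp only [Finset.sum_insert ha]
    exact (h a).add ih

lemma memLp_int_sq {f : CN M → ℂ} (hf : MemLp f 2) : ∫ x, ‖f x‖ ^ 2 = ‖hf.toLp f‖ ^ 2 := by
  rw [Lp.norm_toLp, hf.eLpNorm_eq_integral_rpow_norm (by norm_num) (by norm_num)]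
  have h0 : 0 ≤ ∫ x, ‖f x‖ ^ 2 := integral_nonneg fun x => by positivity
  have : ∫ a, ‖f a‖ ^ (2 : ℝ≥0∞).toReal = ∫ x, ‖f x‖ ^ 2 := by simp
  rw [this, ENNReal.toReal_ofReal (by positivity), ← Real.rpow_natCast, ← Real.rpow_mul h0]
  simp

lemma L2c.int_tendsto {fn : ℕ → CN M → ℂ} {f} (hf : L2c fn f) {W : CN M → ℝ} (hW : Continuous W)
    (hW0 : ∀ x, 0 ≤ W x) {C : ℝ} (hC : ∀ x, W x ≤ C) :
    Tendsto (fun n => ∫ x, W x * ‖fn n x‖ ^ 2) atTop (𝓝 (∫ x, W x * ‖f x‖ ^ 2)) := by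
  set b : CN M → ℂ := fun x => ((Real.sqrt (W x) : ℝ) : ℂ) with hb
  have hbc : Continuous b := Complex.continuous_ofReal.comp hW.sqrt
  have hbC : ∀ x, ‖b x‖ ≤ Real.sqrt C := fun x => by
    simp only [hb, Complex.norm_real, Real.norm_of_nonneg (Real.sqrt_nonneg _)]
    exact Real.sqrt_le_sqrt (hC x)
  have h1 := hf.bdd_mul hbc hbC
  have e : ∀ (g : CN M → ℂ) x, W x * ‖g x‖ ^ 2 = ‖b x * g x‖ ^ 2 := by
    intro g x
    rw [norm_mul, mul_pow]
    simp only [hb, Complex.norm_real, Real.norm_of_nonneg (Real.sqrt_nonneg _), Real.sq_sqrt (hW0 x)]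
  simp_rw [e]
  have h2 := (Lp.tendsto_Lp_iff_tendsto_eLpNorm'' (fi := atTop) _ h1.1 _ h1.2.1).2 h1.2.2
  have h3 := (h2.norm.pow 2)
  rw [memLp_int_sq h1.2.1]
  refine h3.congr fun n => ?_
  rw [memLp_int_sq (h1.1 n)]

end l2conv

section weakbasic
open MeasureTheory Filter
variable {M : ℕ}

lemma memLp_int_W {f : CN M → ℂ} (hf : MemLp f 2) {W : CN M → ℝ} (hW : Continuous W)
    (hW0 : ∀ x, 0 ≤ W x) {C : ℝ} (hC : ∀ x, W x ≤ C) : Integrable (fun x => W x * ‖f x‖ ^ 2) := by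
  have h1 : Integrable (fun x => ‖f x‖ ^ 2) := (memLp_two_iff_integrable_sq_norm hf.1).1 hf
  refine Integrable.bdd_mul (c := C) h1 hW.aestronglyMeasurable (ae_of_all _ fun x => ?_)
  rw [Real.norm_of_nonneg (hW0 x)]; exact hC x

lemma L2c_sum_int {ι : Type*} (s : Finset ι) {fn : ι → ℕ → CN M → ℂ} {f : ι → CN M → ℂ}
    (h : ∀ i, L2c (fn i) (f i)) {W : CN M → ℝ} (hW : Continuous W)
    (hW0 : ∀ x, 0 ≤ W x) {C : ℝ} (hC : ∀ x, W x ≤ C) :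
    Tendsto (fun n => ∫ x, W x * ∑ i ∈ s, ‖fn i n x‖ ^ 2) atTop (𝓝 (∫ x, W x * ∑ i ∈ s, ‖f i x‖ ^ 2)) := by
  simp_rw [Finset.mul_sum]
  rw [integral_finsetSum _ fun i _ => memLp_int_W (h i).2.1 hW hW0 hC]
  have : ∀ n, ∫ x, ∑ i ∈ s, W x * ‖fn i n x‖ ^ 2 = ∑ i ∈ s, ∫ x, W x * ‖fn i n x‖ ^ 2 := fun n =>
    integral_finsetSum _ fun i _ => memLp_int_W ((h i).1 n) hW hW0 hC
  simp_rw [this]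
  exact tendsto_finsetSum _ fun i _ => (h i).int_tendsto hW hW0 hC

lemma bdd_of_hcs {f : CN M → ℂ} (hf : Continuous f) (hc : HasCompactSupport f) : ∃ C, ∀ x, ‖f x‖ ≤ C :=
  hf.bounded_above_of_compact_support hc

lemma exp_bdd_of_hcs {f : CN M → ℝ} (hf : Continuous f) (hc : HasCompactSupport f) :
    ∃ C, ∀ x, Real.exp (f x) ≤ C := by
  obtain ⟨C, hC⟩ := hf.bounded_above_of_compact_support hc
  refine ⟨Real.exp C, fun x => Real.exp_le_exp.2 ((le_abs_self _).trans (hC x))⟩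

lemma weak_basic {φ ψ : CN M → ℝ} (hφ : ContDiff ℝ ∞ φ) (hψ : ContDiff ℝ ∞ ψ)
    (hφc : HasCompactSupport φ) (hψc : HasCompactSupport ψ) {U K : Set (CN M)} (hU : IsOpen U)
    (hK : IsCompact K) (hKU : K ⊆ U)
    (hL : ∀ x ∈ U, ∀ ξ : Fin M → ℂ,
      2 * ((∑ j, ‖dz j (fun x => (ψ x : ℂ)) x‖ ^ 2) + Real.exp (ψ x)) * ∑ j, ‖ξ j‖ ^ 2 ≤
      (∑ j, ∑ k, dz j (dzb k (fun x => (φ x : ℂ))) x * ξ j * (starRingEnd ℂ) (ξ k)).re)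
    {a : Fin M → CN M → ℂ} {κ : CN M → ℂ} {σ : Fin M → Fin M → CN M → ℂ}
    (ha : ∀ j, MemLp (a j) 2) (hκ : MemLp κ 2) (hσ : ∀ j k, MemLp (σ j k) 2)
    (haK : ∀ j x, x ∉ K → a j x = 0)
    (hdiv : ∀ χ : CN M → ℂ, ContDiff ℝ ∞ χ → HasCompactSupport χ →
      ∫ x, ∑ j, a j x * dz j χ x = - ∫ x, κ x * χ x)
    (hcurl : ∀ j k, ∀ χ : CN M → ℂ, ContDiff ℝ ∞ χ → HasCompactSupport χ →
      ∫ x, (a k x * dzb j χ x - a j x * dzb k χ x) = - ∫ x, σ j k x * χ x) :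
    ∫ x, Real.exp (-φ x + ψ x) * ∑ j, ‖a j x‖ ^ 2 ≤
    (∫ x, Real.exp (-φ x) * ‖κ x + ∑ j, (- dz j (fun x => (φ x : ℂ)) x +
        dz j (fun x => (ψ x : ℂ)) x) * a j x‖ ^ 2) +
    (∫ x, Real.exp (-φ x) * (∑ j, ∑ k, ‖σ j k x‖ ^ 2)) / 4 := by
  obtain ⟨δ, hδ, hδU⟩ := hK.exists_thickening_subset_open hU hKU
  set Φ : CN M → ℂ := fun x => (φ x : ℂ) with hΦdef
  set Ψ : CN M → ℂ := fun x => (ψ x : ℂ) with hΨdef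
  have hΦ : ContDiff ℝ ∞ Φ := ofReal_contDiff hφ
  have hΨ : ContDiff ℝ ∞ Ψ := ofReal_contDiff hψ
  have hΦc : HasCompactSupport Φ := hφc.comp_left (g := fun r : ℝ => (r : ℂ)) (by simp)
  have hΨc : HasCompactSupport Ψ := hψc.comp_left (g := fun r : ℝ => (r : ℂ)) (by simp)
  have hal : ∀ j, LocallyIntegrable (a j) := fun j => (ha j).locallyIntegrable (by norm_num)
  have acs : ∀ n j, HasCompactSupport (mol (eps n) (a j)) := by
    intro n j
    refine HasCompactSupport.intro (hK.cthickening (r := eps n)) fun x hx => ?_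
    refine mol_zero_of (eps_pos n) fun y hy => haK j y fun hyK => hx ?_
    refine Metric.mem_cthickening_of_dist_le x y _ K hyK ?_
    rw [dist_eq_norm]; exact hy.le
  have asm : ∀ n j, ContDiff ℝ ∞ (mol (eps n) (a j)) := fun n j => mol_contDiff (eps_pos n) (hal j)
  -- integrability against smooth compactly supported
  have int1 : ∀ j, ∀ g : CN M → ℂ, Continuous g → HasCompactSupport g → Integrable (fun x => a j x * g x) := by
    intro j g hg hgc
    have := (hal j).integrable_smul_right_of_hasCompactSupport hg hgc
    simpa using this
  have e1 : ∀ n x, ∑ j, dz j (mol (eps n) (a j)) x = mol (eps n) κ x := by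
    intro n x
    have h := hdiv (fun y => kerC (eps n) (x - y)) (reflect_contDiff (kerC_contDiff _) x)
      (reflect_hcs (kerC_hcs (eps_pos n)) x)
    simp_rw [mol_dz (eps_pos n) (hal _)]
    rw [Finset.sum_neg_distrib, ← integral_finsetSum, h, neg_neg]; · rfl
    intro j _
    exact int1 j _ (dz_contDiff (reflect_contDiff (kerC_contDiff _) x) j).continuous
      (hcs_dz (reflect_hcs (kerC_hcs (eps_pos n)) x) j)
  have e2 : ∀ n x j k, dzb j (mol (eps n) (a k)) x - dzb k (mol (eps n) (a j)) x = mol (eps n) (σ j k) x := by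
    intro n x j k
    have h := hcurl j k (fun y => kerC (eps n) (x - y)) (reflect_contDiff (kerC_contDiff _) x)
      (reflect_hcs (kerC_hcs (eps_pos n)) x)
    have ii : ∀ i l, Integrable fun y => a i y * dzb l (fun y => kerC (eps n) (x - y)) y := fun i l =>
      int1 i _ (dzb_contDiff (reflect_contDiff (kerC_contDiff _) x) l).continuous
      (hcs_dzb (reflect_hcs (kerC_hcs (eps_pos n)) x) l)
    rw [integral_sub (ii _ _) (ii _ _)] at h
    rw [mol_dzb (eps_pos n) (hal _), mol_dzb (eps_pos n) (hal _)]
    rw [neg_sub_neg, ← neg_sub, h, neg_neg]; rfl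
  have step : ∀ᶠ n in atTop, ∫ x, Real.exp (-φ x + ψ x) * ∑ j, ‖mol (eps n) (a j) x‖ ^ 2 ≤
    (∫ x, Real.exp (-φ x) * ‖mol (eps n) κ x + ∑ j, (- dz j Φ x + dz j Ψ x) * mol (eps n) (a j) x‖ ^ 2) +
    (∫ x, Real.exp (-φ x) * (∑ j, ∑ k, ‖mol (eps n) (σ j k) x‖ ^ 2)) / 4 := by
    filter_upwards [eps_tendsto.eventually (Iio_mem_nhds hδ)] with n hn
    have hb := basic_est hφ hψ (asm n) (acs n) ?_
    · refine hb.trans (le_of_eq (congrArg₂ (· + ·) (integral_congr_ae (ae_of_all _ fun x => ?_))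
        (congrArg (· / 4) (integral_congr_ae (ae_of_all _ fun x => ?_)))))
      · simp only [Finset.sum_add_distrib, e1]; rfl
      · simp only [e2]
    · intro x
      by_cases hx : x ∈ U
      · exact hL x hx (fun j => mol (eps n) (a j) x)
      · have : ∀ j, mol (eps n) (a j) x = 0 := by
          intro j
          refine mol_zero_of (eps_pos n) fun y hy => haK j y fun hyK => hx (hδU ?_)
          refine Metric.mem_thickening_iff.2 ⟨y, hyK, ?_⟩
          rw [dist_eq_norm]; exact hy.trans hn
        simp [this]
  have cφ := hφ.continuous
  have cψ := hψ.continuous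
  obtain ⟨C1, hC1⟩ := exp_bdd_of_hcs (f := fun x => -φ x) cφ.neg hφc.neg
  obtain ⟨C2, hC2⟩ := exp_bdd_of_hcs (f := fun x => -φ x + ψ x) (by fun_prop) (hφc.neg.add hψc)
  have l1 := L2c_sum_int Finset.univ (fun j => L2c_mol (ha j)) (W := fun x => Real.exp (-φ x + ψ x))
    (by fun_prop) (fun x => (Real.exp_pos _).le) hC2
  have l3 := L2c_sum_int Finset.univ (fun p : Fin M × Fin M => L2c_mol (hσ p.1 p.2)) (W := fun x => Real.exp (-φ x))
    (by fun_prop) (fun x => (Real.exp_pos _).le) hC1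
  simp_rw [← Finset.univ_product_univ, Finset.sum_product] at l3
  have l2' : ∀ j, L2c (fun n x => (- dz j Φ x + dz j Ψ x) * mol (eps n) (a j) x)
      (fun x => (- dz j Φ x + dz j Ψ x) * a j x) := by
    intro j
    have c3 := (dz_contDiff hΦ j).continuous
    have c4 := (dz_contDiff hΨ j).continuous
    obtain ⟨C, hC⟩ := bdd_of_hcs (f := fun x => - dz j Φ x + dz j Ψ x) (by fun_prop)
      ((hcs_dz hΦc j).neg.add (hcs_dz hΨc j))
    exact (L2c_mol (ha j)).bdd_mul (by fun_prop) hC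
  have l2 := ((L2c_mol hκ).add (L2c_sum Finset.univ l2')).int_tendsto (W := fun x => Real.exp (-φ x))
    (by fun_prop) (fun x => (Real.exp_pos _).le) hC1
  exact le_of_tendsto_of_tendsto l1 (l2.add (l3.div_const 4)) step

end weakbasic

section lemD
open MeasureTheory Filter
variable {M : ℕ}

lemma exists_cutoff {E : Type*} [NormedAddCommGroup E] [NormedSpace ℝ E] [FiniteDimensional ℝ E]
    {K Ω : Set E} (hK : IsCompact K) (hΩ : IsOpen Ω) (hKΩ : K ⊆ Ω) :
    ∃ χ : E → ℝ, ContDiff ℝ ∞ χ ∧ HasCompactSupport χ ∧ tsupport χ ⊆ Ω ∧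
      (∀ x, 0 ≤ χ x ∧ χ x ≤ 1) ∧ ∃ U : Set E, IsOpen U ∧ K ⊆ U ∧ U ⊆ Ω ∧ ∀ x ∈ U, χ x = 1 := by
  obtain ⟨L, hL, hKL, hLΩ⟩ := exists_compact_between hK hΩ hKΩ
  obtain ⟨g, hg1, hg2, hg3⟩ := exists_contMDiffMap_zero_one_nhds_of_isClosed
    (n := ⊤) (modelWithCornersSelf ℝ E) (s := (interior L)ᶜ) (t := K) isOpen_interior.isClosed_compl hK.isClosed
    (disjoint_left.2 fun x hx hx2 => hx (hKL hx2))
  have hts : tsupport g ⊆ L := by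
    refine closure_minimal (fun x hx => ?_) hL.isClosed
    by_contra hxL
    have : x ∈ (interior L)ᶜ := fun h => hxL (interior_subset h)
    exact hx (subset_of_mem_nhdsSet (s := (interior L)ᶜ) hg1 this)
  obtain ⟨U, hU, hKU, hU1⟩ := mem_nhdsSet_iff_exists.1 hg2
  refine ⟨g, g.contMDiff.contDiff, hL.of_isClosed_subset (isClosed_tsupport _) hts,
    hts.trans hLΩ, fun x => hg3 x, U ∩ Ω, hU.inter hΩ, subset_inter hKU hKΩ, inter_subset_right,
    fun x hx => hU1 hx.1⟩

lemma cutoff_mul_contDiff {E : Type*} [NormedAddCommGroup E] [NormedSpace ℝ E]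
    {χ g : E → ℝ} {Ω : Set E} (hχ : ContDiff ℝ ∞ χ) (h : tsupport χ ⊆ Ω)
    (hg : ∀ x ∈ Ω, ContDiffAt ℝ ∞ g x) : ContDiff ℝ ∞ (fun x => χ x * g x) := by
  refine contDiff_iff_contDiffAt.2 fun x => ?_
  by_cases hx2 : x ∈ tsupport χ
  · exact hχ.contDiffAt.mul (hg x (h hx2))
  · have := notMem_tsupport_iff_eventuallyEq.1 hx2
    refine (contDiffAt_const (c := (0 : ℝ))).congr_of_eventuallyEq ?_
    filter_upwards [this] with y hy
    simp [hy]

lemma norm_dz_le (v : CN M → ℂ) (j x) : ‖dz j v x‖ ≤ ‖fderiv ℝ v x‖ := by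
  have h1 : ‖fderiv ℝ v x (Pi.single j 1)‖ ≤ ‖fderiv ℝ v x‖ := by
    simpa [Pi.norm_single] using (fderiv ℝ v x).le_opNorm (Pi.single j 1)
  have h2 : ‖fderiv ℝ v x (Pi.single j Complex.I)‖ ≤ ‖fderiv ℝ v x‖ := by
    simpa [Pi.norm_single] using (fderiv ℝ v x).le_opNorm (Pi.single j Complex.I)
  unfold dz
  rw [norm_div]
  have h3 := norm_sub_le (fderiv ℝ v x (Pi.single j 1)) (Complex.I * fderiv ℝ v x (Pi.single j Complex.I))
  simp only [norm_mul, Complex.norm_I, one_mul, Complex.norm_ofNat] at h3 ⊢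
  linarith

lemma norm_dzb_le (v : CN M → ℂ) (j x) : ‖dzb j v x‖ ≤ ‖fderiv ℝ v x‖ := by
  have h1 : ‖fderiv ℝ v x (Pi.single j 1)‖ ≤ ‖fderiv ℝ v x‖ := by
    simpa [Pi.norm_single] using (fderiv ℝ v x).le_opNorm (Pi.single j 1)
  have h2 : ‖fderiv ℝ v x (Pi.single j Complex.I)‖ ≤ ‖fderiv ℝ v x‖ := by
    simpa [Pi.norm_single] using (fderiv ℝ v x).le_opNorm (Pi.single j Complex.I)
  unfold dzb
  rw [norm_div]
  have h3 := norm_add_le (fderiv ℝ v x (Pi.single j 1)) (Complex.I * fderiv ℝ v x (Pi.single j Complex.I))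
  simp only [norm_mul, Complex.norm_I, one_mul, Complex.norm_ofNat] at h3 ⊢
  linarith

/-- compactly supported multiplier of a weighted square integrable function -/
lemma memLp_loc {Ω : Set (CN M)} {w : CN M → ℝ} (hw : ContinuousOn w Ω) (hw0 : ∀ x, 0 < w x)
    {α : CN M → ℂ} (hαm : AEStronglyMeasurable α) (hαi : Integrable (fun x => w x * ‖α x‖ ^ 2))
    {b : CN M → ℂ} (hb : Continuous b) (hbc : HasCompactSupport b) (hbΩ : tsupport b ⊆ Ω) :
    MemLp (fun x => b x * α x) 2 := by
  obtain ⟨C, hC⟩ := bdd_of_hcs hb hbc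
  have hm : AEStronglyMeasurable (fun x => b x * α x) := hb.aestronglyMeasurable.mul hαm
  rw [memLp_two_iff_integrable_sq_norm hm]
  rcases (tsupport b).eq_empty_or_nonempty with he | hne
  · have : ∀ x, b x = 0 := fun x => image_eq_zero_of_notMem_tsupport (by simp [he])
    simp [this]
  obtain ⟨x0, hx0, hmin⟩ := hbc.exists_isMinOn hne (hw.mono hbΩ)
  have hc := hw0 x0
  refine Integrable.mono' (hαi.const_mul (C ^ 2 / w x0)) (hm.norm.pow 2) (ae_of_all _ fun x => ?_)
  by_cases hx : x ∈ tsupport b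
  · have h1 : w x0 ≤ w x := hmin hx
    rw [Real.norm_of_nonneg (by positivity), norm_mul, mul_pow]
    have h2 : ‖b x‖ ^ 2 ≤ C ^ 2 := by have := hC x; gcongr
    calc ‖b x‖ ^ 2 * ‖α x‖ ^ 2 ≤ C ^ 2 * ‖α x‖ ^ 2 := by gcongr
      _ = C ^ 2 / w x0 * (w x0 * ‖α x‖ ^ 2) := by field_simp
      _ ≤ _ := by gcongr
  · rw [image_eq_zero_of_notMem_tsupport hx]
    have := hw0 x
    simp; positivity

lemma int_loc {Ω : Set (CN M)} {w : CN M → ℝ} (hw : ContinuousOn w Ω) (hw0 : ∀ x, 0 < w x)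
    {α : CN M → ℂ} (hαm : AEStronglyMeasurable α) (hαi : Integrable (fun x => w x * ‖α x‖ ^ 2))
    {b : CN M → ℂ} (hb : Continuous b) (hbc : HasCompactSupport b) (hbΩ : tsupport b ⊆ Ω) :
    Integrable (fun x => b x * α x) := by
  have h1 := (memLp_loc hw hw0 hαm hαi hb hbc hbΩ).locallyIntegrable (by norm_num)
  have h2 := h1.integrableOn_isCompact hbc
  rwa [integrableOn_iff_integrable_of_support_subset] at h2
  intro x hx
  by_contra h
  exact hx (by simp [image_eq_zero_of_notMem_tsupport h])

lemma lemD_loc {Ω : Set (CN M)} (hΩ : IsOpen Ω) {φ ψ : CN M → ℝ}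
    (hφ : ∀ x ∈ Ω, ContDiffAt ℝ ∞ φ x) (hψ : ∀ x ∈ Ω, ContDiffAt ℝ ∞ ψ x)
    (hL : ∀ x ∈ Ω, ∀ ξ : Fin M → ℂ,
      2 * ((∑ j, ‖dz j (fun x => (ψ x : ℂ)) x‖ ^ 2) + Real.exp (ψ x)) * ∑ j, ‖ξ j‖ ^ 2 ≤
      (∑ j, ∑ k, dz j (dzb k (fun x => (φ x : ℂ))) x * ξ j * (starRingEnd ℂ) (ξ k)).re)
    {η : CN M → ℝ} (hη : ContDiff ℝ ∞ η) (hηc : HasCompactSupport η) (hηΩ : tsupport η ⊆ Ω)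
    {α : Fin M → CN M → ℂ} (hαm : ∀ j, AEStronglyMeasurable (α j))
    (hαi : ∀ j, Integrable (fun x => Real.exp (-φ x + ψ x) * ‖α j x‖ ^ 2))
    {τ : CN M → ℂ} (hτ : ContDiff ℝ ∞ τ)
    (hdiv : ∀ χ : CN M → ℂ, ContDiff ℝ ∞ χ → HasCompactSupport χ → tsupport χ ⊆ Ω →
      ∫ x, ∑ j, (Real.exp (-φ x + ψ x) : ℂ) * α j x * dz j χ x = - ∫ x, τ x * χ x)
    (hcurl : ∀ j k, ∀ χ : CN M → ℂ, ContDiff ℝ ∞ χ → HasCompactSupport χ → tsupport χ ⊆ Ω →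
      ∫ x, (α k x * dzb j χ x - α j x * dzb k χ x) = 0) :
    ∫ x, Real.exp (-φ x + ψ x) * ∑ j, ‖(η x : ℂ) * α j x‖ ^ 2 ≤
    (∫ x, Real.exp (-φ x) * ‖(η x : ℂ) * (Real.exp (φ x - ψ x) : ℂ) * τ x +
      ∑ j, dz j (fun x => (η x : ℂ)) x * α j x‖ ^ 2) +
    (∫ x, Real.exp (-φ x) * (∑ j, ∑ k, ‖dzb j (fun x => (η x : ℂ)) x * α k x -
      dzb k (fun x => (η x : ℂ)) x * α j x‖ ^ 2)) / 4 := by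
  obtain ⟨χ, hχ, hχc, hχΩ, hχ01, U, hU, hKU, hUΩ, hχ1⟩ := exists_cutoff hηc hΩ hηΩ
  have hφ' := cutoff_mul_contDiff hχ hχΩ hφ
  have hψ' := cutoff_mul_contDiff hχ hχΩ hψ
  set φ' : CN M → ℝ := fun x => χ x * φ x with hφ'def
  set ψ' : CN M → ℝ := fun x => χ x * ψ x with hψ'def
  have hφ'c : HasCompactSupport φ' := hχc.mul_right
  have hψ'c : HasCompactSupport ψ' := hχc.mul_right
  have eφ : ∀ x ∈ U, φ' x = φ x := fun x hx => by simp [hφ'def, hχ1 x hx]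
  have eψ : ∀ x ∈ U, ψ' x = ψ x := fun x hx => by simp [hψ'def, hχ1 x hx]
  have eΦ : ∀ x ∈ U, (fun x => (φ' x : ℂ)) =ᶠ[𝓝 x] (fun x => (φ x : ℂ)) := fun x hx => by
    filter_upwards [hU.mem_nhds hx] with y hy; rw [eφ y hy]
  have eΨ : ∀ x ∈ U, (fun x => (ψ' x : ℂ)) =ᶠ[𝓝 x] (fun x => (ψ x : ℂ)) := fun x hx => by
    filter_upwards [hU.mem_nhds hx] with y hy; rw [eψ y hy]
  have hL' : ∀ x ∈ U, ∀ ξ : Fin M → ℂ,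
      2 * ((∑ j, ‖dz j (fun x => (ψ' x : ℂ)) x‖ ^ 2) + Real.exp (ψ' x)) * ∑ j, ‖ξ j‖ ^ 2 ≤
      (∑ j, ∑ k, dz j (dzb k (fun x => (φ' x : ℂ))) x * ξ j * (starRingEnd ℂ) (ξ k)).re := by
    intro x hx ξ
    have := hL x (hUΩ hx) ξ
    simp only [dz_congr (eΨ x hx), eψ x hx]
    simpa only [dz_congr (dzb_congr' (eΦ x hx) _)] using this
  set H : CN M → ℂ := fun x => (η x : ℂ) with hHdef
  have hH : ContDiff ℝ ∞ H := ofReal_contDiff hη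
  have hts : tsupport H ⊆ tsupport η := tsupport_comp_subset (g := fun r : ℝ => (r : ℂ)) (by simp) η
  have hHc : HasCompactSupport H := hηc.of_isClosed_subset (isClosed_tsupport _) hts
  have hHΩ : tsupport H ⊆ Ω := hts.trans hηΩ
  have hw : ContinuousOn (fun x => Real.exp (-φ x + ψ x)) Ω := fun x hx =>
    (Real.continuous_exp.continuousAt.comp
      ((hφ x hx).continuousAt.neg.add (hψ x hx).continuousAt)).continuousWithinAt
  have hw0 : ∀ x, 0 < Real.exp (-φ x + ψ x) := fun x => Real.exp_pos _
  have mem := fun j (b : CN M → ℂ) h1 h2 h3 => memLp_loc hw hw0 (hαm j) (hαi j) (b := b) h1 h2 h3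
  have itg := fun j (b : CN M → ℂ) h1 h2 h3 => int_loc hw hw0 (hαm j) (hαi j) (b := b) h1 h2 h3
  have offH : ∀ x, x ∉ U → H x = 0 := fun x hx => by
    have : η x = 0 := image_eq_zero_of_notMem_tsupport fun h => hx (hKU h)
    simp [hHdef, this]
  have offHz : ∀ x, x ∉ U → ∀ j, dz j H x = 0 := fun x hx j =>
    dz_eq_zero_of_notMem (fun h => hx (hKU (hts h))) j
  have offHzb : ∀ x, x ∉ U → ∀ j, dzb j H x = 0 := fun x hx j =>
    dzb_eq_zero_of_notMem (fun h => hx (hKU (hts h))) j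
  set E : CN M → ℂ := cW (fun x => ψ' x - φ' x) with hEdef
  have hE : ContDiff ℝ ∞ E := cW_contDiff (hψ'.sub hφ')
  have dzE : ∀ j x, dz j E x = E x * (dz j (fun x => (φ' x : ℂ)) x - dz j (fun x => (ψ' x : ℂ)) x) := by
    intro j x
    rw [hEdef, dz_cW (hψ'.sub hφ')]
    have h1 := dz_sub ((ofReal_contDiff hψ').differentiable (by simp) x)
      ((ofReal_contDiff hφ').differentiable (by simp) x) j
    have : (fun x => ((ψ' x - φ' x : ℝ) : ℂ)) = fun x => (ψ' x : ℂ) - (φ' x : ℂ) := by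
      funext x; push_cast; rfl
    rw [this, h1]; ring
  have hΦ' := ofReal_contDiff hφ'
  have hΨ' := ofReal_contDiff hψ'
  have key := weak_basic hφ' hψ' hφ'c hψ'c (U := U) (K := tsupport η) hU hηc hKU hL'
    (a := fun j x => H x * α j x)
    (κ := fun x => H x * E x * τ x + ∑ j, dz j H x * α j x +
      ∑ j, (dz j (fun x => (φ' x : ℂ)) x - dz j (fun x => (ψ' x : ℂ)) x) * (H x * α j x))
    (σ := fun j k x => dzb j H x * α k x - dzb k H x * α j x)
    (fun j => mem j H hH.continuous hHc hHΩ) ?_ ?_ ?_ ?_ ?_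
  · have hEU : ∀ x ∈ U, E x = (Real.exp (φ x - ψ x) : ℂ) := fun x hx => by
      simp only [hEdef, cW, eφ x hx, eψ x hx, neg_sub]
    have e1 : ∀ x, Real.exp (-φ' x + ψ' x) * ∑ j, ‖H x * α j x‖ ^ 2 =
        Real.exp (-φ x + ψ x) * ∑ j, ‖H x * α j x‖ ^ 2 := by
      intro x
      by_cases hx : x ∈ U
      · rw [eφ x hx, eψ x hx]
      · simp [offH x hx]
    have e2 : ∀ x, Real.exp (-φ' x) * ‖(H x * E x * τ x + ∑ j, dz j H x * α j x +
      ∑ j, (dz j (fun x => (φ' x : ℂ)) x - dz j (fun x => (ψ' x : ℂ)) x) * (H x * α j x)) +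
      ∑ j, (- dz j (fun x => (φ' x : ℂ)) x + dz j (fun x => (ψ' x : ℂ)) x) * (H x * α j x)‖ ^ 2 =
        Real.exp (-φ x) * ‖H x * (Real.exp (φ x - ψ x) : ℂ) * τ x + ∑ j, dz j H x * α j x‖ ^ 2 := by
      intro x
      by_cases hx : x ∈ U
      · rw [eφ x hx, hEU x hx]
        congr 3
        have h0 : (∑ j, (dz j (fun x => (φ' x : ℂ)) x - dz j (fun x => (ψ' x : ℂ)) x) * (H x * α j x)) +
          ∑ j, (- dz j (fun x => (φ' x : ℂ)) x + dz j (fun x => (ψ' x : ℂ)) x) * (H x * α j x) = 0 := by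
          rw [← Finset.sum_add_distrib]
          exact Finset.sum_eq_zero fun j _ => by ring
        rw [add_assoc _ _ (∑ j, (- dz j (fun x => (φ' x : ℂ)) x + dz j (fun x => (ψ' x : ℂ)) x) * (H x * α j x)),
          h0, add_zero]
      · simp [offH x hx, offHz x hx]
    have e3 : ∀ x, Real.exp (-φ' x) * (∑ j, ∑ k, ‖dzb j H x * α k x - dzb k H x * α j x‖ ^ 2) =
        Real.exp (-φ x) * (∑ j, ∑ k, ‖dzb j H x * α k x - dzb k H x * α j x‖ ^ 2) := by
      intro x
      by_cases hx : x ∈ U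
      · rw [eφ x hx]
      · simp [offHzb x hx]
    simp only [e1, e2, e3] at key
    exact key
  · refine ((((hH.mul hE).mul hτ).continuous.memLp_of_hasCompactSupport
      (HasCompactSupport.mul_right (HasCompactSupport.mul_right hHc))).add
      (memLp_finsetSum _ fun j _ => mem j _ (dz_contDiff hH j).continuous (hcs_dz hHc j)
        ((tsupport_dz_subset H j).trans hHΩ))).add (memLp_finsetSum _ fun j _ => ?_)
    have := mem j (fun x => H x * (dz j (fun x => (φ' x : ℂ)) x - dz j (fun x => (ψ' x : ℂ)) x))
      (hH.mul ((dz_contDiff hΦ' j).sub (dz_contDiff hΨ' j))).continuous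
      hHc.mul_right ((tsupport_mul_subset_left (f := H)).trans hHΩ)
    refine this.congr_norm ?_ ?_
    · exact ((((dz_contDiff hΦ' j).sub (dz_contDiff hΨ' j)).continuous).aestronglyMeasurable).mul
        (hH.continuous.aestronglyMeasurable.mul (hαm j))
    · exact ae_of_all _ fun x => by congr 1; ring
  · exact fun j k => (mem k _ (dzb_contDiff hH j).continuous (hcs_dzb hHc j)
        ((tsupport_dzb_subset H j).trans hHΩ)).sub (mem j _ (dzb_contDiff hH k).continuous (hcs_dzb hHc k)
        ((tsupport_dzb_subset H k).trans hHΩ))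
  · intro j x hx
    have : H x = 0 := image_eq_zero_of_notMem_tsupport fun h => hx (hts h)
    simp [this]
  · intro X hX hXc
    have t1 : ContDiff ℝ ∞ (fun x => H x * (E x * X x)) := hH.mul (hE.mul hX)
    have t2 : tsupport (fun x => H x * (E x * X x)) ⊆ tsupport H := tsupport_mul_subset_left (f := H)
    have t3 : HasCompactSupport (fun x => H x * (E x * X x)) := hHc.mul_right
    have h1 := hdiv _ t1 t3 (t2.trans hHΩ)
    have dd : ∀ j x, dz j (fun x => H x * (E x * X x)) x = E x * (dz j H x * X x + H x * dz j X x +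
        H x * X x * (dz j (fun x => (φ' x : ℂ)) x - dz j (fun x => (ψ' x : ℂ)) x)) := by
      intro j x
      rw [dz_mul (hH.differentiable (by simp) x) ((hE.mul hX).differentiable (by simp) x),
        dz_mul (hE.differentiable (by simp) x) (hX.differentiable (by simp) x), dzE]
      ring
    have wE : ∀ x ∈ U, (Real.exp (-φ x + ψ x) : ℂ) * E x = 1 := fun x hx => by
      simp only [hEdef, cW, eφ x hx, eψ x hx, neg_sub]
      rw [← Complex.ofReal_mul, ← Real.exp_add]
      simp
    have p1 : ∀ x, ∑ j, (Real.exp (-φ x + ψ x) : ℂ) * α j x * dz j (fun x => H x * (E x * X x)) x =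
        (∑ j, (H x * α j x) * dz j X x) + ∑ j, (dz j H x * X x +
        H x * X x * (dz j (fun x => (φ' x : ℂ)) x - dz j (fun x => (ψ' x : ℂ)) x)) * α j x := by
      intro x
      rw [← Finset.sum_add_distrib]
      refine Finset.sum_congr rfl fun j _ => ?_
      by_cases hx : x ∈ U
      · rw [dd]
        have := wE x hx
        linear_combination α j x * (dz j H x * X x + H x * dz j X x +
          H x * X x * (dz j (fun x => (φ' x : ℂ)) x - dz j (fun x => (ψ' x : ℂ)) x)) * this
      · rw [dd, offH x hx, offHz x hx]; simp
    have i3 : Integrable (fun x => ∑ j, (dz j H x * X x +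
        H x * X x * (dz j (fun x => (φ' x : ℂ)) x - dz j (fun x => (ψ' x : ℂ)) x)) * α j x) := by
      refine integrable_finsetSum _ fun j _ => ?_
      have j1 := itg j (fun x => dz j H x * X x) ((dz_contDiff hH j).mul hX).continuous (hcs_dz hHc j).mul_right
        ((tsupport_mul_subset_left (f := dz j H)).trans ((tsupport_dz_subset H j).trans hHΩ))
      have j2 := itg j (fun x => H x * (X x * (dz j (fun x => (φ' x : ℂ)) x - dz j (fun x => (ψ' x : ℂ)) x)))
        (hH.mul (hX.mul ((dz_contDiff hΦ' j).sub (dz_contDiff hΨ' j)))).continuous hHc.mul_right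
        ((tsupport_mul_subset_left (f := H)).trans hHΩ)
      refine (j1.add j2).congr (ae_of_all _ fun x => ?_)
      simp only [Pi.add_apply]; ring
    simp only [p1] at h1
    rw [integral_add] at h1
    · rw [eq_neg_iff_add_eq_zero] at h1 ⊢
      rw [← h1, add_assoc]
      congr 1
      rw [add_comm, ← integral_add]
      · refine integral_congr_ae (ae_of_all _ fun x => ?_)
        simp only [add_mul, Finset.sum_mul, Finset.sum_add_distrib]
        have : ∀ a b c a' b' c' : ℂ, a = a' → b = b' → c = c' → a + b + c = c' + (a' + b') := by
          intros; subst_vars; ring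
        rw [show τ x * (H x * (E x * X x)) = H x * E x * τ x * X x by ring]
        rw [add_assoc]
        congr 1
        congr 1 <;> exact Finset.sum_congr rfl fun j _ => by ring
      · exact (hτ.mul t1).continuous.integrable_of_hasCompactSupport (HasCompactSupport.mul_left t3)
      · exact i3
    · refine integrable_finsetSum _ fun j _ => ?_
      have := itg j (fun x => H x * dz j X x) (hH.mul (dz_contDiff hX j)).continuous hHc.mul_right
        ((tsupport_mul_subset_left (f := H)).trans hHΩ)
      refine this.congr (ae_of_all _ fun x => ?_)
      ring
    · exact i3
  · intro j k X hX hXc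
    have t1 : ContDiff ℝ ∞ (fun x => H x * X x) := hH.mul hX
    have t2 : tsupport (fun x => H x * X x) ⊆ tsupport H := tsupport_mul_subset_left (f := H)
    have t3 : HasCompactSupport (fun x => H x * X x) := hHc.mul_right
    have h1 := hcurl j k _ t1 t3 (t2.trans hHΩ)
    have dd : ∀ j x, dzb j (fun x => H x * X x) x = dzb j H x * X x + H x * dzb j X x := fun j x =>
      dzb_mul (hH.differentiable (by simp) x) (hX.differentiable (by simp) x) j
    have i1 : ∀ j k, Integrable (fun x => H x * dzb j X x * α k x) := fun j k =>
      itg k (fun x => H x * dzb j X x) (hH.mul (dzb_contDiff hX j)).continuous hHc.mul_right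
        ((tsupport_mul_subset_left (f := H)).trans hHΩ)
    have i2 : ∀ j k, Integrable (fun x => dzb j H x * X x * α k x) := fun j k =>
      itg k (fun x => dzb j H x * X x) ((dzb_contDiff hH j).mul hX).continuous (hcs_dzb hHc j).mul_right
        ((tsupport_mul_subset_left (f := dzb j H)).trans ((tsupport_dzb_subset H j).trans hHΩ))
    rw [eq_neg_iff_add_eq_zero, ← h1, ← integral_add]
    · refine integral_congr_ae (ae_of_all _ fun x => ?_)
      simp only [dd]; ring
    · refine ((i1 j k).sub (i1 k j)).congr (ae_of_all _ fun x => ?_)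
      simp only [Pi.sub_apply]; ring
    · refine ((i2 j k).sub (i2 k j)).congr (ae_of_all _ fun x => ?_)
      simp only [Pi.sub_apply]; ring


lemma lemD {Ω : Set (CN M)} (hΩ : IsOpen Ω) {φ ψ : CN M → ℝ} (hφm : Measurable φ) (hψm : Measurable ψ)
    (hφ : ∀ x ∈ Ω, ContDiffAt ℝ ∞ φ x) (hψ : ∀ x ∈ Ω, ContDiffAt ℝ ∞ ψ x)
    (hL : ∀ x ∈ Ω, ∀ ξ : Fin M → ℂ,
      2 * ((∑ j, ‖dz j (fun x => (ψ x : ℂ)) x‖ ^ 2) + Real.exp (ψ x)) * ∑ j, ‖ξ j‖ ^ 2 ≤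
      (∑ j, ∑ k, dz j (dzb k (fun x => (φ x : ℂ))) x * ξ j * (starRingEnd ℂ) (ξ k)).re)
    {η : ℕ → CN M → ℝ} (hη : ∀ n, ContDiff ℝ ∞ (η n)) (hηc : ∀ n, HasCompactSupport (η n))
    (hηΩ : ∀ n, tsupport (η n) ⊆ Ω) (hη1 : ∀ n x, |η n x| ≤ 1) {C : ℝ} (hC : 0 ≤ C)
    (hηC : ∀ n, ∀ x ∈ Ω, ‖fderiv ℝ (η n) x‖ ^ 2 ≤ C * Real.exp (ψ x))
    (hηl : ∀ x ∈ Ω, ∀ᶠ n in atTop, η n x = 1 ∧ fderiv ℝ (η n) x = 0)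
    {α : Fin M → CN M → ℂ} (hαm : ∀ j, AEStronglyMeasurable (α j))
    (hα0 : ∀ j x, x ∉ Ω → α j x = 0)
    (hαi : ∀ j, Integrable (fun x => Real.exp (-φ x + ψ x) * ‖α j x‖ ^ 2))
    {τ : CN M → ℂ} (hτ : ContDiff ℝ ∞ τ) (hτc : HasCompactSupport τ) (hτΩ : tsupport τ ⊆ Ω)
    (hdiv : ∀ χ : CN M → ℂ, ContDiff ℝ ∞ χ → HasCompactSupport χ → tsupport χ ⊆ Ω →
      ∫ x, ∑ j, (Real.exp (-φ x + ψ x) : ℂ) * α j x * dz j χ x = - ∫ x, τ x * χ x)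
    (hcurl : ∀ j k, ∀ χ : CN M → ℂ, ContDiff ℝ ∞ χ → HasCompactSupport χ → tsupport χ ⊆ Ω →
      ∫ x, (α k x * dzb j χ x - α j x * dzb k χ x) = 0) :
    ∫ x, Real.exp (-φ x + ψ x) * ∑ j, ‖α j x‖ ^ 2 ≤ ∫ x, Real.exp (φ x - 2 * ψ x) * ‖τ x‖ ^ 2 := by
  have key := fun n => lemD_loc hΩ hφ hψ hL (hη n) (hηc n) (hηΩ n) hαm hαi hτ hdiv hcurl
  have iG : Integrable (fun x => Real.exp (-φ x + ψ x) * ∑ j, ‖α j x‖ ^ 2) := by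
    simp only [Finset.mul_sum]
    exact integrable_finsetSum _ fun j _ => hαi j
  have iT : Integrable (fun x => Real.exp (φ x - 2 * ψ x) * ‖τ x‖ ^ 2) := by
    have h2 : Continuous (fun x => Real.exp (φ x - 2 * ψ x) * ‖τ x‖ ^ 2) := by
      refine continuous_iff_continuousAt.2 fun x => ?_
      by_cases hx : x ∈ Ω
      · exact (Real.continuous_exp.continuousAt.comp ((hφ x hx).continuousAt.sub
          (continuousAt_const.mul (hψ x hx).continuousAt))).mul (hτ.continuous.norm.pow 2).continuousAt
      · have := notMem_tsupport_iff_eventuallyEq.1 (fun h => hx (hτΩ h))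
        refine (continuousAt_const (y := (0 : ℝ))).congr ?_
        filter_upwards [this] with y hy
        simp [hy]
    refine h2.integrable_of_hasCompactSupport (HasCompactSupport.mul_left ?_)
    exact hτc.comp_left (g := fun z => ‖z‖ ^ 2) (by simp)
  have fd : ∀ n x, ‖fderiv ℝ (fun x => (η n x : ℂ)) x‖ ≤ ‖fderiv ℝ (η n) x‖ := by
    intro n x
    refine ContinuousLinearMap.opNorm_le_bound _ (norm_nonneg _) fun e => ?_
    rw [fderiv_ofReal ((hη n).differentiable (by simp) x), Complex.norm_real]
    exact (fderiv ℝ (η n) x).le_opNorm e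
  have bz : ∀ n, ∀ x ∈ Ω, ∀ j, ‖dz j (fun x => (η n x : ℂ)) x‖ ^ 2 ≤ C * Real.exp (ψ x) := by
    intro n x hx j
    refine le_trans ?_ (hηC n x hx)
    have := (norm_dz_le (fun x => (η n x : ℂ)) j x).trans (fd n x)
    gcongr
  have bzb : ∀ n, ∀ x ∈ Ω, ∀ j, ‖dzb j (fun x => (η n x : ℂ)) x‖ ^ 2 ≤ C * Real.exp (ψ x) := by
    intro n x hx j
    refine le_trans ?_ (hηC n x hx)
    have := (norm_dzb_le (fun x => (η n x : ℂ)) j x).trans (fd n x)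
    gcongr
  have lz : ∀ x ∈ Ω, ∀ᶠ n in atTop, η n x = 1 ∧ (∀ j, dz j (fun x => (η n x : ℂ)) x = 0) ∧
      ∀ j, dzb j (fun x => (η n x : ℂ)) x = 0 := by
    intro x hx
    filter_upwards [hηl x hx] with n hn
    refine ⟨hn.1, fun j => norm_le_zero_iff.1 ?_, fun j => norm_le_zero_iff.1 ?_⟩
    · have := (norm_dz_le (fun x => (η n x : ℂ)) j x).trans (fd n x)
      simpa [hn.2] using this
    · have := (norm_dzb_le (fun x => (η n x : ℂ)) j x).trans (fd n x)
      simpa [hn.2] using this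
  have off0 : ∀ n x, x ∉ Ω → η n x = 0 := fun n x hx =>
    image_eq_zero_of_notMem_tsupport fun h => hx (hηΩ n h)
  have Hc : ∀ n, ContDiff ℝ ∞ (fun x => (η n x : ℂ)) := fun n => ofReal_contDiff (hη n)
  have T1 : Tendsto (fun n => ∫ x, Real.exp (-φ x + ψ x) * ∑ j, ‖(η n x : ℂ) * α j x‖ ^ 2) atTop
      (𝓝 (∫ x, Real.exp (-φ x + ψ x) * ∑ j, ‖α j x‖ ^ 2)) := by
    refine tendsto_integral_of_dominated_convergence _ (fun n => ?_) iG (fun n => ae_of_all _ fun x => ?_)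
      (ae_of_all _ fun x => ?_)
    · exact (Real.measurable_exp.comp (hφm.neg.add hψm)).aestronglyMeasurable.mul
        (Finset.aestronglyMeasurable_fun_sum _ fun j _ =>
          (((Hc n).continuous.aestronglyMeasurable.mul (hαm j)).norm.pow 2))
    · rw [Real.norm_of_nonneg (by positivity)]
      gcongr with j
      rw [norm_mul, Complex.norm_real]
      exact mul_le_of_le_one_left (norm_nonneg _) (hη1 n x)
    · by_cases hx : x ∈ Ω
      · refine tendsto_const_nhds.congr' ?_
        filter_upwards [lz x hx] with n hn
        simp [hn.1]
      · simp [hα0 _ x hx]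
  have T2 : Tendsto (fun n => ∫ x, Real.exp (-φ x) * ‖(η n x : ℂ) * (Real.exp (φ x - ψ x) : ℂ) * τ x +
      ∑ j, dz j (fun x => (η n x : ℂ)) x * α j x‖ ^ 2) atTop
      (𝓝 (∫ x, Real.exp (φ x - 2 * ψ x) * ‖τ x‖ ^ 2)) := by
    refine tendsto_integral_of_dominated_convergence (fun x => 2 * (Real.exp (φ x - 2 * ψ x) * ‖τ x‖ ^ 2) +
      2 * M * C * (Real.exp (-φ x + ψ x) * ∑ j, ‖α j x‖ ^ 2)) (fun n => ?_)
      ((iT.const_mul _).add (iG.const_mul _)) (fun n => ae_of_all _ fun x => ?_)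
      (ae_of_all _ fun x => ?_)
    · exact (Real.measurable_exp.comp hφm.neg).aestronglyMeasurable.mul
        (((((Hc n).continuous.aestronglyMeasurable.mul
          (Complex.measurable_ofReal.comp (Real.measurable_exp.comp (hφm.sub hψm))).aestronglyMeasurable).mul
          hτ.continuous.aestronglyMeasurable).add
        (Finset.aestronglyMeasurable_fun_sum _ fun j _ =>
          (((dz_contDiff (Hc n) j).continuous.aestronglyMeasurable.mul (hαm j))))).norm.pow 2)
    · rw [Real.norm_of_nonneg (by positivity)]
      by_cases hx : x ∈ Ω
      · have h1 : ∀ a b : ℂ, ‖a + b‖ ^ 2 ≤ 2 * ‖a‖ ^ 2 + 2 * ‖b‖ ^ 2 := by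
          intro a b
          simpa using norm_sub_sq_le_two a (-b)
        have h2 := norm_sq_sum_mul_le Finset.univ (fun j => dz j (fun x => (η n x : ℂ)) x) (fun j => α j x)
        have h3 : ∑ j, ‖dz j (fun x => (η n x : ℂ)) x‖ ^ 2 ≤ M * (C * Real.exp (ψ x)) := by
          refine (Finset.sum_le_sum fun j _ => bz n x hx j).trans ?_
          simp
        have h4 : ‖(η n x : ℂ) * (Real.exp (φ x - ψ x) : ℂ) * τ x‖ ^ 2 ≤
            (Real.exp (φ x - ψ x)) ^ 2 * ‖τ x‖ ^ 2 := by
          rw [norm_mul, norm_mul, Complex.norm_real, Complex.norm_real, Real.norm_of_nonneg (Real.exp_pos _).le,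
            mul_pow, mul_pow]
          have : ‖η n x‖ ^ 2 ≤ 1 := by
            have := hη1 n x
            rw [Real.norm_eq_abs]; exact pow_le_one₀ (abs_nonneg _) this
          have h5 : 0 ≤ Real.exp (φ x - ψ x) ^ 2 * ‖τ x‖ ^ 2 := by positivity
          nlinarith
        calc _ ≤ Real.exp (-φ x) * (2 * ((Real.exp (φ x - ψ x)) ^ 2 * ‖τ x‖ ^ 2) +
              2 * ((M * (C * Real.exp (ψ x))) * ∑ j, ‖α j x‖ ^ 2)) := by
              gcongr
              refine (h1 _ _).trans ?_
              gcongr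
              refine h2.trans ?_
              gcongr
          _ = _ := by
              have e1 : Real.exp (φ x - 2 * ψ x) = Real.exp (-φ x) * Real.exp (φ x - ψ x) ^ 2 := by
                rw [← Real.exp_nat_mul, ← Real.exp_add]; congr 1; push_cast; ring
              rw [e1, Real.exp_add]
              ring
      · have hz : ∀ j, dz j (fun x => (η n x : ℂ)) x * α j x = 0 := fun j => by simp [hα0 _ x hx]
        simp only [off0 n x hx, hz]
        simp
        positivity
    · by_cases hx : x ∈ Ω
      · refine tendsto_const_nhds.congr' ?_
        filter_upwards [lz x hx] with n hn
        have e1 : Real.exp (φ x - 2 * ψ x) = Real.exp (-φ x) * Real.exp (φ x - ψ x) ^ 2 := by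
          rw [← Real.exp_nat_mul, ← Real.exp_add]; congr 1; push_cast; ring
        simp only [hn.1, hn.2.1, Complex.ofReal_one, one_mul, zero_mul, Finset.sum_const_zero, add_zero, norm_mul,
          Complex.norm_real, Real.norm_of_nonneg (Real.exp_pos _).le]
        rw [e1]; ring
      · have h0 : τ x = 0 := image_eq_zero_of_notMem_tsupport fun h => hx (hτΩ h)
        simp [hα0 _ x hx, h0]
  have T3 : Tendsto (fun n => ∫ x, Real.exp (-φ x) * (∑ j, ∑ k, ‖dzb j (fun x => (η n x : ℂ)) x * α k x -
      dzb k (fun x => (η n x : ℂ)) x * α j x‖ ^ 2)) atTop (𝓝 (∫ x : CN M, (0 : ℝ))) := by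
    refine tendsto_integral_of_dominated_convergence (fun x =>
      4 * M * C * (Real.exp (-φ x + ψ x) * ∑ j, ‖α j x‖ ^ 2)) (fun n => ?_)
      (iG.const_mul _) (fun n => ae_of_all _ fun x => ?_)
      (ae_of_all _ fun x => ?_)
    · exact (Real.measurable_exp.comp hφm.neg).aestronglyMeasurable.mul
        (Finset.aestronglyMeasurable_fun_sum _ fun j _ => Finset.aestronglyMeasurable_fun_sum _ fun k _ =>
          (((((dzb_contDiff (Hc n) j).continuous.aestronglyMeasurable.mul (hαm k))).sub
          (((dzb_contDiff (Hc n) k).continuous.aestronglyMeasurable.mul (hαm j)))).norm.pow 2))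
    · rw [Real.norm_of_nonneg (by positivity)]
      by_cases hx : x ∈ Ω
      · calc _ ≤ Real.exp (-φ x) * (∑ j : Fin M, ∑ k : Fin M, (2 * (C * Real.exp (ψ x) * ‖α k x‖ ^ 2) +
              2 * (C * Real.exp (ψ x) * ‖α j x‖ ^ 2))) := by
              gcongr with j _ k _
              refine (norm_sub_sq_le_two _ _).trans ?_
              rw [norm_mul, norm_mul, mul_pow, mul_pow]
              have := bzb n x hx j
              have := bzb n x hx k
              gcongr
          _ = _ := by
              simp only [Finset.sum_add_distrib, Finset.sum_const, ← Finset.mul_sum, Finset.card_univ,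
                Fintype.card_fin, nsmul_eq_mul]
              rw [Real.exp_add]
              ring
      · simp only [hα0 _ x hx]
        simp
    · by_cases hx : x ∈ Ω
      · refine tendsto_const_nhds.congr' ?_
        filter_upwards [lz x hx] with n hn
        simp [hn.2.2]
      · simp [hα0 _ x hx]
  have T4 := T2.add (T3.div_const 4)
  simp only [integral_zero, zero_div, add_zero] at T4
  exact le_of_tendsto_of_tendsto' T1 T4 key

end lemD

section exist
open MeasureTheory Filter
variable {M : ℕ}

/-- admissible pair of weights on `Ω` -/
structure HW (Ω : Set (CN M)) (φ ψ : CN M → ℝ) : Prop where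
  hΩ : IsOpen Ω
  hφm : Measurable φ
  hψm : Measurable ψ
  hφ : ∀ x ∈ Ω, ContDiffAt ℝ ∞ φ x
  hψ : ∀ x ∈ Ω, ContDiffAt ℝ ∞ ψ x
  hL : ∀ x ∈ Ω, ∀ ξ : Fin M → ℂ,
      2 * ((∑ j, ‖dz j (fun x => (ψ x : ℂ)) x‖ ^ 2) + Real.exp (ψ x)) * ∑ j, ‖ξ j‖ ^ 2 ≤
      (∑ j, ∑ k, dz j (dzb k (fun x => (φ x : ℂ))) x * ξ j * (starRingEnd ℂ) (ξ k)).re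
  cut : ∃ (η : ℕ → CN M → ℝ) (C : ℝ), (∀ n, ContDiff ℝ ∞ (η n)) ∧ (∀ n, HasCompactSupport (η n)) ∧
    (∀ n, tsupport (η n) ⊆ Ω) ∧ (∀ n x, |η n x| ≤ 1) ∧ (0 ≤ C) ∧
    (∀ n, ∀ x ∈ Ω, ‖fderiv ℝ (η n) x‖ ^ 2 ≤ C * Real.exp (ψ x)) ∧
    (∀ x ∈ Ω, ∀ᶠ n in atTop, η n x = 1 ∧ fderiv ℝ (η n) x = 0)

/-- smooth test functions on `Ω` -/
structure Tst (Ω : Set (CN M)) (c : CN M → ℂ) : Prop where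
  sm : ContDiff ℝ ∞ c
  cs : HasCompactSupport c
  ts : tsupport c ⊆ Ω

lemma Tst.dzb {Ω : Set (CN M)} {c : CN M → ℂ} (h : Tst Ω c) (j) : Tst Ω (dzb j c) :=
  ⟨dzb_contDiff h.sm j, hcs_dzb h.cs j, (tsupport_dzb_subset c j).trans h.ts⟩

lemma Tst.dz {Ω : Set (CN M)} {c : CN M → ℂ} (h : Tst Ω c) (j) : Tst Ω (dz j c) :=
  ⟨dz_contDiff h.sm j, hcs_dz h.cs j, (tsupport_dz_subset c j).trans h.ts⟩

lemma Tst.conj {Ω : Set (CN M)} {c : CN M → ℂ} (h : Tst Ω c) : Tst Ω (fun x => (starRingEnd ℂ) (c x)) :=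
  ⟨contDiff_conj h.sm, hcs_conj h.cs, (tsupport_comp_subset (g := (starRingEnd ℂ)) (by simp) c).trans h.ts⟩

lemma Tst.add {Ω : Set (CN M)} {c d : CN M → ℂ} (h : Tst Ω c) (h' : Tst Ω d) : Tst Ω (fun x => c x + d x) :=
  ⟨h.sm.add h'.sm, HasCompactSupport.add h.cs h'.cs,
    (tsupport_add (f := c) (g := d)).trans (union_subset h.ts h'.ts)⟩

lemma Tst.zero {Ω : Set (CN M)} : Tst Ω (fun _ => (0 : ℂ)) :=
  ⟨contDiff_const, HasCompactSupport.zero, by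
    have : tsupport (fun _ : CN M => (0 : ℂ)) = ∅ := tsupport_eq_empty_iff.2 rfl
    rw [this]; exact empty_subset _⟩

lemma Tst.sum {Ω : Set (CN M)} {ι : Type*} (s : Finset ι) {c : ι → CN M → ℂ} (h : ∀ i, Tst Ω (c i)) :
    Tst Ω (fun x => ∑ i ∈ s, c i x) := by
  classical
  induction s using Finset.induction_on with
  | empty => simpa using Tst.zero
  | insert a s ha ih => simp only [Finset.sum_insert ha]; exact (h a).add ih

lemma Tst.smul {Ω : Set (CN M)} {c : CN M → ℂ} (h : Tst Ω c) (a : ℂ) : Tst Ω (fun x => a * c x) :=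
  ⟨contDiff_const.mul h.sm, h.cs.mul_left, (tsupport_mul_subset_right (f := fun _ => a) (g := c)).trans h.ts⟩

lemma Tst.off {Ω : Set (CN M)} {c : CN M → ℂ} (h : Tst Ω c) {x} (hx : x ∉ Ω) : c x = 0 :=
  image_eq_zero_of_notMem_tsupport fun h' => hx (h.ts h')

lemma Tst.mul_cont {Ω : Set (CN M)} (hΩ : IsOpen Ω) {c : CN M → ℂ} (h : Tst Ω c) {s : CN M → ℝ}
    (hs : ContinuousOn s Ω) : Continuous (fun x => (s x : ℂ) * c x) := by
  refine continuous_iff_continuousAt.2 fun x => ?_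
  by_cases hx : x ∈ Ω
  · exact (Complex.continuous_ofReal.continuousAt.comp (hs.continuousAt (hΩ.mem_nhds hx))).mul
      h.sm.continuous.continuousAt
  · have := notMem_tsupport_iff_eventuallyEq.1 (fun h' => hx (h.ts h'))
    refine (continuousAt_const (y := (0 : ℂ))).congr ?_
    filter_upwards [this] with y hy
    simp [hy]

lemma Tst.memLp {Ω : Set (CN M)} (hΩ : IsOpen Ω) {c : CN M → ℂ} (h : Tst Ω c) {s : CN M → ℝ}
    (hs : ContinuousOn s Ω) : MemLp (fun x => (s x : ℂ) * c x) 2 (volume.restrict Ω) :=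
  ((h.mul_cont hΩ hs).memLp_of_hasCompactSupport (HasCompactSupport.mul_left h.cs)).restrict _

lemma Tst.int {Ω : Set (CN M)} {c d : CN M → ℂ} (h : Tst Ω c) (hd : Continuous d) :
    Integrable (fun x => c x * d x) :=
  (h.sm.continuous.mul hd).integrable_of_hasCompactSupport (HasCompactSupport.mul_right h.cs)

lemma inner_toLp_left {μ : Measure (CN M)} {c : CN M → ℂ} (hc : MemLp c 2 μ) (F : Lp ℂ 2 μ) :
    inner ℂ (hc.toLp c) F = ∫ x, (starRingEnd ℂ) (c x) * F x ∂μ := by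
  rw [L2.inner_def]
  refine integral_congr_ae ?_
  filter_upwards [hc.coeFn_toLp] with x hx
  rw [hx, RCLike.inner_apply, mul_comm]

lemma inner_toLp_toLp {μ : Measure (CN M)} {c d : CN M → ℂ} (hc : MemLp c 2 μ) (hd : MemLp d 2 μ) :
    inner ℂ (hc.toLp c) (hd.toLp d) = ∫ x, (starRingEnd ℂ) (c x) * d x ∂μ := by
  rw [inner_toLp_left]
  refine integral_congr_ae ?_
  filter_upwards [hd.coeFn_toLp] with x hx
  rw [hx]

lemma norm_sq_Lp {μ : Measure (CN M)} (F : Lp ℂ 2 μ) : ‖F‖ ^ 2 = ∫ x, ‖F x‖ ^ 2 ∂μ := by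
  have h := inner_self_eq_norm_sq_to_K (𝕜 := ℂ) F
  rw [L2.inner_def] at h
  have h2 : ∀ x, inner ℂ (F x) (F x) = ((‖F x‖ ^ 2 : ℝ) : ℂ) := fun x => by
    rw [inner_self_eq_norm_sq_to_K]; norm_cast
  simp only [h2] at h
  rw [integral_complex_ofReal] at h
  have h3 : (((∫ x, ‖F x‖ ^ 2 ∂μ : ℝ)) : ℂ) = ((‖F‖ ^ 2 : ℝ) : ℂ) := by rw [Complex.ofReal_pow]; exact h
  exact (Complex.ofReal_inj.1 h3).symm

lemma int_sq_Lp {μ : Measure (CN M)} (F : Lp ℂ 2 μ) : Integrable (fun x => ‖F x‖ ^ 2) μ :=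
  (memLp_two_iff_integrable_sq_norm (Lp.aestronglyMeasurable F)).1 (Lp.memLp F)

lemma restr_int {Ω : Set (CN M)} {f : CN M → ℂ} (h : ∀ x, x ∉ Ω → f x = 0) :
    ∫ x in Ω, f x = ∫ x, f x :=
  setIntegral_eq_integral_of_forall_compl_eq_zero fun x hx => h x hx

lemma restr_intR {Ω : Set (CN M)} {f : CN M → ℝ} (h : ∀ x, x ∉ Ω → f x = 0) :
    ∫ x in Ω, f x = ∫ x, f x :=
  setIntegral_eq_integral_of_forall_compl_eq_zero fun x hx => h x hx

lemma dzb_dzb_comm {v : CN M → ℂ} {x} (hv : ContDiffAt ℝ ∞ v x) (j k : Fin M) :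
    dzb j (dzb k v) x = dzb k (dzb j v) x := by
  have hd : ∀ e, DifferentiableAt ℝ (fun y => fderiv ℝ v y e) x := fun e =>
    (contDiffAt_fderiv_apply hv e).differentiableAt (by simp)
  have key : ∀ k e, fderiv ℝ (dzb k v) x e = (fderiv ℝ (fderiv ℝ v) x e (Pi.single k 1)
      + Complex.I * fderiv ℝ (fderiv ℝ v) x e (Pi.single k Complex.I)) / 2 := by
    intro k e
    have : dzb k v = fun y => (2:ℂ)⁻¹ * (fderiv ℝ v y (Pi.single k 1) +
      Complex.I * fderiv ℝ v y (Pi.single k Complex.I)) := by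
      funext y; simp [dzb]; ring
    rw [this, fderiv_const_mul ((hd _).fun_add ((hd _).const_mul _)), fderiv_fun_add (hd _) ((hd _).const_mul _),
      fderiv_const_mul (hd _)]
    simp [fderiv_fderiv_apply hv]
    ring
  rw [dzb, key, key, dzb, key, key, fderiv2_symm hv (Pi.single k 1) (Pi.single j 1),
    fderiv2_symm hv (Pi.single k Complex.I) (Pi.single j 1), fderiv2_symm hv (Pi.single k 1) (Pi.single j Complex.I),
    fderiv2_symm hv (Pi.single k Complex.I) (Pi.single j Complex.I)]
  ring

lemma proj_exists {H : Type*} [NormedAddCommGroup H] [InnerProductSpace ℂ H] [CompleteSpace H]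
    (N : Submodule ℂ H) (F : H) : ∃ A ∈ Nᗮ, ∀ v ∈ Nᗮ, inner ℂ A v = inner ℂ F v := by
  refine ⟨Nᗮ.starProjection F, Submodule.starProjection_apply_mem _ _, fun v hv => ?_⟩
  rw [Submodule.inner_starProjection_left_eq_right, Submodule.starProjection_eq_self_iff.2 hv]

lemma dual_est {Ω : Set (CN M)} {φ ψ : CN M → ℝ} (hw : HW Ω φ ψ) {X : CN M → ℂ} (hX : Tst Ω X)
    {β : Fin M → CN M → ℂ} (hβ : ∀ j, Tst Ω (β j)) :
    ‖∫ x, ∑ j, dzb j X x * β j x‖ ≤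
      Real.sqrt (∫ x, Real.exp (-φ x + ψ x) * ∑ j, ‖dzb j X x‖ ^ 2) *
      Real.sqrt (∫ x, Real.exp (φ x - 2 * ψ x) * ‖∑ j, dzb j (β j) x‖ ^ 2) := by
  classical
  have hΩ := hw.hΩ
  set μ : Measure (CN M) := volume.restrict Ω with hμ
  set sp : CN M → ℝ := fun x => Real.exp ((φ x - ψ x) / 2) with hsp
  set sm : CN M → ℝ := fun x => Real.exp (-(φ x - ψ x) / 2) with hsm
  have cspm : ∀ x, (sp x : ℂ) * (sm x : ℂ) = 1 := fun x => by
    rw [← Complex.ofReal_mul, hsp, hsm]; simp only; rw [← Real.exp_add]; ring_nf; simp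
  have hspc : ContinuousOn sp Ω := fun x hx => (Real.continuous_exp.continuousAt.comp
    (((hw.hφ x hx).continuousAt.sub (hw.hψ x hx).continuousAt).div_const 2)).continuousWithinAt
  have hsmc : ContinuousOn sm Ω := fun x hx => (Real.continuous_exp.continuousAt.comp
    (((hw.hφ x hx).continuousAt.sub (hw.hψ x hx).continuousAt).neg.div_const 2)).continuousWithinAt
  have vp : ∀ {c : CN M → ℂ}, Tst Ω c → MemLp (fun x => (sp x : ℂ) * c x) 2 μ := fun h => h.memLp hΩ hspc
  have vm : ∀ {c : CN M → ℂ}, Tst Ω c → MemLp (fun x => (sm x : ℂ) * c x) 2 μ := fun h => h.memLp hΩ hsmc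
  -- the closed subspace
  let XV : Fin M → Fin M → {c : CN M → ℂ // Tst Ω c} → PiLp 2 (fun _ : Fin M => Lp ℂ 2 μ) := fun j k c =>
    WithLp.toLp 2 (Pi.single k ((vp (c.2.dzb j).conj).toLp _)) -
      WithLp.toLp 2 (Pi.single j ((vp (c.2.dzb k).conj).toLp _))
  have hXV : ∀ j k c (F : PiLp 2 (fun _ : Fin M => Lp ℂ 2 μ)), inner ℂ (XV j k c) F =
      (∫ x in Ω, (sp x : ℂ) * dzb j c.1 x * F k x) - ∫ x in Ω, (sp x : ℂ) * dzb k c.1 x * F j x := by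
    intro j k c F
    have h1 : ∀ k (v : Lp ℂ 2 μ), inner ℂ (WithLp.toLp 2 (Pi.single k v) : PiLp 2 (fun _ : Fin M => Lp ℂ 2 μ)) F =
        inner ℂ v (F k) := by
      intro k v
      rw [PiLp.inner_apply, Finset.sum_eq_single k]
      · simp
      · intro b _ hb; simp [Pi.single_eq_of_ne hb]
      · simp
    simp only [XV, inner_sub_left, h1]
    rw [inner_toLp_left, inner_toLp_left]
    simp only [map_mul, Complex.conj_ofReal, Complex.conj_conj, hμ]
  let N0 : Submodule ℂ (PiLp 2 (fun _ : Fin M => Lp ℂ 2 μ)) :=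
    Submodule.span ℂ {v | ∃ j k c, v = XV j k c}
  let N := N0ᗮ
  have memN : ∀ F, F ∈ N ↔ ∀ j k c, inner ℂ (XV j k c) F = 0 := by
    intro F
    constructor
    · intro h j k c
      exact (Submodule.mem_orthogonal _ _).1 h _ (Submodule.subset_span ⟨j, k, c, rfl⟩)
    · intro h
      refine (Submodule.mem_orthogonal _ _).2 fun v hv => ?_
      induction hv using Submodule.span_induction with
      | mem v hv => obtain ⟨j, k, c, rfl⟩ := hv; exact h j k c
      | zero => simp
      | add x y _ _ hx hy => rw [inner_add_left, hx, hy, add_zero]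
      | smul a x _ hx => rw [inner_smul_left, hx, mul_zero]
  -- exact forms are in `N`
  let GV : {c : CN M → ℂ // Tst Ω c} → PiLp 2 (fun _ : Fin M => Lp ℂ 2 μ) := fun c =>
    WithLp.toLp 2 (fun j => (vm (c.2.dzb j)).toLp _)
  have hGV : ∀ c, GV c ∈ N := by
    intro c
    rw [memN]
    intro j k d
    rw [hXV]
    have h1 : ∀ j k, ∫ x in Ω, (sp x : ℂ) * dzb j d.1 x * GV c k x = ∫ x, dzb j d.1 x * dzb k c.1 x := by
      intro j k
      rw [← restr_int (Ω := Ω) (fun x hx => by simp [(d.2.dzb j).off hx])]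
      refine integral_congr_ae ?_
      filter_upwards [(vm (c.2.dzb k)).coeFn_toLp] with x hx
      have : GV c k x = (sm x : ℂ) * dzb k c.1 x := hx
      rw [this]
      linear_combination dzb j d.1 x * dzb k c.1 x * cspm x
    rw [h1, h1, dzb_ibp (d.2.dzb j).sm c.2.sm c.2.cs, dzb_ibp (d.2.dzb k).sm c.2.sm c.2.cs]
    simp only [dzb_dzb_comm d.2.sm.contDiffAt j k, sub_self]
  let FV : PiLp 2 (fun _ : Fin M => Lp ℂ 2 μ) := WithLp.toLp 2 (fun j => (vp (hβ j).conj).toLp _)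
  obtain ⟨A, hA, hAG'⟩ := proj_exists N0 FV
  have hAG : ∀ c, inner ℂ A (GV c) = inner ℂ FV (GV c) := fun c => hAG' _ (hGV c)
  have hFG : ∀ c, inner ℂ FV (GV c) = ∫ x, ∑ j, β j x * dzb j c.1 x := by
    intro c
    rw [PiLp.inner_apply, integral_finsetSum]
    · refine Finset.sum_congr rfl fun j _ => ?_
      have : inner ℂ (FV j) (GV c j) = _ := inner_toLp_toLp (vp (hβ j).conj) (vm (c.2.dzb j))
      rw [this, ← restr_int (Ω := Ω) (fun x hx => by simp [(hβ j).off hx])]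
      refine integral_congr_ae (ae_of_all _ fun x => ?_)
      simp only [map_mul, Complex.conj_ofReal, Complex.conj_conj]
      linear_combination β j x * dzb j c.1 x * cspm x
    · exact fun j _ => (hβ j).int (c.2.dzb j).sm.continuous
  have hGn : ‖GV ⟨X, hX⟩‖ ^ 2 = ∫ x, Real.exp (-φ x + ψ x) * ∑ j, ‖dzb j X x‖ ^ 2 := by
    have e0 : ∀ x, sm x ^ 2 = Real.exp (-φ x + ψ x) := fun x => by
      simp only [hsm]; rw [← Real.exp_nat_mul]; congr 1; push_cast; ring
    rw [PiLp.norm_sq_eq_of_L2]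
    simp only [norm_sq_Lp]
    rw [← integral_finsetSum]
    · rw [← restr_intR (Ω := Ω) (fun x hx => by simp [(hX.dzb _).off hx])]
      refine integral_congr_ae ?_
      have : ∀ᵐ x ∂μ, ∀ j, GV ⟨X, hX⟩ j x = (sm x : ℂ) * dzb j X x :=
        ae_all_iff.2 fun j => (vm (hX.dzb j)).coeFn_toLp
      filter_upwards [this] with x hx
      simp only [hx, norm_mul, mul_pow, Complex.norm_real, Real.norm_eq_abs, sq_abs, ← Finset.mul_sum, e0]
    · exact fun j _ => int_sq_Lp _
  have hAn : ‖A‖ ^ 2 ≤ ∫ x, Real.exp (φ x - 2 * ψ x) * ‖∑ j, dzb j (β j) x‖ ^ 2 := by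
    obtain ⟨η, C, c1, c2, c3, c4, c5, c6, c7⟩ := hw.cut
    have e1 : ∀ x, Real.exp (-φ x + ψ x) * sp x ^ 2 = 1 := fun x => by
      simp only [hsp]; rw [← Real.exp_nat_mul, ← Real.exp_add]; push_cast; ring_nf; simp
    have e2 : ∀ x, (Real.exp (-φ x + ψ x) : ℂ) * (sp x : ℂ) = sm x := fun x => by
      rw [← Complex.ofReal_mul]; simp only [hsp, hsm]; rw [← Real.exp_add]; ring_nf
    have hms : Measurable sp := Real.measurable_exp.comp ((hw.hφm.sub hw.hψm).div_const 2)
    let α : Fin M → CN M → ℂ := fun j => Ω.indicator (fun x => (sp x : ℂ) * A j x)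
    have hαsq : ∀ j, (fun x => Real.exp (-φ x + ψ x) * ‖α j x‖ ^ 2) = Ω.indicator (fun x => ‖A j x‖ ^ 2) := by
      intro j; funext x
      by_cases hx : x ∈ Ω
      · simp only [α, indicator_of_mem hx, norm_mul, mul_pow, Complex.norm_real, Real.norm_eq_abs, sq_abs]
        linear_combination ‖A j x‖ ^ 2 * e1 x
      · simp [α, indicator_of_notMem hx]
    have hαi : ∀ j, Integrable (fun x => Real.exp (-φ x + ψ x) * ‖α j x‖ ^ 2) := by
      intro j
      rw [hαsq, integrable_indicator_iff hΩ.measurableSet]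
      exact int_sq_Lp _
    have hoff : ∀ j x, x ∉ Ω → α j x = 0 := fun j x hx => by simp [α, indicator_of_notMem hx]
    have hτ : Tst Ω (fun x => ∑ j, dz j (fun y => (starRingEnd ℂ) (β j y)) x) :=
      Tst.sum _ fun j => (hβ j).conj.dz j
    have key := lemD hΩ hw.hφm hw.hψm hw.hφ hw.hψ hw.hL c1 c2 c3 c4 c5 c6 c7 (α := α)
      (fun j => (aestronglyMeasurable_indicator_iff hΩ.measurableSet).2
        ((Complex.measurable_ofReal.comp hms).aestronglyMeasurable.mul (Lp.aestronglyMeasurable (A j))))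
      hoff hαi hτ.sm hτ.cs hτ.ts ?_ ?_
    · refine le_trans (le_of_eq ?_) (key.trans (le_of_eq ?_))
      · simp only [Finset.mul_sum]
        rw [integral_finsetSum _ fun j _ => hαi j, PiLp.norm_sq_eq_of_L2]
        refine Finset.sum_congr rfl fun j _ => ?_
        rw [hαsq, integral_indicator hΩ.measurableSet, norm_sq_Lp]
      · refine integral_congr_ae (ae_of_all _ fun x => ?_)
        simp only [dz_conj, ← map_sum, RCLike.norm_conj]
    · intro χ h1 h2 h3
      have hχ : Tst Ω χ := ⟨h1, h2, h3⟩
      have s1 : inner ℂ (GV ⟨_, hχ.conj⟩) A = ∫ x, ∑ j, (Real.exp (-φ x + ψ x) : ℂ) * α j x * dz j χ x := by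
        rw [PiLp.inner_apply, ← restr_int (Ω := Ω) (fun x hx => by simp [hoff _ x hx]), integral_finsetSum]
        · refine Finset.sum_congr rfl fun j _ => ?_
          have := inner_toLp_left (vm (hχ.conj.dzb j)) (A j)
          refine this.trans ?_
          refine setIntegral_congr_fun hΩ.measurableSet fun x hx => ?_
          simp only [α, indicator_of_mem hx, map_mul, Complex.conj_ofReal, dzb_conj, Complex.conj_conj]
          linear_combination - A j x * dz j χ x * e2 x
        · intro j _
          have := (vm (hχ.dz j)).integrable_mul (Lp.memLp (A j))
          refine (integrable_congr ?_).1 this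
          filter_upwards [ae_restrict_mem hΩ.measurableSet] with x hx
          simp only [α, indicator_of_mem hx, Pi.mul_apply]
          linear_combination - A j x * dz j χ x * e2 x
      rw [← s1, ← inner_conj_symm, hAG, hFG, ← integral_conj]
      simp only [map_sum, map_mul, dzb_conj, Complex.conj_conj, Finset.sum_mul]
      rw [integral_finsetSum, integral_finsetSum, ← Finset.sum_neg_distrib]
      · exact Finset.sum_congr rfl fun j _ => dz_ibp (hβ j).conj.sm h1 h2 j
      · exact fun j _ => ((hβ j).conj.dz j).int h1.continuous
      · exact fun j _ => (hβ j).conj.int (dz_contDiff h1 j).continuous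
    · intro j k χ h1 h2 h3
      have hχ : Tst Ω χ := ⟨h1, h2, h3⟩
      have h0 := (memN A).1 hA j k ⟨χ, hχ⟩
      rw [hXV, ← integral_sub] at h0
      · rw [← h0, ← restr_int (Ω := Ω) (fun x hx => by simp [hoff _ x hx])]
        refine setIntegral_congr_fun hΩ.measurableSet fun x hx => ?_
        simp only [α, indicator_of_mem hx]
        ring
      · exact (vp (hχ.dzb j)).integrable_mul (Lp.memLp (A k))
      · exact (vp (hχ.dzb k)).integrable_mul (Lp.memLp (A j))
  have h1 : ∫ x, ∑ j, dzb j X x * β j x = inner ℂ A (GV ⟨X, hX⟩) := by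
    rw [hAG, hFG]; simp only [mul_comm]
  rw [h1, mul_comm, ← hGn, Real.sqrt_sq (norm_nonneg _)]
  refine (norm_inner_le_norm _ _).trans ?_
  gcongr
  exact Real.le_sqrt_of_sq_le hAn

lemma riesz_exists {V H : Type*} [AddCommGroup V] [Module ℂ V] [NormedAddCommGroup H] [InnerProductSpace ℂ H]
    [CompleteSpace H] (T : V →ₗ[ℂ] H) (l : V →ₗ[ℂ] ℂ) {C : ℝ} (hC : 0 ≤ C) (h : ∀ v, ‖l v‖ ≤ C * ‖T v‖) :
    ∃ u : H, ‖u‖ ≤ C ∧ ∀ v, l v = inner ℂ u (T v) := by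
  obtain ⟨s, hs⟩ := T.rangeRestrict.exists_rightInverse_of_surjective
    (LinearMap.range_eq_top.2 T.surjective_rangeRestrict)
  have hs' : ∀ y : LinearMap.range T, T (s y) = y := fun y => by
    have := LinearMap.congr_fun hs y
    simpa using congrArg Subtype.val this
  have hb : ∀ y : LinearMap.range T, ‖(l ∘ₗ s) y‖ ≤ C * ‖y‖ := fun y => by
    have := h (s y)
    rw [hs'] at this
    exact this
  obtain ⟨g, hg1, hg2⟩ := exists_extension_norm_eq (𝕜 := ℂ) (LinearMap.range T) ((l ∘ₗ s).mkContinuous C hb)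
  refine ⟨(InnerProductSpace.toDual ℂ H).symm g, ?_, fun v => ?_⟩
  · rw [LinearIsometryEquiv.norm_map, hg2]
    exact LinearMap.mkContinuous_norm_le _ hC _
  · rw [InnerProductSpace.toDual_symm_apply]
    have h1 := hg1 ⟨T v, LinearMap.mem_range_self T v⟩
    rw [h1]
    have h2 : T (s ⟨T v, LinearMap.mem_range_self T v⟩ - v) = 0 := by rw [map_sub, hs']; simp
    have h3 := h (s ⟨T v, LinearMap.mem_range_self T v⟩ - v)
    rw [h2, norm_zero, mul_zero, norm_le_zero_iff, map_sub, sub_eq_zero] at h3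
    exact h3.symm

/-- test forms -/
def TF (Ω : Set (CN M)) : Submodule ℂ (Fin M → CN M → ℂ) where
  carrier := {β | ∀ j, Tst Ω (β j)}
  zero_mem' := fun _ => Tst.zero
  add_mem' := fun h h' j => (h j).add (h' j)
  smul_mem' := fun a _ h j => (h j).smul a

lemma dzb_smul {v : CN M → ℂ} {x} (hv : DifferentiableAt ℝ v x) (a : ℂ) (j) :
    dzb j (fun y => a * v y) x = a * dzb j v x := by
  rw [dzb_mul (differentiableAt_const a) hv]
  simp [dzb]

lemma exists_u {Ω : Set (CN M)} {φ ψ : CN M → ℝ} (hw : HW Ω φ ψ) {X : CN M → ℂ} (hX : Tst Ω X) :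
    ∃ u : CN M → ℂ, AEStronglyMeasurable u ∧ (∀ x, x ∉ Ω → u x = 0) ∧
      Integrable (fun x => Real.exp (-φ x + 2 * ψ x) * ‖u x‖ ^ 2) ∧
      (∫ x, Real.exp (-φ x + 2 * ψ x) * ‖u x‖ ^ 2) ≤
        (∫ x, Real.exp (-φ x + ψ x) * ∑ j, ‖dzb j X x‖ ^ 2) ∧
      ∀ β, Tst Ω β → ∀ j, ∫ x, (X x - u x) * dzb j β x = 0 := by
  classical
  have hΩ := hw.hΩ
  set μ : Measure (CN M) := volume.restrict Ω with hμ
  set sp : CN M → ℝ := fun x => Real.exp ((φ x - 2 * ψ x) / 2) with hsp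
  have hspc : ContinuousOn sp Ω := fun x hx => (Real.continuous_exp.continuousAt.comp
    (((hw.hφ x hx).continuousAt.sub (continuousAt_const.mul (hw.hψ x hx).continuousAt)).div_const 2)).continuousWithinAt
  have hms : Measurable sp := Real.measurable_exp.comp ((hw.hφm.sub (hw.hψm.const_mul 2)).div_const 2)
  have vp : ∀ {c : CN M → ℂ}, Tst Ω c → MemLp (fun x => (sp x : ℂ) * c x) 2 μ := fun h => h.memLp hΩ hspc
  have hS : ∀ β : TF Ω, Tst Ω (fun x => ∑ j, dzb j (β.1 j) x) := fun β => Tst.sum _ fun j => (β.2 j).dzb j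
  have dif : ∀ (β : TF Ω) j x, DifferentiableAt ℝ (β.1 j) x := fun β j x =>
    (β.2 j).sm.differentiable (by simp) x
  let T : TF Ω →ₗ[ℂ] Lp ℂ 2 μ :=
    { toFun := fun β => (vp (hS β)).toLp _
      map_add' := by
        intro β γ
        rw [← MemLp.toLp_add]
        congr 1
        funext x
        simp only [Pi.add_apply, ← mul_add, ← Finset.sum_add_distrib]
        congr 1
        exact Finset.sum_congr rfl fun j _ => dzb_add (dif β j x) (dif γ j x) j
      map_smul' := by
        intro a β
        simp only [RingHom.id_apply]
        rw [← MemLp.toLp_const_smul]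
        congr 1
        funext x
        simp only [Pi.smul_apply, smul_eq_mul]
        rw [mul_left_comm]
        congr 1
        rw [Finset.mul_sum]
        exact Finset.sum_congr rfl fun j _ => dzb_smul (dif β j x) a j }
  let l : TF Ω →ₗ[ℂ] ℂ :=
    { toFun := fun β => ∫ x, ∑ j, dzb j X x * β.1 j x
      map_add' := by
        intro β γ
        rw [← integral_add]
        · refine integral_congr_ae (ae_of_all _ fun x => ?_)
          simp only [← Finset.sum_add_distrib]
          exact Finset.sum_congr rfl fun j _ => mul_add _ _ _
        · exact integrable_finsetSum _ fun j _ => (hX.dzb j).int (β.2 j).sm.continuous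
        · exact integrable_finsetSum _ fun j _ => (hX.dzb j).int (γ.2 j).sm.continuous
      map_smul' := by
        intro a β
        simp only [RingHom.id_apply, smul_eq_mul]
        rw [← integral_const_mul]
        refine integral_congr_ae (ae_of_all _ fun x => ?_)
        simp only [Finset.mul_sum]
        exact Finset.sum_congr rfl fun j _ => mul_left_comm _ _ _ }
  have e0 : ∀ x, sp x ^ 2 = Real.exp (φ x - 2 * ψ x) := fun x => by
    simp only [hsp]; rw [← Real.exp_nat_mul]; congr 1; push_cast; ring
  have e1 : ∀ x, Real.exp (-φ x + 2 * ψ x) * sp x ^ 2 = 1 := fun x => by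
    rw [e0, ← Real.exp_add]; ring_nf; simp
  set CC := ∫ x, Real.exp (-φ x + ψ x) * ∑ j, ‖dzb j X x‖ ^ 2 with hCC
  have hCC0 : 0 ≤ CC := integral_nonneg fun x => by positivity
  obtain ⟨u0, hu1, hu2⟩ := riesz_exists T l (Real.sqrt_nonneg CC) (by
    intro β
    refine (dual_est hw hX β.2).trans (le_of_eq ?_)
    congr 1
    rw [Real.sqrt_eq_iff_mul_self_eq (integral_nonneg fun x => by positivity) (norm_nonneg _), ← sq, norm_sq_Lp,
      ← restr_intR (Ω := Ω) (fun x hx => by simp [((β.2 _).dzb _).off hx])]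
    refine integral_congr_ae ?_
    filter_upwards [(vp (hS β)).coeFn_toLp] with x hx
    have : T β x = (sp x : ℂ) * _ := hx
    rw [this]
    simp only [norm_mul, mul_pow, Complex.norm_real, Real.norm_eq_abs, sq_abs, e0])
  let u : CN M → ℂ := Ω.indicator (fun x => - ((sp x : ℂ) * (starRingEnd ℂ) (u0 x)))
  have hoff : ∀ x, x ∉ Ω → u x = 0 := fun x hx => by simp [u, indicator_of_notMem hx]
  have husq : (fun x => Real.exp (-φ x + 2 * ψ x) * ‖u x‖ ^ 2) = Ω.indicator (fun x => ‖u0 x‖ ^ 2) := by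
    funext x
    by_cases hx : x ∈ Ω
    · simp only [u, indicator_of_mem hx, norm_neg, norm_mul, mul_pow, Complex.norm_real, Real.norm_eq_abs, sq_abs,
        RCLike.norm_conj]
      linear_combination ‖u0 x‖ ^ 2 * e1 x
    · simp [u, indicator_of_notMem hx]
  refine ⟨u, ?_, hoff, ?_, ?_, ?_⟩
  · exact (aestronglyMeasurable_indicator_iff hΩ.measurableSet).2
        ((Complex.measurable_ofReal.comp hms).aestronglyMeasurable.mul
          (Complex.continuous_conj.comp_aestronglyMeasurable (Lp.aestronglyMeasurable u0))).neg
  · rw [husq, integrable_indicator_iff hΩ.measurableSet]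
    exact int_sq_Lp _
  · rw [husq, integral_indicator hΩ.measurableSet, ← norm_sq_Lp]
    calc ‖u0‖ ^ 2 ≤ (Real.sqrt CC) ^ 2 := by gcongr
      _ = CC := Real.sq_sqrt hCC0
  · intro β hβ j
    let b : TF Ω := ⟨fun k => if k = j then β else fun _ => 0, fun k => by
      dsimp only
      split_ifs
      · exact hβ
      · exact Tst.zero⟩
    have h1 := hu2 b
    have hb1 : l b = ∫ x, dzb j X x * β x := by
      show ∫ x, ∑ k, dzb k X x * b.1 k x = _
      refine integral_congr_ae (ae_of_all _ fun x => ?_)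
      simp only [b]
      rw [Finset.sum_eq_single j]
      · simp
      · intro k _ hk; simp [hk]
      · simp
    have hb2 : ∀ x, ∑ k, dzb k (b.1 k) x = dzb j β x := by
      intro x
      simp only [b]
      rw [Finset.sum_eq_single j]
      · simp
      · intro k _ hk; simp [hk, dzb]
      · simp
    have hIntg : Integrable (fun x => u x * dzb j β x) := by
      have h3 : IntegrableOn (fun x => u x * dzb j β x) Ω := by
        have := ((vp (hβ.dzb j)).integrable_mul
          ((Lp.memLp u0).star)).neg
        refine (integrable_congr ?_).1 this
        filter_upwards [ae_restrict_mem hΩ.measurableSet] with x hx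
        simp only [u, indicator_of_mem hx, Pi.mul_apply, Pi.neg_apply, Pi.star_apply]
        simp only [RCLike.star_def]
        ring
      rwa [integrableOn_iff_integrable_of_support_subset] at h3
      intro x hx
      by_contra h
      exact hx (by simp [hoff x h])
    have hb3 : inner ℂ u0 (T b) = - ∫ x, u x * dzb j β x := by
      rw [L2.inner_def, ← integral_neg, ← restr_int (Ω := Ω) (fun x hx => by simp [hoff x hx])]
      refine integral_congr_ae ?_
      filter_upwards [(vp (hS b)).coeFn_toLp, ae_restrict_mem hΩ.measurableSet] with x hx hxΩ
      have : T b x = (sp x : ℂ) * _ := hx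
      rw [this, hb2, RCLike.inner_apply]
      simp only [u, indicator_of_mem hxΩ]
      ring
    rw [hb1, hb3] at h1
    have h4 := dzb_ibp hX.sm hβ.sm hβ.cs j
    simp only [sub_mul]
    rw [integral_sub (hX.int (dzb_contDiff hβ.sm j).continuous) hIntg, h4, h1]
    ring

end exist

section reg
open MeasureTheory Filter
variable {M : ℕ}

lemma fderiv_eq_of_dzb {v : CN M → ℂ} {x : CN M} (h : ∀ j, dzb j v x = 0) (w : CN M) :
    fderiv ℝ v x w = ∑ j, w j * fderiv ℝ v x (Pi.single j 1) := by
  have hw : w = ∑ j, ((w j).re • (Pi.single j 1 : CN M) + (w j).im • (Pi.single j Complex.I : CN M)) := by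
    funext i
    rw [Finset.sum_apply, Finset.sum_eq_single i]
    · simp [Complex.re_add_im]
    · intro b _ hb; simp [Pi.single_eq_of_ne hb.symm]
    · simp
  conv_lhs => rw [hw]
  rw [map_sum]
  refine Finset.sum_congr rfl fun j _ => ?_
  have hj := h j
  unfold dzb at hj
  rw [map_add, map_smul, map_smul]
  have : fderiv ℝ v x (Pi.single j Complex.I) = Complex.I * fderiv ℝ v x (Pi.single j 1) := by
    have hI := Complex.I_mul_I
    linear_combination (-2 * Complex.I) * hj + (fderiv ℝ v x (Pi.single j Complex.I)) * hI
  rw [this]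
  conv_rhs => rw [← Complex.re_add_im (w j)]
  simp only [Complex.real_smul]; ring

lemma differentiableAt_of_dzb {v : CN M → ℂ} {x : CN M} (hv : DifferentiableAt ℝ v x)
    (h : ∀ j, dzb j v x = 0) : DifferentiableAt ℂ v x := by
  rw [differentiableAt_iff_restrictScalars ℝ hv]
  refine ⟨∑ j, (fderiv ℝ v x (Pi.single j 1)) • (ContinuousLinearMap.proj (R := ℂ) (φ := fun _ : Fin M => ℂ) j), ?_⟩
  ext w
  rw [fderiv_eq_of_dzb h w]
  simp [mul_comm]

lemma rot_mp {c : ℂ} (hc : ‖c‖ = 1) : MeasurePreserving (fun z : CN M => c • z) := by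
  have h1 : MeasurePreserving (fun z : ℂ => c * z) := by
    have h2 := (rotation (⟨c, mem_sphere_zero_iff_norm.2 hc⟩ : Circle)).measurePreserving
    convert h2 using 1
    exact (funext fun z => rfl)
  exact volume_preserving_pi (fun _ : Fin M => h1)

lemma mol_rot (ε : ℝ) (g : CN M → ℂ) (z : CN M) {c : ℂ} (hc : ‖c‖ = 1) :
    ∫ t, g (z - c • t) * kerC ε t = mol ε g z := by
  have hc0 : c ≠ 0 := by rintro rfl; simp at hc
  rw [mol_eq_translate]
  have := (rot_mp (M := M) hc).integral_comp
    (MeasurableEquiv.smul₀ c hc0).measurableEmbedding (fun t => g (z - t) * kerC ε t)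
  rw [← this]
  congr 1; funext t
  simp [kerC, ker_smul ε hc]

lemma mol_hol {ε ε' : ℝ} (hε : 0 < ε) (hεε : ε < ε') {g : CN M → ℂ} (hg : Continuous g) {z : CN M}
    (hd : DifferentiableOn ℂ g (Metric.ball z ε')) : mol ε g z = g z := by
  have hpi := Real.pi_pos
  have hmv : ∀ t : CN M, (∫ θ in (0:ℝ)..2 * Real.pi, g (z - circleMap 0 1 θ • t) * kerC ε t)
      = (2 * Real.pi) * (g z * kerC ε t) := by
    intro t
    by_cases ht : ε ≤ ‖t‖
    · simp [kerC_zero_of hε ht]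
    push Not at ht
    rw [intervalIntegral.integral_mul_const]
    have h1 : DiffContOnCl ℂ (fun c : ℂ => g (z - c • t)) (Metric.ball 0 |1|) := by
      have : DifferentiableOn ℂ (fun c : ℂ => g (z - c • t)) (Metric.closedBall 0 |1|) := by
        refine hd.comp (t := Metric.ball z ε') (by fun_prop) ?_
        intro c hc
        simp at hc
        simp only [Metric.mem_ball, dist_eq_norm, sub_sub_cancel_left, norm_neg, norm_smul]
        nlinarith [norm_nonneg t]
      exact this.diffContOnCl_ball (by simp)
    have h2 := h1.circleAverage
    rw [Real.circleAverage_def] at h2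
    simp only [zero_smul, sub_zero] at h2
    rw [← h2, Complex.real_smul]
    push_cast
    field_simp
  have hsw := MeasureTheory.intervalIntegral_integral_swap (μ := (volume : Measure (CN M))) (a := 0) (b := 2 * Real.pi)
    (f := fun θ t => g (z - circleMap 0 1 θ • t) * kerC ε t) (by
      have : (volume.restrict (uIoc (0:ℝ) (2 * Real.pi))).prod (volume : Measure (CN M))
          = (volume.prod volume).restrict (uIoc 0 (2 * Real.pi) ×ˢ univ) := by
        rw [← Measure.prod_restrict, Measure.restrict_univ]
      rw [this]
      have hc : Continuous (Function.uncurry fun (θ : ℝ) (t : CN M) => g (z - circleMap 0 1 θ • t) * kerC ε t) := by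
        have := (kerC_contDiff (M := M) ε).continuous
        have h2 := continuous_circleMap 0 1
        unfold Function.uncurry
        fun_prop
      have hi : IntegrableOn (Function.uncurry fun (θ : ℝ) (t : CN M) => g (z - circleMap 0 1 θ • t) * kerC ε t)
          (Icc 0 (2 * Real.pi) ×ˢ Metric.closedBall 0 ε) (volume.prod volume) :=
        hc.continuousOn.integrableOn_compact (isCompact_Icc.prod (isCompact_closedBall _ _))
      refine hi.of_forall_sdiff_eq_zero (measurableSet_uIoc.prod MeasurableSet.univ) ?_
      rintro ⟨θ, t⟩ ⟨h1, h2⟩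
      simp only [mem_prod, mem_univ, and_true, uIoc_of_le (by positivity : (0:ℝ) ≤ 2 * Real.pi)] at h1
      have : ε ≤ ‖t‖ := by
        by_contra hcon
        push Not at hcon
        exact h2 ⟨⟨h1.1.le, h1.2⟩, by simpa using hcon.le⟩
      simp [kerC_zero_of hε this])
  have hl : (∫ θ in (0:ℝ)..2 * Real.pi, ∫ t, g (z - circleMap 0 1 θ • t) * kerC ε t)
      = (2 * Real.pi) * mol ε g z := by
    have : ∀ θ : ℝ, ∫ t, g (z - circleMap 0 1 θ • t) * kerC ε t = mol ε g z :=
      fun θ => mol_rot ε g z (by simp)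
    simp [this]
  rw [hl] at hsw
  simp only [hmv] at hsw
  rw [integral_const_mul, integral_const_mul] at hsw
  have hk : ∫ t : CN M, kerC ε t = 1 := by
    have := integral_ofReal (𝕜 := ℂ) (μ := (volume : Measure (CN M))) (f := ker ε)
    rw [ker_integral hε] at this
    exact this.trans (by simp)
  rw [hk, mul_one] at hsw
  exact mul_left_cancel₀ (by norm_cast; positivity) hsw

lemma mol_ptw {ε : ℝ} (hε : 0 < ε) {f : CN M → ℂ} (hf : MemLp f 2) (x : CN M) :
    ‖mol ε f x‖ ^ 2 ≤ (∫ t : CN M, ker ε t ^ 2) * ∫ y, ‖f y‖ ^ 2 := by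
  have h0 : ‖mol ε f x‖ ≤ ∫ y, ‖f y‖ * ker ε (x - y) := by
    refine (norm_integral_le_integral_norm _).trans (le_of_eq ?_)
    congr 1; funext y
    rw [norm_mul, kerC, Complex.norm_real, Real.norm_of_nonneg (ker_nonneg _ _)]
  have hk : MemLp (fun y : CN M => ker ε (x - y)) 2 := by
    refine Continuous.memLp_of_hasCompactSupport ?_ ?_
    · have := (ker_contDiff (M := M) ε).continuous
      fun_prop
    · refine HasCompactSupport.intro (isCompact_closedBall x ε) fun y hy => ker_zero_of hε ?_
      simp [dist_comm, dist_eq_norm] at hy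
      exact hy.le
  have h1 := integral_mul_le_Lp_mul_Lq_of_nonneg (μ := (volume : Measure (CN M))) Real.HolderConjugate.two_two
    (f := fun y => ‖f y‖) (g := fun y => ker ε (x - y)) (ae_of_all _ fun y => norm_nonneg _)
    (ae_of_all _ fun y => ker_nonneg _ _) (by simpa using hf.norm) (by simpa using hk)
  simp only [Real.rpow_two, ← Real.sqrt_eq_rpow] at h1
  have h2 : ∫ y : CN M, ker ε (x - y) ^ 2 = ∫ t : CN M, ker ε t ^ 2 :=
    integral_sub_left_eq_self (fun y => ker ε y ^ 2) volume x
  rw [h2] at h1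
  have h3 := h0.trans h1
  have h4 := pow_le_pow_left₀ (norm_nonneg _) h3 2
  rw [mul_pow, Real.sq_sqrt (integral_nonneg fun _ => by positivity), Real.sq_sqrt (integral_nonneg fun _ => by positivity)] at h4
  linarith

lemma cont_cutoff_mul {E : Type*} [TopologicalSpace E] {Ω : Set E} (hΩ : IsOpen Ω)
    {χ : E → ℝ} (hχ : Continuous χ) (ht : tsupport χ ⊆ Ω)
    {g : E → ℂ} (hg : ContinuousOn g Ω) : Continuous (fun x => (χ x : ℂ) * g x) := by
  rw [continuous_iff_continuousAt]
  intro x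
  by_cases hx : x ∈ Ω
  · exact (Complex.continuous_ofReal.comp hχ).continuousAt.mul (hg.continuousAt (hΩ.mem_nhds hx))
  · have : (fun x => (χ x : ℂ) * g x) =ᶠ[𝓝 x] fun _ => 0 := by
      filter_upwards [(isClosed_tsupport χ).isOpen_compl.mem_nhds fun h => hx (ht h)] with y hy
      simp [image_eq_zero_of_notMem_tsupport hy]
    exact continuousAt_const.congr this.symm

/-- globally continuous replacement of a holomorphic function near a compact ball -/
lemma hol_glob {Ω : Set (CN M)} (hΩ : IsOpen Ω) {g : CN M → ℂ} (hg : DifferentiableOn ℂ g Ω)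
    {K : Set (CN M)} (hK : IsCompact K) (hKΩ : K ⊆ Ω) :
    ∃ g1 : CN M → ℂ, Continuous g1 ∧ ∀ x ∈ K, g1 x = g x := by
  obtain ⟨χ, h1, h2, h3, h4, U, hU, hKU, -, hU1⟩ := exists_cutoff hK hΩ hKΩ
  exact ⟨_, cont_cutoff_mul hΩ h1.continuous h3 hg.continuousOn, fun x hx => by simp [hU1 x (hKU hx)]⟩

lemma hol_mol {Ω : Set (CN M)} (hΩ : IsOpen Ω) {g : CN M → ℂ} (hg : DifferentiableOn ℂ g Ω)
    {x : CN M} {r : ℝ} (hr : 0 < r) (hb : Metric.closedBall x r ⊆ Ω) :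
    ∃ g1 : CN M → ℂ, Continuous g1 ∧ (∀ y ∈ Metric.closedBall x r, g1 y = g y) ∧
      ∀ z ∈ Metric.ball x (r / 2), mol (r / 4) g1 z = g z := by
  obtain ⟨g1, hc, he⟩ := hol_glob hΩ hg (isCompact_closedBall x r) hb
  refine ⟨g1, hc, he, fun z hz => ?_⟩
  have hsub : Metric.ball z (r / 2) ⊆ Metric.closedBall x r := by
    intro y hy
    simp only [Metric.mem_ball, Metric.mem_closedBall] at *
    linarith [dist_triangle y z x]
  rw [mol_hol (ε' := r / 2) (by positivity) (by linarith) hc, he z (hsub (Metric.mem_ball_self (by positivity)))]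
  exact (hg.mono (hsub.trans hb)).congr fun y hy => he y (hsub hy)

lemma hol_contDiffAt {Ω : Set (CN M)} (hΩ : IsOpen Ω) {g : CN M → ℂ} (hg : DifferentiableOn ℂ g Ω)
    {x : CN M} (hx : x ∈ Ω) : ContDiffAt ℝ ∞ g x := by
  obtain ⟨r, hr, hb⟩ := Metric.nhds_basis_closedBall.mem_iff.1 (hΩ.mem_nhds hx)
  obtain ⟨g1, hc, -, h⟩ := hol_mol hΩ hg hr hb
  refine (mol_contDiff (ε := r / 4) (by positivity) hc.locallyIntegrable).contDiffAt.congr_of_eventuallyEq ?_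
  filter_upwards [Metric.ball_mem_nhds x (by positivity : 0 < r / 2)] with z hz using (h z hz).symm

lemma hol_ptw {Ω : Set (CN M)} (hΩ : IsOpen Ω) {g : CN M → ℂ} (hg : DifferentiableOn ℂ g Ω)
    {x : CN M} {r : ℝ} (hr : 0 < r) (hb : Metric.closedBall x r ⊆ Ω) :
    ‖g x‖ ^ 2 ≤ (∫ t : CN M, _root_.ker (r / 4) t ^ 2) * ∫ y in Metric.closedBall x r, ‖g y‖ ^ 2 := by
  obtain ⟨g1, hc, he, h⟩ := hol_mol hΩ hg hr hb
  rw [← h x (Metric.mem_ball_self (by positivity))]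
  have e1 : mol (r / 4) g1 x = mol (r / 4) ((Metric.closedBall x r).indicator g1) x := by
    unfold mol
    congr 1; funext y
    by_cases hy : y ∈ Metric.closedBall x r
    · rw [indicator_of_mem hy]
    · rw [kerC_zero_of (by positivity), mul_zero, mul_zero]
      simp [dist_comm, dist_eq_norm] at hy
      linarith
  rw [e1]
  have hm : MemLp ((Metric.closedBall x r).indicator g1) 2 := by
    rw [memLp_indicator_iff_restrict measurableSet_closedBall]
    obtain ⟨C, hC⟩ := (isCompact_closedBall x r).exists_bound_of_continuousOn hc.continuousOn
    haveI : IsFiniteMeasure ((volume : Measure (CN M)).restrict (Metric.closedBall x r)) :=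
      ⟨by simpa using (isCompact_closedBall x r).measure_lt_top⟩
    exact MemLp.of_bound hc.aestronglyMeasurable C ((ae_restrict_iff' measurableSet_closedBall).2 (ae_of_all _ hC))
  refine (mol_ptw (by positivity) hm x).trans (le_of_eq ?_)
  congr 1
  rw [← integral_indicator measurableSet_closedBall]
  congr 1; funext y
  by_cases hy : y ∈ Metric.closedBall x r
  · simp [indicator_of_mem hy, he y hy]
  · simp [indicator_of_notMem hy]

lemma weak_loc {F : CN M → ℂ} (hF : MemLp F 2) {q : CN M} {r : ℝ} (hr : 0 < r)
    (hw : ∀ β, Tst (Metric.ball q (2 * r)) β → ∀ j, ∫ x, F x * dzb j β x = 0) :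
    ∃ G : CN M → ℂ, DifferentiableOn ℂ G (Metric.ball q (r / 2)) ∧
      ∀ᵐ x, x ∈ Metric.ball q (r / 2) → F x = G x := by
  have hloc := hF.locallyIntegrable (by norm_num)
  have hhol : ∀ ε : ℝ, 0 < ε → ε < r → DifferentiableOn ℂ (mol ε F) (Metric.ball q r) := by
    intro ε hε hεr x hx
    refine (differentiableAt_of_dzb ((mol_contDiff hε hloc).differentiable (by simp) x) fun j => ?_).differentiableWithinAt
    rw [mol_dzb hε hloc, hw, neg_zero]
    have hs : ∀ y, y ∉ Metric.closedBall x ε → kerC ε (x - y) = 0 := by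
      intro y hy
      refine kerC_zero_of hε ?_
      simp [dist_comm, dist_eq_norm] at hy
      exact hy.le
    refine ⟨(kerC_contDiff ε).comp (contDiff_const.sub contDiff_id), HasCompactSupport.intro (isCompact_closedBall x ε) hs, ?_⟩
    refine (closure_minimal (t := Metric.closedBall x ε) (fun y hy => ?_) Metric.isClosed_closedBall).trans (Metric.closedBall_subset_ball' ?_)
    · by_contra hcon; exact hy (hs y hcon)
    · have := Metric.mem_ball.1 hx; linarith
  refine ⟨mol (r / 4) F, (hhol _ (by positivity) (by linarith)).mono (Metric.ball_subset_ball (by linarith)), ?_⟩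
  have hL := L2c_mol hF
  have hpt : ∀ z ∈ Metric.ball q (r / 2), Tendsto (fun n => mol (eps n) F z) atTop (𝓝 (mol (r / 4) F z)) := by
    intro z hz
    have hcv : Tendsto (fun n => (∫ t : CN M, _root_.ker (r / 4) t ^ 2) * ∫ y, ‖mol (eps n) F y - F y‖ ^ 2) atTop (𝓝 0) := by
      have h0 : L2c (fun n => mol (eps n) F - F) (fun _ => 0) :=
        ⟨fun n => (hL.1 n).sub hF, MemLp.zero', by
          have e : ∀ n, (mol (eps n) F - F) - (fun _ => (0 : ℂ)) = mol (eps n) F - F := fun n => by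
            funext y; simp
          simpa only [e] using hL.2.2⟩
      have h1 := (h0.int_tendsto (W := fun _ => 1) continuous_const (fun _ => by norm_num) (C := 1) (fun _ => le_rfl)).const_mul
        (∫ t : CN M, _root_.ker (r / 4) t ^ 2)
      simpa using h1
    have hev : ∀ᶠ n in atTop, ‖mol (eps n) F z - mol (r / 4) F z‖ ^ 2 ≤
        (∫ t : CN M, _root_.ker (r / 4) t ^ 2) * ∫ y, ‖mol (eps n) F y - F y‖ ^ 2 := by
      filter_upwards [eps_tendsto.eventually_lt_const hr] with n hn
      have hcont := (mol_contDiff (eps_pos n) hloc).continuous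
      have h1 : mol (r / 4) (mol (eps n) F) z = mol (eps n) F z := by
        refine mol_hol (ε' := r / 2) (by positivity) (by linarith) hcont
          ((hhol _ (eps_pos n) hn).mono (Metric.ball_subset_ball' ?_))
        have := Metric.mem_ball.1 hz; linarith
      have h2 := mol_ptw (ε := r / 4) (by positivity) ((hL.1 n).sub hF) z
      have h3 : mol (r / 4) (mol (eps n) F - F) z = mol (r / 4) (mol (eps n) F) z - mol (r / 4) F z := by
        have hk := (kerC_contDiff (M := M) (r / 4)).continuous
        have hkc : HasCompactSupport (fun y : CN M => kerC (r / 4) (z - y)) := by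
          refine HasCompactSupport.intro (isCompact_closedBall z (r / 4)) fun y hy => kerC_zero_of (by positivity) ?_
          simp [dist_comm, dist_eq_norm] at hy
          exact hy.le
        have hkc2 : Continuous (fun y : CN M => kerC (r / 4) (z - y)) := by fun_prop
        unfold mol
        rw [← integral_sub]
        · congr 1; funext y; simp; ring
        · exact ((hcont.mul hkc2).integrable_of_hasCompactSupport hkc.mul_left)
        · have := hloc.integrable_smul_right_of_hasCompactSupport hkc2 hkc
          simpa [mul_comm] using this
      rw [h3, h1] at h2
      exact h2
    have h5 : Tendsto (fun n => ‖mol (eps n) F z - mol (r / 4) F z‖ ^ 2) atTop (𝓝 0) :=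
      tendsto_of_tendsto_of_tendsto_of_le_of_le' tendsto_const_nhds hcv (Eventually.of_forall fun n => by positivity) hev
    have h6 := h5.sqrt
    simp only [Real.sqrt_zero, Real.sqrt_sq (norm_nonneg _)] at h6
    exact tendsto_iff_norm_sub_tendsto_zero.2 h6
  have hms := tendstoInMeasure_of_tendsto_eLpNorm (p := 2) (by norm_num) (fun n => (hL.1 n).1) hF.1 hL.2.2
  obtain ⟨ns, hns, hae⟩ := hms.exists_seq_tendsto_ae
  filter_upwards [hae] with x hx hxb
  exact tendsto_nhds_unique hx ((hpt x hxb).comp hns.tendsto_atTop)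

lemma weak_reg {Ω : Set (CN M)} (hΩ : IsOpen Ω) {F : CN M → ℂ}
    (hF : ∀ x ∈ Ω, ∃ r > 0, Metric.ball x r ⊆ Ω ∧ MemLp ((Metric.ball x r).indicator F) 2)
    (hw : ∀ β, Tst Ω β → ∀ j, ∫ x, F x * dzb j β x = 0) :
    ∃ G : CN M → ℂ, DifferentiableOn ℂ G Ω ∧ ∀ᵐ x, x ∈ Ω → F x = G x := by
  have hl : ∀ x : CN M, ∃ r : ℝ, 0 < r ∧ (x ∈ Ω → Metric.ball x r ⊆ Ω ∧ ∃ G : CN M → ℂ,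
      DifferentiableOn ℂ G (Metric.ball x r) ∧ ∀ᵐ y, y ∈ Metric.ball x r → F y = G y) := by
    intro x
    by_cases hx : x ∈ Ω
    · obtain ⟨r, hr, hb, hm⟩ := hF x hx
      obtain ⟨G, hG, hae⟩ := weak_loc hm (q := x) (r := r / 2) (by positivity) (by
        intro β hβ j
        rw [show 2 * (r / 2) = r by ring] at hβ
        rw [← hw β ⟨hβ.sm, hβ.cs, hβ.ts.trans hb⟩ j]
        congr 1; funext y
        by_cases hy : y ∈ Metric.ball x r
        · rw [indicator_of_mem hy]
        · rw [dzb_eq_zero_of_notMem (fun h => hy (hβ.ts h))]; simp)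
      refine ⟨r / 2 / 2, by positivity, fun _ => ⟨(Metric.ball_subset_ball (by linarith)).trans hb, G, hG, ?_⟩⟩
      filter_upwards [hae] with y hy hyb
      rw [← hy hyb, indicator_of_mem (Metric.ball_subset_ball (by linarith) hyb)]
    · exact ⟨1, one_pos, fun h => absurd h hx⟩
  choose r hr hl using hl
  choose! hb G hG hae using hl
  have key : ∀ x ∈ Ω, ∀ y ∈ Ω, ∀ z ∈ Metric.ball x (r x) ∩ Metric.ball y (r y), G x z = G y z := by
    intro x hx y hy
    have ho : IsOpen (Metric.ball x (r x) ∩ Metric.ball y (r y)) := Metric.isOpen_ball.inter Metric.isOpen_ball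
    refine Measure.eqOn_open_of_ae_eq (μ := volume) ?_ ho ((hG x hx).continuousOn.mono inter_subset_left)
      ((hG y hy).continuousOn.mono inter_subset_right)
    rw [Filter.EventuallyEq, ae_restrict_iff' ho.measurableSet]
    filter_upwards [hae x hx, hae y hy] with z h1 h2 h3
    rw [← h1 h3.1, h2 h3.2]
  have hself : ∀ x, x ∈ Metric.ball x (r x) := fun x => Metric.mem_ball_self (hr x)
  have hev : ∀ x ∈ Ω, ∀ z ∈ Metric.ball x (r x), G z z = G x z := fun x hx z hz =>
    key z (hb x hx hz) x hx z ⟨hself z, hz⟩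
  refine ⟨fun z => G z z, fun x hx => ?_, ?_⟩
  · have h1 := (hG x hx).differentiableAt (Metric.ball_mem_nhds x (hr x))
    refine (h1.congr_of_eventuallyEq ?_).differentiableWithinAt
    filter_upwards [Metric.ball_mem_nhds x (hr x)] with z hz using hev x hx z hz
  · rw [ae_iff]
    refine measure_null_of_locally_null _ fun x hx => ?_
    simp only [mem_ofPred_eq, Classical.not_imp] at hx
    refine ⟨Metric.ball x (r x) ∩ {a | ¬(a ∈ Ω → F a = G a a)}, inter_mem (mem_nhdsWithin_of_mem_nhds (Metric.ball_mem_nhds x (hr x))) self_mem_nhdsWithin, ?_⟩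
    have := ae_iff.1 (hae x hx.1)
    refine measure_mono_null (fun z hz => ?_) this
    simp only [mem_ofPred_eq, Classical.not_imp] at hz ⊢
    exact ⟨hz.1, by rw [← hev x hx.1 z hz.1]; exact hz.2.2⟩
end reg

section psh
open Filter
variable {E : Type*} [NormedAddCommGroup E] [NormedSpace ℝ E]

lemma cdiff_ev {F : Type*} [NormedAddCommGroup F] [NormedSpace ℝ F] {u : E → F} {x : E}
    (hu : ContDiffAt ℝ ∞ u x) : ∀ᶠ y in 𝓝 x, DifferentiableAt ℝ u y := by
  have := (hu.of_le (show (1 : WithTop ℕ∞) ≤ ∞ by norm_cast)).eventually (by simp)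
  filter_upwards [this] with y hy using hy.differentiableAt (by simp)

/-- second derivative in direction `a` -/
def d2 (u : E → ℝ) (x a : E) : ℝ := fderiv ℝ (fun y => fderiv ℝ u y a) x a

lemma d2_congr {u v : E → ℝ} {x : E} (h : u =ᶠ[𝓝 x] v) (a : E) : d2 u x a = d2 v x a := by
  unfold d2
  have : (fun y => fderiv ℝ u y a) =ᶠ[𝓝 x] (fun y => fderiv ℝ v y a) := by
    filter_upwards [h.fderiv (𝕜 := ℝ)] with y hy using by rw [hy]
  rw [this.fderiv_eq]

lemma d2_comp {u : E → ℝ} {x : E} (hu : ContDiffAt ℝ ∞ u x) {χ : ℝ → ℝ} (hχ : ContDiffAt ℝ ∞ χ (u x)) (a : E) :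
    d2 (fun y => χ (u y)) x a = deriv (deriv χ) (u x) * (fderiv ℝ u x a) ^ 2 + deriv χ (u x) * d2 u x a := by
  have h1 : (fun y => fderiv ℝ (fun y => χ (u y)) y a) =ᶠ[𝓝 x] fun y => deriv χ (u y) * fderiv ℝ u y a := by
    filter_upwards [cdiff_ev hu, hu.continuousAt.eventually (cdiff_ev hχ)] with y h1 h2
    have := (h2.hasDerivAt.comp_hasFDerivAt y h1.hasFDerivAt).fderiv
    rw [show (fun y => χ (u y)) = χ ∘ u from rfl, this]; simp
  have hd : ContDiffAt ℝ ∞ (deriv χ) (u x) := by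
    have := contDiffAt_fderiv_apply hχ 1
    exact this
  have h2 := (hd.differentiableAt (by simp)).hasDerivAt.comp_hasFDerivAt x (hu.differentiableAt (by simp)).hasFDerivAt
  have h3 := ((contDiffAt_fderiv_apply hu a).differentiableAt (by simp)).hasFDerivAt
  unfold d2
  rw [h1.fderiv_eq, show (fun y => deriv χ (u y) * fderiv ℝ u y a) = (deriv χ ∘ u) * (fun y => fderiv ℝ u y a) from rfl, (h2.mul h3).fderiv]
  simp; ring

lemma d2_add {u v : E → ℝ} {x : E} (hu : ContDiffAt ℝ ∞ u x) (hv : ContDiffAt ℝ ∞ v x) (a : E) :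
    d2 (fun y => u y + v y) x a = d2 u x a + d2 v x a := by
  have h1 : (fun y => fderiv ℝ (fun y => u y + v y) y a) =ᶠ[𝓝 x] fun y => fderiv ℝ u y a + fderiv ℝ v y a := by
    filter_upwards [cdiff_ev hu, cdiff_ev hv] with y h1 h2
    rw [(h1.hasFDerivAt.fun_add h2.hasFDerivAt).fderiv]; simp
  unfold d2
  rw [h1.fderiv_eq, (((contDiffAt_fderiv_apply hu a).differentiableAt (by simp)).hasFDerivAt.fun_add
    ((contDiffAt_fderiv_apply hv a).differentiableAt (by simp)).hasFDerivAt).fderiv]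
  simp

lemma d2_const_mul {u : E → ℝ} {x : E} (hu : ContDiffAt ℝ ∞ u x) (c : ℝ) (a : E) :
    d2 (fun y => c * u y) x a = c * d2 u x a := by
  have := d2_comp hu (χ := fun t => c * t) (by fun_prop) a
  rw [this]
  have : deriv (fun t : ℝ => c * t) = fun _ => c := by funext t; simp
  rw [this]; simp

lemma d2_const (c : ℝ) (x a : E) : d2 (fun _ => c) x a = 0 := by
  simp [d2]

variable [NormedSpace ℂ E]

/-- Levi form (Laplacian along a complex line) -/
def lv (u : E → ℝ) (x ξ : E) : ℝ := d2 u x ξ + d2 u x (Complex.I • ξ)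

/-- squared gradient along a complex line -/
def gr (u : E → ℝ) (x ξ : E) : ℝ := fderiv ℝ u x ξ ^ 2 + fderiv ℝ u x (Complex.I • ξ) ^ 2

lemma gr_nonneg (u : E → ℝ) (x ξ : E) : 0 ≤ gr u x ξ := by unfold gr; positivity

lemma lv_congr {u v : E → ℝ} {x : E} (h : u =ᶠ[𝓝 x] v) (ξ : E) : lv u x ξ = lv v x ξ := by
  simp [lv, d2_congr h]

lemma lv_comp {u : E → ℝ} {x : E} (hu : ContDiffAt ℝ ∞ u x) {χ : ℝ → ℝ} (hχ : ContDiffAt ℝ ∞ χ (u x)) (ξ : E) :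
    lv (fun y => χ (u y)) x ξ = deriv (deriv χ) (u x) * gr u x ξ + deriv χ (u x) * lv u x ξ := by
  simp only [lv, gr, d2_comp hu hχ]; ring

lemma lv_add {u v : E → ℝ} {x : E} (hu : ContDiffAt ℝ ∞ u x) (hv : ContDiffAt ℝ ∞ v x) (ξ : E) :
    lv (fun y => u y + v y) x ξ = lv u x ξ + lv v x ξ := by
  simp only [lv, d2_add hu hv]; ring

lemma lv_const_mul {u : E → ℝ} {x : E} (hu : ContDiffAt ℝ ∞ u x) (c : ℝ) (ξ : E) :
    lv (fun y => c * u y) x ξ = c * lv u x ξ := by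
  simp only [lv, d2_const_mul hu]; ring

lemma lv_sub {u v : E → ℝ} {x : E} (hu : ContDiffAt ℝ ∞ u x) (hv : ContDiffAt ℝ ∞ v x) (ξ : E) :
    lv (fun y => u y - v y) x ξ = lv u x ξ - lv v x ξ := by
  have := lv_add hu (contDiffAt_const.mul hv : ContDiffAt ℝ ∞ (fun y => (-1) * v y) x) ξ
  rw [lv_const_mul hv] at this
  simpa [sub_eq_add_neg] using this

lemma lv_const (c : ℝ) (x ξ : E) : lv (fun _ => c) x ξ = 0 := by simp [lv, d2_const]

/-- smooth plurisubharmonic at a point -/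
def Psh (u : E → ℝ) (x : E) : Prop := ContDiffAt ℝ ∞ u x ∧ ∀ ξ, 0 ≤ lv u x ξ

lemma Psh.congr {u v : E → ℝ} {x : E} (hu : Psh u x) (h : v =ᶠ[𝓝 x] u) : Psh v x :=
  ⟨hu.1.congr_of_eventuallyEq h, fun ξ => by rw [lv_congr h]; exact hu.2 ξ⟩

lemma Psh.add {u v : E → ℝ} {x : E} (hu : Psh u x) (hv : Psh v x) : Psh (fun y => u y + v y) x :=
  ⟨hu.1.add hv.1, fun ξ => by rw [lv_add hu.1 hv.1]; exact add_nonneg (hu.2 ξ) (hv.2 ξ)⟩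

lemma Psh.const (c : ℝ) (x : E) : Psh (fun _ => c) x :=
  ⟨contDiffAt_const, fun ξ => by rw [lv_const]⟩

lemma Psh.const_mul {u : E → ℝ} {x : E} (hu : Psh u x) {c : ℝ} (hc : 0 ≤ c) : Psh (fun y => c * u y) x :=
  ⟨contDiffAt_const.mul hu.1, fun ξ => by rw [lv_const_mul hu.1]; exact mul_nonneg hc (hu.2 ξ)⟩

lemma Psh.sum {ι : Type*} (s : Finset ι) {u : ι → E → ℝ} {x : E} (h : ∀ i ∈ s, Psh (u i) x) :
    Psh (fun y => ∑ i ∈ s, u i y) x := by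
  classical
  induction s using Finset.induction_on with
  | empty => simpa using Psh.const 0 x
  | insert a s ha ih =>
    simp only [Finset.sum_insert ha]
    exact (h a (by simp)).add (ih fun i hi => h i (by simp [hi]))

lemma Psh.comp {u : E → ℝ} {x : E} (hu : Psh u x) {χ : ℝ → ℝ} (hχ : ContDiffAt ℝ ∞ χ (u x))
    (h1 : 0 ≤ deriv χ (u x)) (h2 : 0 ≤ deriv (deriv χ) (u x)) : Psh (fun y => χ (u y)) x :=
  ⟨hχ.comp x hu.1, fun ξ => by
    rw [lv_comp hu.1 hχ]
    exact add_nonneg (mul_nonneg h2 (gr_nonneg _ _ _)) (mul_nonneg h1 (hu.2 ξ))⟩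

lemma Psh.exp {u : E → ℝ} {x : E} (hu : Psh u x) : Psh (fun y => Real.exp (u y)) x :=
  hu.comp Real.contDiff_exp.contDiffAt (by simp [Real.exp_nonneg]) (by simp [Real.exp_nonneg])

/-- regularized maximum -/
lemma Psh.rmax {u v : E → ℝ} {x : E} (hu : Psh u x) (hv : Psh v x) {χ : ℝ → ℝ} (hχ : ContDiff ℝ ∞ χ)
    (h0 : ∀ t, 0 ≤ deriv χ t) (h1 : ∀ t, deriv χ t ≤ 1) (h2 : ∀ t, 0 ≤ deriv (deriv χ) t) :
    Psh (fun y => v y + χ (u y - v y)) x := by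
  have hc := hu.1.sub hv.1
  have hcc : ContDiffAt ℝ ∞ (fun y => χ (u y - v y)) x := hχ.contDiffAt.comp x hc
  refine ⟨hv.1.add hcc, fun ξ => ?_⟩
  rw [lv_add hv.1 hcc, lv_comp hc hχ.contDiffAt]
  change 0 ≤ lv v x ξ + (deriv (deriv χ) (u x - v x) * gr (fun y => u y - v y) x ξ + deriv χ (u x - v x) * lv (fun y => u y - v y) x ξ)
  rw [lv_sub hu.1 hv.1]
  have a1 := mul_nonneg (h2 (u x - v x)) (gr_nonneg (fun y => u y - v y) x ξ)
  have a2 := mul_nonneg (h0 (u x - v x)) (hu.2 ξ)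
  have a3 := mul_nonneg (sub_nonneg.2 (h1 (u x - v x))) (hv.2 ξ)
  nlinarith

section holo
variable [IsScalarTower ℝ ℂ E]

lemma hol_fderiv_real {g : E → ℂ} {x : E} (hg : DifferentiableAt ℂ g x) (a : E) :
    fderiv ℝ g x a = fderiv ℂ g x a := by
  rw [(hg.hasFDerivAt.restrictScalars ℝ).fderiv]; rfl

lemma fderiv_re {g : E → ℂ} {x : E} (hg : DifferentiableAt ℝ g x) (a : E) :
    fderiv ℝ (fun y => (g y).re) x a = (fderiv ℝ g x a).re := by
  have := (Complex.reCLM.hasFDerivAt.comp x hg.hasFDerivAt).fderiv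
  exact DFunLike.congr_fun this a

lemma fderiv_im {g : E → ℂ} {x : E} (hg : DifferentiableAt ℝ g x) (a : E) :
    fderiv ℝ (fun y => (g y).im) x a = (fderiv ℝ g x a).im := by
  have := (Complex.imCLM.hasFDerivAt.comp x hg.hasFDerivAt).fderiv
  exact DFunLike.congr_fun this a

lemma hol_lap {g : E → ℂ} {x : E} (hc : ContDiffAt ℝ ∞ g x) (hg : ∀ᶠ y in 𝓝 x, DifferentiableAt ℂ g y) (ξ : E) :
    fderiv ℝ (fun y => fderiv ℝ g y ξ) x ξ
      + fderiv ℝ (fun y => fderiv ℝ g y (Complex.I • ξ)) x (Complex.I • ξ) = 0 := by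
  have h1 : (fun y => fderiv ℝ g y (Complex.I • ξ)) =ᶠ[𝓝 x] fun y => Complex.I * fderiv ℝ g y ξ := by
    filter_upwards [hg] with y hy
    rw [hol_fderiv_real hy, hol_fderiv_real hy, map_smul, smul_eq_mul]
  have hd : ∀ a : E, DifferentiableAt ℝ (fun y => fderiv ℝ g y a) x := fun a =>
    (contDiffAt_fderiv_apply hc a).differentiableAt (by simp)
  have hsym : ∀ a b : E, fderiv ℝ (fun y => fderiv ℝ g y a) x b = fderiv ℝ (fun y => fderiv ℝ g y b) x a := by
    have h : DifferentiableAt ℝ (fderiv ℝ g) x :=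
      (hc.fderiv_right (m := ∞) (by simp)).differentiableAt (by simp)
    have hs : IsSymmSndFDerivAt ℝ g x := hc.isSymmSndFDerivAt (by simp; exact WithTop.coe_le_coe.2 (le_top : (2 : ℕ∞) ≤ ⊤))
    intro a b
    rw [fderiv_clm_apply h (differentiableAt_const _), fderiv_clm_apply h (differentiableAt_const _)]
    simpa using hs b a
  have h2 : ∀ b, fderiv ℝ (fun y => fderiv ℝ g y (Complex.I • ξ)) x b = Complex.I * fderiv ℝ (fun y => fderiv ℝ g y ξ) x b := by
    intro b
    rw [h1.fderiv_eq, ((hd ξ).hasFDerivAt.const_mul Complex.I).fderiv]; simp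
  rw [h2, hsym ξ (Complex.I • ξ), h2, ← mul_assoc, Complex.I_mul_I]; ring

lemma lv_re {g : E → ℂ} {x : E} (hc : ContDiffAt ℝ ∞ g x) (hg : ∀ᶠ y in 𝓝 x, DifferentiableAt ℂ g y) (ξ : E) :
    lv (fun y => (g y).re) x ξ = 0 ∧ lv (fun y => (g y).im) x ξ = 0 := by
  have hl := hol_lap hc hg ξ
  have e1 : ∀ a : E, d2 (fun y => (g y).re) x a = (fderiv ℝ (fun y => fderiv ℝ g y a) x a).re := by
    intro a
    have : (fun y => fderiv ℝ (fun y => (g y).re) y a) =ᶠ[𝓝 x] fun y => (fderiv ℝ g y a).re := by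
      filter_upwards [cdiff_ev hc] with y hy using fderiv_re hy a
    rw [d2, this.fderiv_eq, fderiv_re ((contDiffAt_fderiv_apply hc a).differentiableAt (by simp))]
  have e2 : ∀ a : E, d2 (fun y => (g y).im) x a = (fderiv ℝ (fun y => fderiv ℝ g y a) x a).im := by
    intro a
    have : (fun y => fderiv ℝ (fun y => (g y).im) y a) =ᶠ[𝓝 x] fun y => (fderiv ℝ g y a).im := by
      filter_upwards [cdiff_ev hc] with y hy using fderiv_im hy a
    rw [d2, this.fderiv_eq, fderiv_im ((contDiffAt_fderiv_apply hc a).differentiableAt (by simp))]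
  constructor
  · rw [lv, e1, e1, ← Complex.add_re, hl]; rfl
  · rw [lv, e2, e2, ← Complex.add_im, hl]; rfl

lemma lv_normsq {g : E → ℂ} {x : E} (hc : ContDiffAt ℝ ∞ g x) (hg : ∀ᶠ y in 𝓝 x, DifferentiableAt ℂ g y) (ξ : E) :
    ContDiffAt ℝ ∞ (fun y => ‖g y‖ ^ 2) x ∧ lv (fun y => ‖g y‖ ^ 2) x ξ = 4 * ‖fderiv ℂ g x ξ‖ ^ 2 := by
  have e : (fun y => ‖g y‖ ^ 2) = fun y => (fun t : ℝ => t ^ 2) ((g y).re) + (fun t : ℝ => t ^ 2) ((g y).im) := by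
    funext y; rw [Complex.sq_norm, Complex.normSq_apply]; ring
  have hr : ContDiffAt ℝ ∞ (fun y => (g y).re) x := Complex.reCLM.contDiff.contDiffAt.comp x hc
  have hi : ContDiffAt ℝ ∞ (fun y => (g y).im) x := Complex.imCLM.contDiff.contDiffAt.comp x hc
  have hsq : ContDiff ℝ ∞ (fun t : ℝ => t ^ 2) := contDiff_id.pow 2
  have d1 : deriv (fun t : ℝ => t ^ 2) = fun t => 2 * t := by funext t; simp
  have d3 : ∀ s, deriv (deriv (fun t : ℝ => t ^ 2)) s = 2 := by intro s; rw [d1]; simp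
  have hd := hc.differentiableAt (by simp)
  refine ⟨by rw [e]; exact (hr.pow 2).add (hi.pow 2), ?_⟩
  rw [e, lv_add (hr.pow 2) (hi.pow 2), lv_comp hr hsq.contDiffAt, lv_comp hi hsq.contDiffAt, d3, d3,
    (lv_re hc hg ξ).1, (lv_re hc hg ξ).2, gr, gr, fderiv_re hd, fderiv_re hd, fderiv_im hd, fderiv_im hd,
    hol_fderiv_real hg.self_of_nhds, hol_fderiv_real hg.self_of_nhds, map_smul, Complex.sq_norm, Complex.normSq_apply]
  simp; ring

lemma Psh.normsq {g : E → ℂ} {x : E} (hc : ContDiffAt ℝ ∞ g x) (hg : ∀ᶠ y in 𝓝 x, DifferentiableAt ℂ g y) :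
    Psh (fun y => ‖g y‖ ^ 2) x :=
  ⟨(lv_normsq hc hg 0).1, fun ξ => by rw [(lv_normsq hc hg ξ).2]; positivity⟩

lemma fderiv_normsq {g : E → ℂ} {x : E} (hg : DifferentiableAt ℂ g x) (a : E) :
    HasFDerivAt (fun y => ‖g y‖ ^ 2) (2 • (innerSL ℝ (g x)).comp (fderiv ℝ g x)) x := by
  have := (hg.restrictScalars ℝ).hasFDerivAt.norm_sq
  exact this

lemma lv_sum {ι : Type*} (s : Finset ι) {u : ι → E → ℝ} {x : E} (h : ∀ i ∈ s, ContDiffAt ℝ ∞ (u i) x) (ξ : E) :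
    lv (fun y => ∑ i ∈ s, u i y) x ξ = ∑ i ∈ s, lv (u i) x ξ := by
  classical
  induction s using Finset.induction_on with
  | empty => simpa using lv_const 0 x ξ
  | insert a s ha ih =>
    simp only [Finset.sum_insert ha]
    rw [lv_add (h a (by simp)) (ContDiffAt.sum fun i hi => h i (by simp [hi])), ih fun i hi => h i (by simp [hi])]

lemma Psh.log {ι : Type*} [Fintype ι] {g : ι → E → ℂ} {x : E} (hc : ∀ i, ContDiffAt ℝ ∞ (g i) x)
    (hg : ∀ i, ∀ᶠ y in 𝓝 x, DifferentiableAt ℂ (g i) y) {ε : ℝ} (hε : 0 < ε) :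
    Psh (fun y => Real.log ((∑ i, ‖g i y‖ ^ 2) + ε)) x := by
  set N : E → ℝ := fun y => ∑ i, ‖g i y‖ ^ 2 with hN
  have hNc : ContDiffAt ℝ ∞ N x := ContDiffAt.sum fun i _ => (lv_normsq (hc i) (hg i) 0).1
  have hN0 : 0 ≤ N x := Finset.sum_nonneg fun i _ => by positivity
  have hNe : ContDiffAt ℝ ∞ (fun y => N y + ε) x := hNc.add contDiffAt_const
  have hpos : 0 < N x + ε := by positivity
  have hlog : ContDiffAt ℝ ∞ Real.log (N x + ε) := Real.contDiffAt_log.2 hpos.ne'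
  refine ⟨ContDiffAt.comp (g := Real.log) (f := fun y => N y + ε) x hlog hNe, fun ξ => ?_⟩
  change 0 ≤ lv (fun y => Real.log ((fun y => N y + ε) y)) x ξ
  rw [lv_comp hNe hlog, lv_add hNc contDiffAt_const, lv_const, add_zero]
  have e1 : lv N x ξ = 4 * ∑ i, ‖fderiv ℂ (g i) x ξ‖ ^ 2 := by
    rw [hN, lv_sum _ (fun i _ => (lv_normsq (hc i) (hg i) 0).1), Finset.mul_sum]
    exact Finset.sum_congr rfl fun i _ => (lv_normsq (hc i) (hg i) ξ).2
  have e2 : ∀ a, fderiv ℝ (fun y => N y + ε) x a = 2 * (∑ i, (starRingEnd ℂ) (g i x) * fderiv ℂ (g i) x a).re := by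
    intro a
    have h1 : HasFDerivAt (fun y => N y + ε) (∑ i, 2 • (innerSL ℝ (g i x)).comp (fderiv ℝ (g i) x)) x :=
      (HasFDerivAt.fun_sum fun i _ => fderiv_normsq (hg i).self_of_nhds a).add_const ε
    rw [h1.fderiv, Complex.re_sum, Finset.mul_sum, _root_.sum_apply]
    refine Finset.sum_congr rfl fun i _ => ?_
    simp [hol_fderiv_real (hg i).self_of_nhds, Complex.inner]
    ring
  have e3 : gr (fun y => N y + ε) x ξ = 4 * ‖∑ i, (starRingEnd ℂ) (g i x) * fderiv ℂ (g i) x ξ‖ ^ 2 := by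
    have : ∑ i, (starRingEnd ℂ) (g i x) * fderiv ℂ (g i) x (Complex.I • ξ)
        = Complex.I * ∑ i, (starRingEnd ℂ) (g i x) * fderiv ℂ (g i) x ξ := by
      rw [Finset.mul_sum]
      refine Finset.sum_congr rfl fun i _ => ?_
      rw [map_smul, smul_eq_mul]; ring
    rw [gr, e2, e2, this, Complex.sq_norm, Complex.normSq_apply]
    simp; ring
  have e4 : ‖∑ i, (starRingEnd ℂ) (g i x) * fderiv ℂ (g i) x ξ‖ ^ 2 ≤ N x * ∑ i, ‖fderiv ℂ (g i) x ξ‖ ^ 2 := by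
    have h1 : ‖∑ i, (starRingEnd ℂ) (g i x) * fderiv ℂ (g i) x ξ‖ ≤ ∑ i, ‖g i x‖ * ‖fderiv ℂ (g i) x ξ‖ := by
      refine (norm_sum_le _ _).trans (le_of_eq (Finset.sum_congr rfl fun i _ => by simp))
    exact (pow_le_pow_left₀ (norm_nonneg _) h1 2).trans (Finset.sum_mul_sq_le_sq_mul_sq _ _ _)
  have d1 : deriv Real.log = fun t => t⁻¹ := by funext t; simp
  have d3 : deriv (deriv Real.log) (N x + ε) = - ((N x + ε) ^ 2)⁻¹ := by rw [d1]; simp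
  rw [d3, e3, e1, Real.deriv_log]
  set A := ∑ i, ‖fderiv ℂ (g i) x ξ‖ ^ 2
  have hA : 0 ≤ A := Finset.sum_nonneg fun i _ => by positivity
  have : 0 ≤ 4 * ((N x + ε) ^ 2)⁻¹ * ((N x + ε) * A - ‖∑ i, (starRingEnd ℂ) (g i x) * fderiv ℂ (g i) x ξ‖ ^ 2) := by
    refine mul_nonneg (by positivity) ?_
    nlinarith
  refine this.trans (le_of_eq ?_)
  field_simp
  ring
end holo
end psh

section holE
open Filter
variable {E : Type*} [NormedAddCommGroup E] [NormedSpace ℂ E] [FiniteDimensional ℂ E]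

lemma exists_cle : ∃ M : ℕ, Nonempty (E ≃L[ℂ] CN M) :=
  ⟨Module.finrank ℂ E, ⟨ContinuousLinearEquiv.ofFinrankEq (by simp)⟩⟩

variable [NormedSpace ℝ E] [IsScalarTower ℝ ℂ E]

lemma hol_smooth {Ω : Set E} (hΩ : IsOpen Ω) {g : E → ℂ} (hg : DifferentiableOn ℂ g Ω)
    {x : E} (hx : x ∈ Ω) : ContDiffAt ℝ ∞ g x := by
  obtain ⟨M, ⟨e⟩⟩ := exists_cle (E := E)
  have h1 : DifferentiableOn ℂ (g ∘ e.symm) (e.symm ⁻¹' Ω) :=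
    hg.comp e.symm.differentiable.differentiableOn (fun y hy => hy)
  have h2 := hol_contDiffAt (hΩ.preimage e.symm.continuous) h1 (x := e x) (by simpa using hx)
  have h3 : ContDiffAt ℝ ∞ (e : E → CN M) x := (e.contDiff (𝕜 := ℂ) (n := ∞)).contDiffAt.restrict_scalars ℝ
  have h4 := h2.comp x h3
  simpa [Function.comp_def] using h4

lemma hol_ev {Ω : Set E} (hΩ : IsOpen Ω) {g : E → ℂ} (hg : DifferentiableOn ℂ g Ω)
    {x : E} (hx : x ∈ Ω) : ∀ᶠ y in 𝓝 x, DifferentiableAt ℂ g y := by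
  filter_upwards [hΩ.mem_nhds hx] with y hy using hg.differentiableAt (hΩ.mem_nhds hy)
end holE

section weights
open MeasureTheory Filter
variable {M : ℕ}

lemma levi_link {φ : CN M → ℝ} {x : CN M} (hφ : ContDiffAt ℝ ∞ φ x) (ξ : CN M) :
    (∑ j, ∑ k, dz j (dzb k (fun x => (φ x : ℂ))) x * ξ j * (starRingEnd ℂ) (ξ k)).re = lv φ x ξ / 4 := by
  have hdc : ContDiffAt ℝ ∞ (fderiv ℝ φ) x := hφ.fderiv_right (m := ∞) (by simp)
  have hdd : DifferentiableAt ℝ (fderiv ℝ φ) x := hdc.differentiableAt (by simp)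
  set B := fderiv ℝ (fderiv ℝ φ) x with hB
  have hcC : ContDiffAt ℝ ∞ (fun y => (φ y : ℂ)) x := Complex.ofRealCLM.contDiff.contDiffAt.comp x hφ
  have e1 : ∀ a b : CN M, fderiv ℝ (fderiv ℝ (fun y => (φ y : ℂ))) x a b = ((B a b : ℝ) : ℂ) := by
    intro a b
    rw [← fderiv_fderiv_apply hcC b a]
    have h1 : (fun y => fderiv ℝ (fun y => (φ y : ℂ)) y b) =ᶠ[𝓝 x] fun y => ((fderiv ℝ φ y b : ℝ) : ℂ) := by
      filter_upwards [cdiff_ev hφ] with y hy using fderiv_ofReal hy b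
    rw [h1.fderiv_eq, fderiv_ofReal ((contDiffAt_fderiv_apply hφ b).differentiableAt (by simp)),
      fderiv_clm_apply hdd (differentiableAt_const _)]
    simp [hB]
  have e2 : ∀ a, d2 φ x a = B a a := by
    intro a
    rw [d2, fderiv_clm_apply hdd (differentiableAt_const _)]
    simp [hB]
  have hw : ∀ w : CN M, w = ∑ j, ((w j).re • (Pi.single j 1 : CN M) + (w j).im • (Pi.single j Complex.I : CN M)) := by
    intro w
    funext i
    rw [Finset.sum_apply, Finset.sum_eq_single i]
    · simp [Complex.re_add_im]
    · intro b _ hb; simp [Pi.single_eq_of_ne hb.symm]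
    · simp
  have e3 : ∀ w : CN M, B w w = ∑ j, ∑ k, ((w j).re * (w k).re * B (Pi.single j 1) (Pi.single k 1)
      + (w j).re * (w k).im * B (Pi.single j 1) (Pi.single k Complex.I)
      + (w j).im * (w k).re * B (Pi.single j Complex.I) (Pi.single k 1)
      + (w j).im * (w k).im * B (Pi.single j Complex.I) (Pi.single k Complex.I)) := by
    intro w
    conv_lhs => rw [hw w]
    rw [map_sum, Finset.sum_comm]
    refine Finset.sum_congr rfl fun k _ => ?_
    rw [map_sum, _root_.sum_apply]
    refine Finset.sum_congr rfl fun j _ => ?_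
    simp only [map_add, map_smul, _root_.add_apply, _root_.smul_apply, smul_eq_mul]
    ring
  rw [lv, e2, e2, e3, e3, ← Finset.sum_add_distrib, Finset.sum_div, Complex.re_sum]
  refine Finset.sum_congr rfl fun j _ => ?_
  rw [← Finset.sum_add_distrib, Finset.sum_div, Complex.re_sum]
  refine Finset.sum_congr rfl fun k _ => ?_
  rw [dz_dzb_expand hcC, e1, e1, e1, e1]
  simp [Complex.div_re, Complex.div_im]
  ring

lemma sT_facts : ∃ C : ℝ, 0 ≤ C ∧ (∀ t, |deriv Real.smoothTransition t| ≤ C) ∧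
    (∀ t, t < 0 → deriv Real.smoothTransition t = 0) ∧ (∀ t, 1 < t → deriv Real.smoothTransition t = 0) := by
  have h0 : ∀ t, t < 0 → deriv Real.smoothTransition t = 0 := by
    intro t ht
    have : Real.smoothTransition =ᶠ[𝓝 t] fun _ => 0 := by
      filter_upwards [Iio_mem_nhds ht] with s hs using Real.smoothTransition.zero_of_nonpos (le_of_lt hs)
    rw [this.deriv_eq]; simp
  have h1 : ∀ t, 1 < t → deriv Real.smoothTransition t = 0 := by
    intro t ht
    have : Real.smoothTransition =ᶠ[𝓝 t] fun _ => 1 := by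
      filter_upwards [Ioi_mem_nhds ht] with s hs using Real.smoothTransition.one_of_one_le (le_of_lt hs)
    rw [this.deriv_eq]; simp
  have hc : Continuous (deriv Real.smoothTransition) :=
    (Real.smoothTransition.contDiff (n := 1)).continuous_deriv (by simp)
  obtain ⟨C, hC⟩ := (isCompact_Icc (a := (0:ℝ)) (b := 1)).exists_bound_of_continuousOn hc.continuousOn
  refine ⟨max C 0, le_max_right _ _, fun t => ?_, h0, h1⟩
  by_cases h2 : t < 0
  · rw [h0 t h2]; simp
  by_cases h3 : 1 < t
  · rw [h1 t h3]; simp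
  exact (hC t ⟨not_lt.1 h2, not_lt.1 h3⟩).trans (le_max_left _ _)

/-- bounded strictly pseudoconvex data -/
structure SD {E : Type*} [NormedAddCommGroup E] [NormedSpace ℝ E] [NormedSpace ℂ E]
    (Ω : Set E) (ρ : E → ℝ) (c : ℝ) : Prop where
  op : IsOpen Ω
  cp : IsCompact (closure Ω)
  sm : ∀ x ∈ closure Ω, ContDiffAt ℝ ∞ ρ x
  nn : ∀ x ∈ Ω, 0 ≤ ρ x
  lt : ∀ x ∈ Ω, ρ x < 1
  ge : ∀ x ∈ closure Ω, x ∉ Ω → 1 ≤ ρ x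
  c0 : 0 < c
  st : ∀ x ∈ Ω, ∀ ξ, c * ‖ξ‖ ^ 2 ≤ lv ρ x ξ

/-- weight psi -/
def wpsi (Ω : Set (CN M)) (ρ : CN M → ℝ) : CN M → ℝ := Ω.indicator (fun x => -2 * Real.log (1 - ρ x))

/-- weight phi -/
def wphi (Ω : Set (CN M)) (ρ : CN M → ℝ) (q : CN M) (l δ : ℝ) : CN M → ℝ :=
  Ω.indicator (fun x => l * (1 - ρ x)⁻¹ + (M + 1) * Real.log (nsq (x - q) + δ))

lemma nsq_psh (q : CN M) {δ : ℝ} (hδ : 0 < δ) (x : CN M) : Psh (fun x => Real.log (nsq (x - q) + δ)) x := by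
  have hd : ∀ i : Fin M, Differentiable ℂ (fun y : CN M => y i - q i) := fun i => by fun_prop
  have := Psh.log (ι := Fin M) (g := fun i y => y i - q i) (x := x)
    (fun i => hol_contDiffAt isOpen_univ (hd i).differentiableOn (mem_univ x))
    (fun i => Eventually.of_forall fun y => hd i y) hδ
  simpa [nsq] using this

lemma inv_psh {u : CN M → ℝ} {x : CN M} (hu : ContDiffAt ℝ ∞ u x) (h1 : u x < 1) (ξ : CN M)
    (h2 : 0 ≤ lv u x ξ) : ContDiffAt ℝ ∞ (fun y => (1 - u y)⁻¹) x ∧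
      ((1 - u x) ^ 2)⁻¹ * lv u x ξ ≤ lv (fun y => (1 - u y)⁻¹) x ξ := by
  have hp : 0 < 1 - u x := by linarith
  have hs : ContDiffAt ℝ ∞ (fun t : ℝ => (1 - t)⁻¹) (u x) :=
    (contDiffAt_const.sub contDiffAt_id).inv hp.ne'
  have d1 : deriv (fun t : ℝ => (1 - t)⁻¹) = fun t => ((1 - t) ^ 2)⁻¹ := by
    funext t
    rw [deriv_comp_const_sub (f := fun s : ℝ => s⁻¹)]; simp
  have d3 : deriv (fun t : ℝ => ((1 - t) ^ 2)⁻¹) (u x) = 2 * ((1 - u x) ^ 3)⁻¹ := by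
    have h := ((((hasDerivAt_id (u x)).const_sub 1).pow 2).inv (by simpa using hp.ne')).deriv
    simp only [id] at h
    refine Eq.trans ?_ (h.trans ?_)
    · rfl
    · simp; field_simp
  refine ⟨hs.comp x hu, ?_⟩
  rw [lv_comp (χ := fun t : ℝ => (1 - t)⁻¹) hu hs, d1, d3]
  have : 0 ≤ 2 * ((1 - u x) ^ 3)⁻¹ * gr u x ξ := mul_nonneg (by positivity) (gr_nonneg _ _ _)
  linarith

lemma SD.ev {Ω : Set (CN M)} {ρ : CN M → ℝ} {c : ℝ} (h : SD Ω ρ c) {x} (hx : x ∈ Ω) {f : CN M → ℝ} :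
    Ω.indicator f =ᶠ[𝓝 x] f := by
  filter_upwards [h.op.mem_nhds hx] with y hy using indicator_of_mem hy f

lemma SD.psi {Ω : Set (CN M)} {ρ : CN M → ℝ} {c : ℝ} (h : SD Ω ρ c) {x} (hx : x ∈ Ω) :
    ContDiffAt ℝ ∞ (wpsi Ω ρ) x ∧ Real.exp (wpsi Ω ρ x) = ((1 - ρ x) ^ 2)⁻¹ ∧
      ‖fderiv ℝ (wpsi Ω ρ) x‖ = 2 * (1 - ρ x)⁻¹ * ‖fderiv ℝ ρ x‖ := by
  have hs := h.sm x (subset_closure hx)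
  have hp : 0 < 1 - ρ x := by linarith [h.lt x hx]
  have hl : HasFDerivAt (fun x => -2 * Real.log (1 - ρ x)) ((2 * (1 - ρ x)⁻¹) • fderiv ℝ ρ x) x := by
    have h1 := (((hs.differentiableAt (by simp)).hasFDerivAt.const_sub 1).log hp.ne').const_mul (-2)
    have he : (2 * (1 - ρ x)⁻¹) • fderiv ℝ ρ x = (-2 : ℝ) • (1 - ρ x)⁻¹ • -fderiv ℝ ρ x := by
      ext w; simp [mul_assoc]
    rw [he]; exact h1
  refine ⟨?_, ?_, ?_⟩
  · exact ((contDiffAt_const (c := (-2 : ℝ))).mul ((contDiffAt_const.sub hs).log hp.ne')).congr_of_eventuallyEq (h.ev hx)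
  · rw [wpsi, indicator_of_mem hx, show -2 * Real.log (1 - ρ x) = -(2 * Real.log (1 - ρ x)) by ring, Real.exp_neg,
      show 2 * Real.log (1 - ρ x) = ((2:ℕ):ℝ) * Real.log (1 - ρ x) by norm_num, Real.exp_nat_mul, Real.exp_log hp]
  · rw [wpsi, (h.ev hx).fderiv_eq, hl.fderiv, norm_smul, Real.norm_of_nonneg (by positivity)]

lemma SD.grad {Ω : Set (CN M)} {ρ : CN M → ℝ} {c : ℝ} (h : SD Ω ρ c) :
    ∃ G, 0 ≤ G ∧ ∀ x ∈ closure Ω, ‖fderiv ℝ ρ x‖ ≤ G := by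
  have hc : ContinuousOn (fderiv ℝ ρ) (closure Ω) := fun x hx =>
    ((h.sm x hx).fderiv_right (m := ∞) (by simp)).continuousAt.continuousWithinAt
  obtain ⟨C, hC⟩ := h.cp.exists_bound_of_continuousOn hc
  exact ⟨max C 0, le_max_right _ _, fun x hx => (hC x hx).trans (le_max_left _ _)⟩

lemma SD.sub {Ω : Set (CN M)} {ρ : CN M → ℝ} {c : ℝ} (h : SD Ω ρ c) {m : ℝ} (hm : m < 1) :
    IsCompact {x | x ∈ closure Ω ∧ ρ x ≤ m} ∧ {x | x ∈ closure Ω ∧ ρ x ≤ m} ⊆ Ω := by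
  have hc : ContinuousOn ρ (closure Ω) := fun x hx => (h.sm x hx).continuousAt.continuousWithinAt
  refine ⟨h.cp.of_isClosed_subset ?_ fun x hx => hx.1, fun x hx => ?_⟩
  · exact hc.preimage_isClosed_of_isClosed isClosed_closure isClosed_Iic
  · by_contra hcon
    linarith [h.ge x hx.1 hcon, hx.2]

lemma SD.cut {Ω : Set (CN M)} {ρ : CN M → ℝ} {c : ℝ} (h : SD Ω ρ c) :
    ∃ (η : ℕ → CN M → ℝ) (C : ℝ), (∀ n, ContDiff ℝ ∞ (η n)) ∧ (∀ n, HasCompactSupport (η n)) ∧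
    (∀ n, tsupport (η n) ⊆ Ω) ∧ (∀ n x, |η n x| ≤ 1) ∧ (0 ≤ C) ∧
    (∀ n, ∀ x ∈ Ω, ‖fderiv ℝ (η n) x‖ ^ 2 ≤ C * Real.exp (wpsi Ω ρ x)) ∧
    (∀ x ∈ Ω, ∀ᶠ n in atTop, η n x = 1 ∧ fderiv ℝ (η n) x = 0) := by
  obtain ⟨C, hC0, hC, hz0, hz1⟩ := sT_facts
  obtain ⟨G, hG0, hG⟩ := h.grad
  set η : ℕ → CN M → ℝ := fun n => Ω.indicator fun x => Real.smoothTransition ((n + 1) * (1 - ρ x) - 1) with hη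
  set Kn : ℕ → Set (CN M) := fun n => {x | x ∈ closure Ω ∧ ρ x ≤ 1 - 1 / ((n : ℝ) + 1)} with hKn
  have hK : ∀ n, IsCompact (Kn n) ∧ Kn n ⊆ Ω := fun n => h.sub (by
    have : 0 < 1 / ((n : ℝ) + 1) := by positivity
    linarith)
  have hoff : ∀ n x, x ∉ Kn n → η n x = 0 := by
    intro n x hx
    by_cases hxΩ : x ∈ Ω
    · rw [hη]; simp only [indicator_of_mem hxΩ]
      refine Real.smoothTransition.zero_of_nonpos ?_
      have h1 : ¬ (ρ x ≤ 1 - 1 / ((n : ℝ) + 1)) := fun h' => hx ⟨subset_closure hxΩ, h'⟩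
      push Not at h1
      have h2 : (1 - ρ x) ≤ 1 / ((n : ℝ) + 1) := by linarith
      rw [le_div_iff₀ (by positivity)] at h2
      linarith
    · rw [hη]; simp only [indicator_of_notMem hxΩ]
  have hder : ∀ n, ∀ x ∈ Ω, HasFDerivAt (η n) (deriv Real.smoothTransition ((n + 1) * (1 - ρ x) - 1) • (((n : ℝ) + 1) • (-fderiv ℝ ρ x))) x := by
    intro n x hx
    have hs := h.sm x (subset_closure hx)
    have h1 := (((hs.differentiableAt (by simp)).hasFDerivAt.const_sub 1).const_mul ((n : ℝ) + 1)).sub_const 1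
    have h2 := ((Real.smoothTransition.contDiff (n := 1)).differentiable (by simp) ((n + 1) * (1 - ρ x) - 1)).hasDerivAt.comp_hasFDerivAt x h1
    exact h2.congr_of_eventuallyEq (h.ev hx)
  have hts : ∀ n, tsupport (η n) ⊆ Kn n := fun n =>
    closure_minimal (fun x hx => by by_contra hcon; exact hx (hoff n x hcon)) (hK n).1.isClosed
  refine ⟨η, C ^ 2 * (4 * G ^ 2), fun n => ?_, fun n => HasCompactSupport.intro (hK n).1 (hoff n), fun n => (hts n).trans (hK n).2, ?_, by positivity, ?_, ?_⟩
  · rw [contDiff_iff_contDiffAt]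
    intro x
    by_cases hx : x ∈ Kn n
    · have hxΩ := (hK n).2 hx
      refine ContDiffAt.congr_of_eventuallyEq ?_ (h.ev hxΩ)
      exact Real.smoothTransition.contDiff.contDiffAt.comp x
        ((contDiffAt_const.mul (contDiffAt_const.sub (h.sm x (subset_closure hxΩ)))).sub contDiffAt_const)
    · refine (contDiffAt_const (c := (0:ℝ))).congr_of_eventuallyEq ?_
      filter_upwards [(hK n).1.isClosed.isOpen_compl.mem_nhds hx] with y hy using hoff n y hy
  · intro n x
    by_cases hx : x ∈ Ω
    · rw [hη]; simp only [indicator_of_mem hx]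
      rw [abs_of_nonneg (Real.smoothTransition.nonneg _)]
      exact Real.smoothTransition.le_one _
    · rw [hη]; simp [indicator_of_notMem hx]
  · intro n x hx
    rw [(hder n x hx).fderiv, (h.psi hx).2.1, norm_smul, norm_smul, norm_neg]
    have hp : 0 < 1 - ρ x := by linarith [h.lt x hx]
    have hg := hG x (subset_closure hx)
    set t := ((n : ℝ) + 1) * (1 - ρ x) - 1 with ht
    by_cases h1 : 1 < t
    · rw [hz1 t h1]; simp; positivity
    push Not at h1
    have h2 : ((n : ℝ) + 1) ≤ 2 * (1 - ρ x)⁻¹ := by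
      rw [← div_eq_mul_inv, le_div_iff₀ hp]; linarith
    have h3 : ‖((n : ℝ) + 1)‖ ≤ 2 * (1 - ρ x)⁻¹ := by rwa [Real.norm_of_nonneg (by positivity)]
    have h4 : ‖deriv Real.smoothTransition t‖ * (‖((n : ℝ) + 1)‖ * ‖fderiv ℝ ρ x‖) ≤ C * ((2 * (1 - ρ x)⁻¹) * G) := by
      have := hC t
      rw [← Real.norm_eq_abs] at this
      gcongr
    refine (pow_le_pow_left₀ (by positivity) h4 2).trans (le_of_eq ?_)
    field_simp; ring
  · intro x hx
    have hp : 0 < 1 - ρ x := by linarith [h.lt x hx]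
    obtain ⟨N, hN⟩ := exists_nat_gt (2 / (1 - ρ x))
    filter_upwards [eventually_ge_atTop N] with n hn
    have h1 : 2 < (n : ℝ) * (1 - ρ x) := by
      rw [← div_lt_iff₀ hp]
      exact hN.trans_le (by exact_mod_cast hn)
    have ht : 1 < ((n : ℝ) + 1) * (1 - ρ x) - 1 := by linarith
    constructor
    · rw [hη]; simp only [indicator_of_mem hx]
      exact Real.smoothTransition.one_of_one_le ht.le
    · rw [(hder n x hx).fderiv, hz1 _ ht, zero_smul]

lemma SD.hw {Ω : Set (CN M)} {ρ : CN M → ℝ} {c : ℝ} (h : SD Ω ρ c) :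
    ∃ l0 : ℝ, 0 ≤ l0 ∧ ∀ l ≥ l0, ∀ q : CN M, ∀ δ > 0, HW Ω (wphi Ω ρ q l δ) (wpsi Ω ρ) := by
  obtain ⟨G, hG0, hG⟩ := h.grad
  have hc0 := h.c0
  refine ⟨8 * M * (4 * M * G ^ 2 + 1) / c, by positivity, fun l hl q δ hδ => ?_⟩
  have hl0 : 0 ≤ l := le_trans (by positivity) hl
  have hphi : ∀ x ∈ Ω, ContDiffAt ℝ ∞ (wphi Ω ρ q l δ) x ∧ ∀ ξ, l * (((1 - ρ x) ^ 2)⁻¹ * lv ρ x ξ) ≤ lv (wphi Ω ρ q l δ) x ξ := by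
    intro x hx
    have hs := h.sm x (subset_closure hx)
    have hlv : ∀ ξ, 0 ≤ lv ρ x ξ := fun ξ => le_trans (by positivity) (h.st x hx ξ)
    have h1 := inv_psh hs (h.lt x hx)
    have hc1 := (h1 0 (hlv 0)).1
    have h2 := (nsq_psh q hδ x).const_mul (c := (M : ℝ) + 1) (by positivity)
    refine ⟨((contDiffAt_const.mul hc1).add h2.1).congr_of_eventuallyEq (h.ev hx), fun ξ => ?_⟩
    rw [wphi, lv_congr (h.ev hx), lv_add (contDiffAt_const.mul hc1) h2.1, lv_const_mul hc1]
    have := mul_le_mul_of_nonneg_left (h1 ξ (hlv ξ)).2 hl0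
    linarith [h2.2 ξ]
  have hmeas : ∀ f : CN M → ℝ, (∀ x ∈ Ω, ContDiffAt ℝ ∞ (Ω.indicator f) x) → Measurable (Ω.indicator f) := by
    intro f hf
    classical
    have hco : ContinuousOn (Ω.indicator f) Ω := fun x hx => (hf x hx).continuousAt.continuousWithinAt
    have := hco.measurable_piecewise (g := fun _ => (0 : ℝ)) continuousOn_const h.op.measurableSet
    convert this using 1
    funext x
    by_cases hx : x ∈ Ω <;> simp [hx]
  refine ⟨h.op, hmeas _ fun x hx => (hphi x hx).1, hmeas _ fun x hx => (h.psi hx).1, fun x hx => (hphi x hx).1,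
    fun x hx => (h.psi hx).1, fun x hx ξ => ?_, h.cut⟩
  rw [levi_link (hphi x hx).1]
  have hp : 0 < 1 - ρ x := by linarith [h.lt x hx]
  obtain ⟨p1, p2, p3⟩ := h.psi hx
  have hdz : ∀ j, ‖dz j (fun x => ((wpsi Ω ρ x : ℝ) : ℂ)) x‖ ^ 2 ≤ 4 * G ^ 2 * ((1 - ρ x) ^ 2)⁻¹ := by
    intro j
    have h1 := norm_dz_le (fun x => ((wpsi Ω ρ x : ℝ) : ℂ)) j x
    have h2 : ‖fderiv ℝ (fun x => ((wpsi Ω ρ x : ℝ) : ℂ)) x‖ ≤ ‖fderiv ℝ (wpsi Ω ρ) x‖ := by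
      refine ContinuousLinearMap.opNorm_le_bound _ (norm_nonneg _) fun a => ?_
      rw [fderiv_ofReal (p1.differentiableAt (by simp)), Complex.norm_real]
      exact (fderiv ℝ (wpsi Ω ρ) x).le_opNorm a
    have h3 : ‖dz j (fun x => ((wpsi Ω ρ x : ℝ) : ℂ)) x‖ ≤ 2 * (1 - ρ x)⁻¹ * G := by
      refine (h1.trans h2).trans ?_
      rw [p3]
      have := hG x (subset_closure hx)
      gcongr
    refine (pow_le_pow_left₀ (norm_nonneg _) h3 2).trans (le_of_eq ?_)
    field_simp; ring
  have hsum : (∑ j, ‖dz j (fun x => ((wpsi Ω ρ x : ℝ) : ℂ)) x‖ ^ 2) ≤ M * (4 * G ^ 2 * ((1 - ρ x) ^ 2)⁻¹) := by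
    refine (Finset.sum_le_sum fun j _ => hdz j).trans ?_
    simp
  have hn : ∑ j, ‖ξ j‖ ^ 2 ≤ M * ‖ξ‖ ^ 2 := nsq_le_norm_sq ξ
  have hn0 : 0 ≤ ∑ j, ‖ξ j‖ ^ 2 := Finset.sum_nonneg fun j _ => by positivity
  have k1 := (hphi x hx).2 ξ
  have k2 := h.st x hx ξ
  rw [p2]
  set D := ((1 - ρ x) ^ 2)⁻¹
  have hD : 0 < D := by positivity
  have k3 : l * (D * (c * ‖ξ‖ ^ 2)) ≤ lv (wphi Ω ρ q l δ) x ξ := le_trans (by gcongr) k1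
  have k4 : 8 * M * (4 * M * G ^ 2 + 1) ≤ l * c := by rwa [ge_iff_le, div_le_iff₀ hc0] at hl
  have k5 : 8 * M * (4 * M * G ^ 2 + 1) * (D * ‖ξ‖ ^ 2) ≤ l * c * (D * ‖ξ‖ ^ 2) := by gcongr
  have k6 : 2 * ((∑ j, ‖dz j (fun x => ((wpsi Ω ρ x : ℝ) : ℂ)) x‖ ^ 2) + D) * ∑ j, ‖ξ j‖ ^ 2
      ≤ 2 * (M * (4 * G ^ 2 * D) + D) * (M * ‖ξ‖ ^ 2) := by gcongr
  refine k6.trans ?_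
  linarith
end weights

section levi
open MeasureTheory Filter
variable {M : ℕ}

lemma wt_bound {u : CN M → ℂ} {w : CN M → ℝ} {C : Set (CN M)} {c I : ℝ} (hu : AEStronglyMeasurable u)
    (hw0 : ∀ x, 0 ≤ w x) (hi : Integrable (fun x => w x * ‖u x‖ ^ 2)) (hI : ∫ x, w x * ‖u x‖ ^ 2 ≤ I)
    (hC : MeasurableSet C) (hc : 0 < c) (hcw : ∀ x ∈ C, c ≤ w x) :
    IntegrableOn (fun x => ‖u x‖ ^ 2) C ∧ ∫ x in C, ‖u x‖ ^ 2 ≤ c⁻¹ * I := by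
  have hp : ∀ x ∈ C, ‖u x‖ ^ 2 ≤ c⁻¹ * (w x * ‖u x‖ ^ 2) := by
    intro x hx
    rw [← mul_assoc]
    have : 1 ≤ c⁻¹ * w x := by
      rw [inv_mul_eq_div, one_le_div hc]; exact hcw x hx
    nlinarith [sq_nonneg ‖u x‖]
  have h1 : IntegrableOn (fun x => ‖u x‖ ^ 2) C := by
    refine Integrable.mono' (hi.const_mul c⁻¹).integrableOn (hu.norm.pow 2).restrict ?_
    refine (ae_restrict_iff' hC).2 (Eventually.of_forall fun x hx => ?_)
    rw [Real.norm_of_nonneg (by positivity)]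
    exact hp x hx
  refine ⟨h1, ?_⟩
  calc ∫ x in C, ‖u x‖ ^ 2 ≤ ∫ x in C, c⁻¹ * (w x * ‖u x‖ ^ 2) :=
        setIntegral_mono_on h1 (hi.const_mul c⁻¹).integrableOn hC hp
    _ ≤ ∫ x, c⁻¹ * (w x * ‖u x‖ ^ 2) := setIntegral_le_integral (hi.const_mul c⁻¹)
        (Eventually.of_forall fun x => mul_nonneg (by positivity) (mul_nonneg (hw0 x) (by positivity)))
    _ = c⁻¹ * ∫ x, w x * ‖u x‖ ^ 2 := integral_const_mul _ _
    _ ≤ c⁻¹ * I := by gcongr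

lemma ker0_scale {ε : ℝ} (hε : 0 < ε) : ∫ z : CN M, ker0 ε z = ε ^ (2 * M) * ∫ z : CN M, ker0 1 z := by
  have h1 : ∀ z : CN M, ker0 ε z = ker0 1 (ε⁻¹ • z) := by
    intro z
    have : (ε⁻¹ • z : CN M) = (((ε⁻¹ : ℝ) : ℂ)) • z := by ext i; simp
    rw [ker0, ker0, this, nsq_smul]
    congr 1
    rw [Complex.norm_real, Real.norm_of_nonneg (by positivity)]
    field_simp
  simp_rw [h1]
  rw [Measure.integral_comp_smul]
  have : Module.finrank ℝ (CN M) = 2 * M := by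
    show Module.finrank ℝ (Fin M → ℂ) = 2 * M
    rw [Module.finrank_pi_fintype]; simp [Complex.finrank_real_complex, mul_comm]
  rw [this, inv_pow, inv_inv, abs_of_nonneg (by positivity), smul_eq_mul]

lemma ker_sq {ε : ℝ} (hε : 0 < ε) :
    ∫ z : CN M, _root_.ker ε z ^ 2 ≤ (ε ^ (2 * M) * ∫ z : CN M, ker0 1 z)⁻¹ := by
  have hp := ker0_int_pos (M := M) hε
  have hb : ∀ z : CN M, _root_.ker ε z ^ 2 ≤ (∫ z : CN M, ker0 ε z)⁻¹ * _root_.ker ε z := by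
    intro z
    rw [sq]
    refine mul_le_mul_of_nonneg_right ?_ (ker_nonneg ε z)
    rw [_root_.ker, div_eq_mul_inv]
    exact mul_le_of_le_one_left (by positivity) (Real.smoothTransition.le_one _)
  rw [← ker0_scale hε]
  calc _ ≤ ∫ z : CN M, (∫ z : CN M, ker0 ε z)⁻¹ * _root_.ker ε z := by
        refine integral_mono_of_nonneg (Eventually.of_forall fun z => by positivity)
          ((ker_integrable hε).const_mul _) (Eventually.of_forall hb)
    _ = _ := by rw [integral_const_mul, ker_integral hε, mul_one]

lemma ker_sq_nonneg (ε : ℝ) : 0 ≤ ∫ z : CN M, _root_.ker ε z ^ 2 := integral_nonneg fun _ => by positivity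

lemma pt_bound {Ω : Set (CN M)} (hΩ : IsOpen Ω) {G X u : CN M → ℂ} {w : CN M → ℝ} {c I r : ℝ} {a : ℂ}
    (hG : DifferentiableOn ℂ G Ω) (hae : ∀ᵐ x, x ∈ Ω → X x - u x = G x) (hu : AEStronglyMeasurable u)
    (hw0 : ∀ x, 0 ≤ w x) (hi : Integrable (fun x => w x * ‖u x‖ ^ 2)) (hI : ∫ x, w x * ‖u x‖ ^ 2 ≤ I)
    {x : CN M} (hr : 0 < r) (hb : Metric.closedBall x r ⊆ Ω) (hX : ∀ y ∈ Metric.closedBall x r, X y = a)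
    (hc : 0 < c) (hcw : ∀ y ∈ Metric.closedBall x r, c ≤ w y) :
    ‖a - G x‖ ^ 2 ≤ (∫ t : CN M, _root_.ker (r / 4) t ^ 2) * (c⁻¹ * I) := by
  refine (hol_ptw hΩ (g := fun y => a - G y) ((differentiableOn_const a).sub hG) hr hb).trans ?_
  refine mul_le_mul_of_nonneg_left ?_ (ker_sq_nonneg _)
  refine le_trans (le_of_eq ?_) (wt_bound hu hw0 hi hI Metric.isClosed_closedBall.measurableSet hc hcw).2
  refine setIntegral_congr_ae Metric.isClosed_closedBall.measurableSet ?_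
  filter_upwards [hae] with y hy hyb
  rw [← hy (hb hyb), hX y hyb]
  simp

lemma exp_cont {Ω : Set (CN M)} {φ ψ : CN M → ℝ} (hw : HW Ω φ ψ) :
    ContinuousOn (fun x => Real.exp (-φ x + 2 * ψ x)) Ω := fun x hx => by
  have h1 := (hw.hφ x hx).continuousAt
  have h2 := (hw.hψ x hx).continuousAt
  exact (Real.continuous_exp.continuousAt.comp (h1.neg.add (continuousAt_const.mul h2))).continuousWithinAt

lemma exists_G {Ω : Set (CN M)} {φ ψ : CN M → ℝ} (hw : HW Ω φ ψ) {X : CN M → ℂ} (hX : Tst Ω X) :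
    ∃ u G : CN M → ℂ, AEStronglyMeasurable u ∧ DifferentiableOn ℂ G Ω ∧ (∀ᵐ x, x ∈ Ω → X x - u x = G x) ∧
      Integrable (fun x => Real.exp (-φ x + 2 * ψ x) * ‖u x‖ ^ 2) ∧
      (∫ x, Real.exp (-φ x + 2 * ψ x) * ‖u x‖ ^ 2) ≤
        (∫ x, Real.exp (-φ x + ψ x) * ∑ j, ‖dzb j X x‖ ^ 2) := by
  obtain ⟨u, h1, h2, h3, h4, h5⟩ := exists_u hw hX
  suffices hF : ∀ x ∈ Ω, ∃ r > 0, Metric.ball x r ⊆ Ω ∧ MemLp ((Metric.ball x r).indicator fun x => X x - u x) 2 by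
    obtain ⟨G, hG, hGe⟩ := weak_reg hw.hΩ (F := fun x => X x - u x) hF h5
    exact ⟨u, G, h1, hG, hGe, h3, h4⟩
  intro x hx
  obtain ⟨r, hr, hb⟩ := Metric.nhds_basis_closedBall.mem_iff.1 (hw.hΩ.mem_nhds hx)
  refine ⟨r, hr, Metric.ball_subset_closedBall.trans hb, ?_⟩
  obtain ⟨y, hy, hmin⟩ := (isCompact_closedBall x r).exists_isMinOn ⟨x, Metric.mem_closedBall_self hr.le⟩
    ((exp_cont hw).mono hb)
  have hu := (wt_bound h1 (fun x => (Real.exp_pos _).le) h3 le_rfl Metric.isOpen_ball.measurableSet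
    (Real.exp_pos _) (C := Metric.ball x r) (fun z hz => hmin (Metric.ball_subset_closedBall hz))).1
  rw [memLp_indicator_iff_restrict Metric.isOpen_ball.measurableSet]
  refine MemLp.sub (f := X) (g := u) (((hX.sm.continuous).memLp_of_hasCompactSupport hX.cs).restrict _) ?_
  rw [memLp_two_iff_integrable_sq_norm h1.restrict]
  exact hu

/-- separation by peak-like functions -/
lemma SD.sep {Ω : Set (CN M)} {ρ : CN M → ℝ} {c : ℝ} (h : SD Ω ρ c) {K : Set (CN M)} (hK : IsCompact K)
    (hKΩ : K ⊆ Ω) {m : ℝ} (hm0 : 0 ≤ m) (hm : ∀ x ∈ K, ρ x ≤ m) {q : CN M} (hq : q ∈ Ω) (hmq : m < ρ q) :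
    ∃ G : CN M → ℂ, DifferentiableOn ℂ G Ω ∧ (∀ x ∈ K, ‖G x‖ ≤ 1 / 4) ∧ 1 / 2 ≤ ‖G q‖ := by
  have hρc : ContinuousOn ρ Ω := fun x hx => (h.sm x (subset_closure hx)).continuousAt.continuousWithinAt
  have hq1 := h.lt q hq
  set m1 := (2 * m + ρ q) / 3 with hm1
  set m2 := (m + 2 * ρ q) / 3 with hm2
  have hm12 : m1 < m2 := by rw [hm1, hm2]; linarith
  have hm2q : m2 < ρ q := by rw [hm2]; linarith
  have hmm1 : m < m1 := by rw [hm1]; linarith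
  -- cutoff
  obtain ⟨χ, c1, c2, c3, c4, U, hU, hqU, hUΩ, hU1⟩ := exists_cutoff (K := {q}) isCompact_singleton
    (hρc.isOpen_inter_preimage h.op isOpen_Ioi (t := Ioi m2)) (by simpa using ⟨hq, hm2q⟩)
  set X : CN M → ℂ := fun x => (χ x : ℂ) with hXd
  have htX : tsupport X ⊆ tsupport χ := tsupport_comp_subset (g := (fun r : ℝ => (r : ℂ))) (by simp) χ
  have hX : Tst Ω X := ⟨Complex.ofRealCLM.contDiff.comp c1, c2.comp_left (g := (fun r : ℝ => (r : ℂ))) (by simp),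
    fun x hx => (c3 (htX hx)).1⟩
  obtain ⟨r0, hr0, hb0⟩ := Metric.nhds_basis_closedBall.mem_iff.1 (hU.mem_nhds (hqU rfl))
  have hb0Ω : Metric.closedBall q r0 ⊆ Ω := fun x hx => (hUΩ (hb0 hx)).1
  -- neighbourhood of K
  obtain ⟨r, hr, hrK⟩ := hK.exists_cthickening_subset_open
    (hρc.isOpen_inter_preimage h.op isOpen_Iio (t := Iio m1)) (fun x hx => ⟨hKΩ hx, (hm x hx).trans_lt hmm1⟩)
  have hrK' : ∀ x ∈ K, ∀ y ∈ Metric.closedBall x r, y ∈ Ω ∧ ρ y < m1 := fun x hx y hy =>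
    hrK (Metric.closedBall_subset_cthickening hx r hy)
  -- constants
  obtain ⟨D, hD⟩ := h.cp.exists_bound_of_continuousOn (f := fun x => nsq (x - q))
    (nsq_contDiff.continuous.comp (continuous_id.sub continuous_const)).continuousOn
  have hD' : ∀ x ∈ Ω, nsq (x - q) ≤ D := fun x hx => (le_abs_self _).trans (hD x (subset_closure hx))
  have hD0 : 0 ≤ D := (nsq_nonneg _).trans (hD' q hq)
  have hψc : ContinuousOn (wpsi Ω ρ) Ω := fun x hx => (h.psi hx).1.continuousAt.continuousWithinAt
  have hψ0 : ∀ x ∈ Ω, 0 ≤ wpsi Ω ρ x := by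
    intro x hx
    rw [wpsi, indicator_of_mem hx]
    have : Real.log (1 - ρ x) ≤ 0 := Real.log_nonpos (by linarith [h.lt x hx]) (by linarith [h.nn x hx])
    linarith
  obtain ⟨E, hE⟩ := c2.isCompact.exists_bound_of_continuousOn (hψc.mono fun x hx => (c3 hx).1)
  obtain ⟨l0, hl0, hHW⟩ := h.hw
  set A : ℝ := Real.exp (-(M + 1) * Real.log (r0 ^ 2) + E) * ∫ x, ∑ j, ‖dzb j X x‖ ^ 2 with hA
  have hIntg : Integrable (fun x => ∑ j, ‖dzb j X x‖ ^ 2) := by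
    refine integrable_finsetSum _ fun j _ => ?_
    have := (hX.dzb j).sm.continuous.memLp_of_hasCompactSupport (hX.dzb j).cs (μ := volume) (p := 2)
    exact (memLp_two_iff_integrable_sq_norm this.1).1 this
  have hA0 : 0 ≤ A := mul_nonneg (Real.exp_pos _).le (integral_nonneg fun x => by positivity)
  set s1 := (1 - m1)⁻¹ with hs1
  set s2 := (1 - m2)⁻¹ with hs2
  have hs12 : s1 < s2 := by
    rw [hs1, hs2]; exact inv_strictAnti₀ (by linarith) (by linarith)
  have hRHS : ∀ l ≥ 0, ∀ δ > 0, (∫ x, Real.exp (-wphi Ω ρ q l δ x + wpsi Ω ρ x) * ∑ j, ‖dzb j X x‖ ^ 2)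
      ≤ Real.exp (-l * s2) * A := by
    intro l hl δ hδ
    rw [hA, ← mul_assoc, ← Real.exp_add, ← integral_const_mul]
    refine integral_mono_of_nonneg (Eventually.of_forall fun x => ?_) (hIntg.const_mul _)
      (Eventually.of_forall fun x => ?_)
    · have := Real.exp_pos (-wphi Ω ρ q l δ x + wpsi Ω ρ x)
      simp only [Pi.zero_apply]
      positivity
    · simp only
      by_cases hx : x ∈ tsupport χ
      · by_cases hxb : x ∈ Metric.ball q r0
        · have : ∀ j, dzb j X x = 0 := by
            intro j
            have he : X =ᶠ[𝓝 x] fun _ => 1 := by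
              filter_upwards [Metric.isOpen_ball.mem_nhds hxb] with y hy
              simp [hXd, hU1 y (hb0 (Metric.ball_subset_closedBall hy))]
            simp [dzb, he.fderiv_eq]
          simp [this]
        · refine mul_le_mul_of_nonneg_right (Real.exp_le_exp.2 ?_) (by positivity)
          have hxΩ := (c3 hx).1
          have hxm : m2 < ρ x := (c3 hx).2
          have e1 : r0 ^ 2 ≤ nsq (x - q) + δ := by
            have := norm_sq_le_nsq (x - q)
            have h2 : r0 ≤ ‖x - q‖ := by simpa [dist_eq_norm] using hxb
            have h3 : r0 ^ 2 ≤ ‖x - q‖ ^ 2 := by gcongr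
            linarith
          have e2 := Real.log_le_log (by positivity) e1
          have e3 : s2 ≤ (1 - ρ x)⁻¹ := inv_anti₀ (by linarith [h.lt x hxΩ]) (by linarith)
          have e4 := mul_le_mul_of_nonneg_left e3 hl
          have e5 := (le_abs_self _).trans (hE x hx)
          have e6 : ((M : ℝ) + 1) * Real.log (r0 ^ 2) ≤ (M + 1) * Real.log (nsq (x - q) + δ) := by gcongr
          rw [wphi, indicator_of_mem hxΩ]
          linarith
      · have : ∀ j, dzb j X x = 0 := fun j =>
          image_eq_zero_of_notMem_tsupport fun hh => hx (htX (tsupport_dzb_subset X j hh))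
        simp [this]
  -- choose l
  obtain ⟨l, hll0, hl⟩ : ∃ l ≥ l0, (∫ t : CN M, _root_.ker (r / 4) t ^ 2) *
      ((Real.exp (-l * s1 - (M + 1) * Real.log (D + 1)))⁻¹ * (Real.exp (-l * s2) * A)) ≤ (1 / 4) ^ 2 := by
    have ht : Tendsto (fun l : ℝ => ((∫ t : CN M, _root_.ker (r / 4) t ^ 2) *
        (Real.exp ((M + 1) * Real.log (D + 1)) * A)) * Real.exp (-(l * (s2 - s1)))) atTop (𝓝 0) := by
      have := (Real.tendsto_exp_neg_atTop_nhds_zero.comp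
        (tendsto_id.atTop_mul_const (sub_pos.2 hs12))).const_mul ((∫ t : CN M, _root_.ker (r / 4) t ^ 2) *
        (Real.exp ((M + 1) * Real.log (D + 1)) * A))
      simpa using this
    obtain ⟨l, h1, h2⟩ := ((ht.eventually (Iic_mem_nhds (show (0:ℝ) < (1 / 4) ^ 2 by norm_num))).and
      (eventually_ge_atTop l0)).exists
    refine ⟨l, h2, le_trans (le_of_eq ?_) h1⟩
    rw [← Real.exp_neg, show -(-l * s1 - (M + 1) * Real.log (D + 1)) = l * s1 + (M + 1) * Real.log (D + 1) by ring,
      show -(l * (s2 - s1)) = l * s1 + -l * s2 by ring, Real.exp_add, Real.exp_add]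
    ring
  have hl0' : 0 ≤ l := hl0.trans hll0
  -- constant near q
  obtain ⟨E3, hE3⟩ := (isCompact_closedBall q r0).exists_bound_of_continuousOn (f := fun x => l * (1 - ρ x)⁻¹)
    (fun x hx => (continuousAt_const.mul ((continuousAt_const.sub (h.sm x
      (subset_closure (hb0Ω hx))).continuousAt).inv₀ (sub_pos.2 (h.lt x (hb0Ω hx))).ne')).continuousWithinAt)
  have hk1 := ker0_int_pos (M := M) one_pos
  set k1 := ∫ z : CN M, ker0 1 z with hk1d
  -- choose t
  obtain ⟨t, ht0, htr, ht1, ht⟩ : ∃ t : ℝ, 0 < t ∧ t ≤ r0 ∧ t ≤ 1 ∧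
      ((4 ^ (2 * M) * k1⁻¹ * Real.exp E3 * (M + 1) ^ (M + 1) * (Real.exp (-l * s2) * A))) * t ^ 2 ≤ (1 / 2) ^ 2 := by
    have ht : Tendsto (fun t : ℝ => ((4 ^ (2 * M) * k1⁻¹ * Real.exp E3 * (M + 1) ^ (M + 1) *
        (Real.exp (-l * s2) * A))) * t ^ 2) (𝓝[>] 0) (𝓝 0) := by
      refine Tendsto.mono_left ?_ nhdsWithin_le_nhds
      have : Continuous (fun t : ℝ => ((4 ^ (2 * M) * k1⁻¹ * Real.exp E3 * (M + 1) ^ (M + 1) *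
        (Real.exp (-l * s2) * A))) * t ^ 2) := by fun_prop
      simpa using this.tendsto 0
    obtain ⟨t, ⟨h1, h2⟩, h3⟩ := ((ht.eventually (Iic_mem_nhds (show (0:ℝ) < (1 / 2) ^ 2 by norm_num))).and
      (Ioc_mem_nhdsGT (show (0:ℝ) < min r0 1 by positivity))).and self_mem_nhdsWithin |>.exists
    exact ⟨t, h2.1, h2.2.trans (min_le_left _ _), h2.2.trans (min_le_right _ _), h1⟩
  have hδ : 0 < t ^ 2 := by positivity
  have hδ1 : t ^ 2 ≤ 1 := by nlinarith
  have hw := hHW l hll0 q (t ^ 2) hδ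
  obtain ⟨u, G, g1, g2, g3, g4, g5⟩ := exists_G hw hX
  have hI := g5.trans (hRHS l hl0' _ hδ)
  refine ⟨G, g2, fun x hx => ?_, ?_⟩
  · have hxb := hrK' x hx
    have := pt_bound h.op (a := 0) (x := x) g2 g3 g1 (fun x => (Real.exp_pos _).le) g4 hI hr (fun y hy => (hxb y hy).1)
      (fun y hy => ?_) (Real.exp_pos (-l * s1 - (M + 1) * Real.log (D + 1))) (fun y hy => ?_)
    · have h2 := this.trans hl
      rw [zero_sub, norm_neg] at h2
      exact le_of_sq_le_sq h2 (by norm_num)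
    · have : χ y = 0 := image_eq_zero_of_notMem_tsupport fun hh => by
        have h1 : m2 < ρ y := (c3 hh).2
        linarith [(hxb y hy).2]
      simp [hXd, this]
    · refine Real.exp_le_exp.2 ?_
      obtain ⟨hyΩ, hym⟩ := hxb y hy
      have e1 : nsq (y - q) + t ^ 2 ≤ D + 1 := by linarith [hD' y hyΩ]
      have e2 := Real.log_le_log (by have := nsq_nonneg (y - q); positivity) e1
      have e3 : (1 - ρ y)⁻¹ ≤ s1 := inv_anti₀ (by linarith) (by linarith)
      have e4 := mul_le_mul_of_nonneg_left e3 hl0'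
      have e6 : ((M : ℝ) + 1) * Real.log (nsq (y - q) + t ^ 2) ≤ (M + 1) * Real.log (D + 1) := by gcongr
      have := hψ0 y hyΩ
      rw [wphi, indicator_of_mem hyΩ]
      linarith
  · have htb : Metric.closedBall q t ⊆ Metric.closedBall q r0 := Metric.closedBall_subset_closedBall htr
    have := pt_bound h.op (a := 1) (x := q) g2 g3 g1 (fun x => (Real.exp_pos _).le) g4 hI ht0 (htb.trans hb0Ω)
      (fun y hy => ?_) (Real.exp_pos (-E3 - (M + 1) * Real.log ((M + 1) * t ^ 2))) (fun y hy => ?_)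
    · have h2 : ‖1 - G q‖ ^ 2 ≤ (1 / 2) ^ 2 := by
        refine this.trans (le_trans ?_ ht)
        refine (mul_le_mul_of_nonneg_right (ker_sq (by positivity)) (by positivity)).trans (le_of_eq ?_)
        have e1 : (Real.exp (-E3 - (M + 1) * Real.log ((M + 1) * t ^ 2)))⁻¹ =
            Real.exp E3 * ((M + 1) * t ^ 2) ^ (M + 1) := by
          rw [← Real.exp_neg, show -(-E3 - (M + 1) * Real.log ((M + 1) * t ^ 2)) =
            E3 + ((M + 1 : ℕ) : ℝ) * Real.log ((M + 1) * t ^ 2) by push_cast; ring, Real.exp_add, Real.exp_nat_mul,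
            Real.exp_log (by positivity)]
        rw [e1, ← hk1d, div_pow, mul_pow, ← pow_mul]
        field_simp
        ring
      have h3 : ‖1 - G q‖ ≤ 1 / 2 := le_of_sq_le_sq h2 (by norm_num)
      have h4 := norm_sub_norm_le (1 : ℂ) (G q)
      rw [norm_one] at h4
      linarith
    · simp [hXd, hU1 y (hb0 (htb hy))]
    · refine Real.exp_le_exp.2 ?_
      have hyΩ := hb0Ω (htb hy)
      have e1 : nsq (y - q) + t ^ 2 ≤ (M + 1) * t ^ 2 := by
        have h1 := nsq_le_norm_sq (y - q)
        have h2 : ‖y - q‖ ≤ t := by simpa [dist_eq_norm] using hy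
        have h3 : (M : ℝ) * ‖y - q‖ ^ 2 ≤ M * t ^ 2 := by gcongr
        linarith
      have e2 := Real.log_le_log (by have := nsq_nonneg (y - q); positivity) e1
      have e3 := (le_abs_self _).trans (hE3 y (htb hy))
      have e6 : ((M : ℝ) + 1) * Real.log (nsq (y - q) + t ^ 2) ≤ (M + 1) * Real.log ((M + 1) * t ^ 2) := by gcongr
      have := hψ0 y hyΩ
      rw [wphi, indicator_of_mem hyΩ]
      linarith

end levi

section stein
open MeasureTheory Filter

lemma le_hull_iff {E : Type*} [NormedAddCommGroup E] [NormedSpace ℂ E] {Ω K : Set E} (hK : IsCompact K)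
    (hKΩ : K ⊆ Ω) {g : E → ℂ} (hg : DifferentiableOn ℂ g Ω) {b : ℝ} (hb0 : 0 ≤ b) (hb : ∀ w ∈ K, ‖g w‖ ≤ b) :
    ⨆ w ∈ K, ‖g w‖ ≤ b :=
  Real.iSup_le (fun w => Real.iSup_le (fun hw => hb w hw) hb0) hb0

lemma le_sup_hull {E : Type*} [NormedAddCommGroup E] {K : Set E} (hK : IsCompact K)
    {g : E → ℂ} (hg : ContinuousOn g K) {w : E} (hw : w ∈ K) : ‖g w‖ ≤ ⨆ w ∈ K, ‖g w‖ := by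
  obtain ⟨C, hC⟩ := hK.exists_bound_of_continuousOn hg
  have hC0 : 0 ≤ C := (norm_nonneg _).trans (hC w hw)
  have hb : BddAbove (range fun w => ⨆ (_ : w ∈ K), ‖g w‖) :=
    ⟨C, by rintro _ ⟨y, rfl⟩; exact Real.iSup_le (fun hy => hC y hy) hC0⟩
  refine le_trans ?_ (le_ciSup hb w)
  simp [hw]

lemma SD.stein {M : ℕ} {Ω : Set (CN M)} {ρ : CN M → ℝ} {c : ℝ} (h : SD Ω ρ c) : IsSteinOpen Ω := by
  refine ⟨h.op, fun K hKΩ hK => ?_⟩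
  have hρc : ContinuousOn ρ Ω := fun x hx => (h.sm x (subset_closure hx)).continuousAt.continuousWithinAt
  obtain ⟨m, hm0, hm1, hm⟩ : ∃ m : ℝ, 0 ≤ m ∧ m < 1 ∧ ∀ x ∈ K, ρ x ≤ m := by
    rcases K.eq_empty_or_nonempty with rfl | hne
    · exact ⟨0, le_rfl, one_pos, by simp⟩
    · obtain ⟨x, hx, hmax⟩ := hK.exists_isMaxOn hne (hρc.mono hKΩ)
      exact ⟨ρ x, h.nn x (hKΩ hx), h.lt x (hKΩ hx), fun y hy => hmax hy⟩
  obtain ⟨hL, hLΩ⟩ := h.sub hm1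
  set L := {x | x ∈ closure Ω ∧ ρ x ≤ m} with hLd
  have hsub : hullO Ω K ⊆ L := by
    intro q hq
    refine ⟨subset_closure hq.1, ?_⟩
    by_contra hcon
    obtain ⟨G, g1, g2, g3⟩ := h.sep hK hKΩ hm0 hm hq.1 (not_le.1 hcon)
    have := (hq.2 G g1).trans (le_hull_iff hK hKΩ g1 (by norm_num) g2)
    linarith
  have : hullO Ω K = L ∩ ⋂ (f : CN M → ℂ) (_ : DifferentiableOn ℂ f Ω), {z ∈ L | ‖f z‖ ≤ ⨆ w ∈ K, ‖f w‖} := by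
    ext z
    constructor
    · intro hz
      refine ⟨hsub hz, mem_iInter₂.2 fun f hf => ⟨hsub hz, hz.2 f hf⟩⟩
    · rintro ⟨hz, hz2⟩
      exact ⟨hLΩ hz, fun f hf => (mem_iInter₂.1 hz2 f hf).2⟩
  rw [this]
  refine hL.inter_right (isClosed_iInter fun f => isClosed_iInter fun hf => ?_)
  exact (hf.continuousOn.mono hLΩ).norm.preimage_isClosed_of_isClosed hL.isClosed isClosed_Iic

lemma stein_crit0 {M : ℕ} {C A : Set (CN M)} {ρ : CN M → ℝ} (hC : IsCompact C) (hA : IsCompact A)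
    (hAC : A ⊆ interior C) (hp : ∀ x ∈ C, Psh ρ x) (h0 : ∀ x ∈ C, 0 ≤ ρ x) (h1 : ∀ x ∈ A, ρ x < 1)
    (h2 : ∀ x ∈ frontier C, 1 ≤ ρ x) : ∃ Ω : Set (CN M), IsSteinOpen Ω ∧ A ⊆ Ω ∧ Ω ⊆ C := by
  have hρc : ContinuousOn ρ C := fun x hx => (hp x hx).1.continuousAt.continuousWithinAt
  obtain ⟨D, hD⟩ := hC.exists_bound_of_continuousOn (f := nsq) nsq_contDiff.continuous.continuousOn
  obtain ⟨η, hη, hηA⟩ : ∃ η > 0, ∀ x ∈ A, ρ x ≤ 1 - η := by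
    rcases A.eq_empty_or_nonempty with rfl | hne
    · exact ⟨1, one_pos, by simp⟩
    · obtain ⟨x, hx, hmax⟩ := hA.exists_isMaxOn hne (hρc.mono (hAC.trans interior_subset))
      exact ⟨1 - ρ x, by linarith [h1 x hx], fun y hy => by have : ρ y ≤ ρ x := hmax hy
                                                            linarith⟩
  set ε := η / (2 * (|D| + 1)) with hε
  have hε0 : 0 < ε := by positivity
  have hεD : ε * (|D| + 1) = η / 2 := by rw [hε]; field_simp
  set σ : CN M → ℝ := fun x => ρ x + ε * nsq x with hσ
  have hns : ∀ x ξ : CN M, ContDiffAt ℝ ∞ nsq x ∧ lv nsq x ξ = 4 * nsq ξ := by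
    intro x ξ
    have hd : ∀ i : Fin M, Differentiable ℂ (fun y : CN M => y i) := fun i => by fun_prop
    have hci : ∀ i : Fin M, ContDiffAt ℝ ∞ (fun y : CN M => y i) x := fun i => (contDiff_apply ℝ ℂ i).contDiffAt
    have hl := fun i => lv_normsq (hci i) (Eventually.of_forall fun y => hd i y) ξ
    refine ⟨nsq_contDiff.contDiffAt, ?_⟩
    have := lv_sum Finset.univ (fun i _ => (hl i).1) ξ
    refine this.trans ?_
    rw [nsq, Finset.mul_sum]
    refine Finset.sum_congr rfl fun i _ => ?_
    rw [(hl i).2]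
    congr 3
    have := (ContinuousLinearMap.proj (R := ℂ) (φ := fun _ : Fin M => ℂ) i).hasFDerivAt (x := x)
    exact congrArg (fun L => L ξ) this.fderiv
  have hσp : ∀ x ∈ C, ContDiffAt ℝ ∞ σ x ∧ ∀ ξ, lv σ x ξ = lv ρ x ξ + ε * (4 * nsq ξ) := by
    intro x hx
    refine ⟨(hp x hx).1.add (contDiffAt_const.mul (hns x 0).1), fun ξ => ?_⟩
    rw [hσ, lv_add (hp x hx).1 (contDiffAt_const.mul (hns x 0).1), lv_const_mul (hns x 0).1, (hns x ξ).2]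
  have hσc : ContinuousOn σ (interior C) := fun x hx => (hσp x (interior_subset hx)).1.continuousAt.continuousWithinAt
  set Ω := interior C ∩ σ ⁻¹' (Iio 1) with hΩ
  have hΩo : IsOpen Ω := hσc.isOpen_inter_preimage isOpen_interior isOpen_Iio
  have hΩC : Ω ⊆ C := fun x hx => interior_subset hx.1
  have hcl : closure Ω ⊆ C := closure_minimal hΩC hC.isClosed
  refine ⟨Ω, ?_, fun x hx => ⟨hAC hx, ?_⟩, hΩC⟩
  · refine SD.stein (ρ := σ) (c := 4 * ε) ⟨hΩo, hC.of_isClosed_subset isClosed_closure hcl, fun x hx => (hσp x (hcl hx)).1,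
      fun x hx => ?_, fun x hx => hx.2, fun x hx hx2 => ?_, by positivity, fun x hx ξ => ?_⟩
    · have := h0 x (hΩC hx)
      have := nsq_nonneg x
      positivity
    · by_cases hi : x ∈ interior C
      · exact not_lt.1 fun hlt => hx2 ⟨hi, hlt⟩
      · have := h2 x ⟨subset_closure (hcl hx), hi⟩
        have := mul_nonneg hε0.le (nsq_nonneg x)
        simp only [hσ]; linarith
    · rw [(hσp x (hΩC hx)).2]
      have := (hp x (hΩC hx)).2 ξ
      have := mul_le_mul_of_nonneg_left (norm_sq_le_nsq ξ) hε0.le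
      linarith
  · have e1 := hηA x hx
    have e2 := (le_abs_self _).trans (hD x (interior_subset (hAC hx)))
    have e3 : ε * nsq x ≤ ε * (|D| + 1) := by
      have := le_abs_self D
      gcongr; linarith
    show ρ x + ε * nsq x < 1
    linarith

variable {E : Type*} [NormedAddCommGroup E] [NormedSpace ℂ E]

lemma stein_pull {M : ℕ} (e : E ≃L[ℂ] CN M) {Ω : Set (CN M)} (h : IsSteinOpen Ω) : IsSteinOpen (e ⁻¹' Ω) := by
  refine ⟨h.1.preimage e.continuous, fun K hK hKc => ?_⟩
  have h1 := h.2 (e '' K) (by simpa using hK) (hKc.image e.continuous)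
  have : hullO (e ⁻¹' Ω) K = e.toHomeomorph ⁻¹' (hullO Ω (e '' K)) := by
    ext z
    refine and_congr Iff.rfl ⟨fun H f hf => ?_, fun H f hf => ?_⟩
    · have := H (f ∘ e) (hf.comp e.differentiable.differentiableOn fun y hy => hy)
      refine this.trans (le_hull_iff hKc hK (hf.comp e.differentiable.differentiableOn fun y hy => hy) ?_ ?_)
      · exact Real.iSup_nonneg fun w => Real.iSup_nonneg fun _ => norm_nonneg _
      · intro w hw
        exact le_sup_hull (g := f) (hKc.image e.continuous) (hf.continuousOn.mono (by simpa using hK))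
          (mem_image_of_mem e hw)
    · have hf' : DifferentiableOn ℂ (f ∘ e.symm) Ω :=
        hf.comp e.symm.differentiable.differentiableOn fun y hy => by simpa using hy
      have := H (f ∘ e.symm) hf'
      simp only [ContinuousLinearEquiv.coe_toHomeomorph, Function.comp, ContinuousLinearEquiv.symm_apply_apply] at this
      refine this.trans (le_hull_iff (hKc.image e.continuous) (Ω := Ω) (by simpa using hK) hf' ?_ ?_)
      · exact Real.iSup_nonneg fun w => Real.iSup_nonneg fun _ => norm_nonneg _
      · rintro _ ⟨w, hw, rfl⟩
        simpa using le_sup_hull (g := f) hKc (hf.continuousOn.mono hK) hw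
  rw [this]
  exact e.toHomeomorph.isClosedEmbedding.isCompact_preimage h1

variable [NormedSpace ℝ E] [IsScalarTower ℝ ℂ E]

lemma psh_pull {M : ℕ} (e : E ≃L[ℂ] CN M) {u : E → ℝ} {x : CN M} (h : Psh u (e.symm x)) :
    Psh (u ∘ e.symm) x := by
  set e' : CN M ≃L[ℝ] E := { e.symm.toLinearEquiv.restrictScalars ℝ with
    continuous_toFun := e.symm.continuous
    continuous_invFun := e.continuous } with he'
  refine ⟨h.1.comp x e'.contDiff.contDiffAt, fun ξ => ?_⟩
  have hd : ∀ a, d2 (u ∘ e.symm) x a = d2 u (e.symm x) (e.symm a) := by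
    intro a
    have h1 : ∀ y, fderiv ℝ (u ∘ e.symm) y a = fderiv ℝ u (e.symm y) (e.symm a) := by
      intro y
      have := e'.comp_right_fderiv (f := u) (x := y)
      exact congrArg (fun L => L a) this
    unfold d2
    simp_rw [h1]
    have := e'.comp_right_fderiv (f := fun z => fderiv ℝ u z (e.symm a)) (x := x)
    exact congrArg (fun L => L a) this
  rw [lv, hd, hd, map_smul]
  exact h.2 _

theorem stein_crit [FiniteDimensional ℂ E] {C A : Set E} {ρ : E → ℝ} (hC : IsCompact C) (hA : IsCompact A)
    (hAC : A ⊆ interior C) (hp : ∀ x ∈ C, Psh ρ x) (h0 : ∀ x ∈ C, 0 ≤ ρ x) (h1 : ∀ x ∈ A, ρ x < 1)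
    (h2 : ∀ x ∈ frontier C, 1 ≤ ρ x) : ∃ Ω : Set E, IsSteinOpen Ω ∧ A ⊆ Ω ∧ Ω ⊆ C := by
  obtain ⟨M, ⟨e⟩⟩ := exists_cle (E := E)
  have i1 : ∀ B : Set E, e '' B = e.symm ⁻¹' B := fun B => e.toEquiv.image_eq_preimage_symm B
  have hmem : ∀ {B : Set E} {y}, y ∈ e '' B → e.symm y ∈ B := by
    intro B y hy; rw [i1] at hy; exact hy
  obtain ⟨Ω, o1, o2, o3⟩ := stein_crit0 (C := e '' C) (A := e '' A) (ρ := ρ ∘ e.symm) (hC.image e.continuous)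
    (hA.image e.continuous) (by
      have := e.toHomeomorph.image_interior C
      rw [ContinuousLinearEquiv.coe_toHomeomorph] at this
      rw [← this]; exact image_mono hAC)
    (fun x hx => psh_pull e (hp _ (hmem hx))) (fun x hx => h0 _ (hmem hx)) (fun x hx => h1 _ (hmem hx))
    (fun x hx => h2 _ (hmem (by
      have := e.toHomeomorph.image_frontier C
      rw [ContinuousLinearEquiv.coe_toHomeomorph] at this
      rw [this]; exact hx)))
  refine ⟨e ⁻¹' Ω, stein_pull e o1, fun x hx => o2 (mem_image_of_mem e hx), fun x hx => ?_⟩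
  have := o3 hx
  simpa using this
end stein

section sos
open Filter

lemma sT_symm (x : ℝ) : Real.smoothTransition x + Real.smoothTransition (1 - x) = 1 := by
  unfold Real.smoothTransition
  have h := Real.smoothTransition.pos_denom x
  rw [sub_sub_cancel, add_comm (expNegInvGlue (1 - x)), ← add_div, div_self h.ne']

lemma exists_chi : ∃ χ : ℝ → ℝ, ContDiff ℝ ∞ χ ∧ (∀ t, 0 ≤ deriv χ t) ∧ (∀ t, deriv χ t ≤ 1) ∧
    (∀ t, 0 ≤ deriv (deriv χ) t) ∧ (∀ t, t ≤ -1 → χ t = 0) ∧ (∀ t, 1 ≤ t → χ t = t) ∧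
    (∀ t, 0 ≤ χ t) ∧ ∀ t, t ≤ χ t := by
  set g : ℝ → ℝ := fun t => Real.smoothTransition ((t + 1) / 2) with hg
  have hgs : ContDiff ℝ ∞ g := Real.smoothTransition.contDiff.comp ((contDiff_id.add contDiff_const).div_const _)
  have hgc := hgs.continuous
  set χ : ℝ → ℝ := fun t => ∫ s in (-1 : ℝ)..t, g s with hχ
  have hd : ∀ t, HasDerivAt χ (g t) t := fun t =>
    intervalIntegral.integral_hasDerivAt_right (hgc.intervalIntegrable _ _)
      (hgc.stronglyMeasurableAtFilter _ _) hgc.continuousAt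
  have hdd : deriv χ = g := funext fun t => (hd t).deriv
  have hmono : Monotone g := by
    intro a b hab
    exact Real.smoothTransition.monotone (by linarith)
  have hsm : ContDiff ℝ ∞ χ := by
    rw [contDiff_infty_iff_deriv]
    exact ⟨fun t => (hd t).differentiableAt, by rw [hdd]; exact hgs⟩
  have h0 : ∀ t, t ≤ -1 → χ t = 0 := by
    intro t ht
    simp only [hχ]
    rw [intervalIntegral.integral_congr (g := fun _ => 0)]
    · simp
    · intro s hs
      rw [uIcc_of_ge ht] at hs
      exact Real.smoothTransition.zero_of_nonpos (by linarith [hs.2])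
  have hsym : ∀ s, g s + g (-s) = 1 := by
    intro s
    have := sT_symm ((s + 1) / 2)
    simp only [hg]
    rw [show (-s + 1) / 2 = 1 - (s + 1) / 2 by ring]
    exact this
  have h1' : χ 1 = 1 := by
    have e1 : ∫ s in (-1 : ℝ)..1, g (-s) = ∫ s in (-1 : ℝ)..1, g s := by
      rw [intervalIntegral.integral_comp_neg]; simp
    have e2 : ∫ s in (-1 : ℝ)..1, (g s + g (-s)) = 2 := by
      simp_rw [hsym]; norm_num
    rw [intervalIntegral.integral_add (hgc.intervalIntegrable _ _)
      ((show Continuous fun s => g (-s) from hgc.comp continuous_neg).intervalIntegrable _ _), e1] at e2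
    simp only [hχ]; linarith
  have h1 : ∀ t, 1 ≤ t → χ t = t := by
    intro t ht
    have e1 : χ 1 + ∫ s in (1 : ℝ)..t, g s = χ t := intervalIntegral.integral_add_adjacent_intervals
      (hgc.intervalIntegrable _ _) (hgc.intervalIntegrable _ _)
    have e2 : ∫ s in (1 : ℝ)..t, g s = t - 1 := by
      rw [intervalIntegral.integral_congr (g := fun _ => 1)]
      · simp
      · intro s hs
        rw [uIcc_of_le ht] at hs
        exact Real.smoothTransition.one_of_one_le (by linarith [hs.1])
    linarith
  have hn : ∀ t, 0 ≤ deriv χ t := fun t => by rw [hdd]; exact Real.smoothTransition.nonneg _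
  have hl : ∀ t, deriv χ t ≤ 1 := fun t => by rw [hdd]; exact Real.smoothTransition.le_one _
  have hm : Monotone χ := monotone_of_deriv_nonneg (hsm.differentiable (by simp)) hn
  have ha : Antitone fun t => χ t - t := by
    refine antitone_of_deriv_nonpos ((hsm.differentiable (by simp)).sub differentiable_id) fun t => ?_
    rw [show deriv (fun t => χ t - t) t = g t - 1 from ((hd t).sub (hasDerivAt_id t)).deriv, ← (hd t).deriv]
    linarith [hl t]
  refine ⟨χ, hsm, hn, hl, fun t => ?_, h0, h1, fun t => ?_, fun t => ?_⟩
  · rw [hdd]; exact hmono.deriv_nonneg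
  · rw [← h0 (min t (-1)) (min_le_right _ _)]; exact hm (min_le_left _ _)
  · have := ha (le_max_left t 1)
    simp only [h1 (max t 1) (le_max_right _ _)] at this
    linarith

variable {E : Type*} [NormedAddCommGroup E] [NormedSpace ℂ E]

/-- finite sums of squared moduli of holomorphic functions -/
def SOS (Θ : Set E) (u : E → ℝ) : Prop :=
  ∃ (m : ℕ) (g : Fin m → E → ℂ), (∀ i, DifferentiableOn ℂ (g i) Θ) ∧ ∀ x, u x = ∑ i, ‖g i x‖ ^ 2

lemma SOS.nonneg {Θ : Set E} {u : E → ℝ} (h : SOS Θ u) (x : E) : 0 ≤ u x := by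
  obtain ⟨m, g, _, h2⟩ := h
  rw [h2]; positivity

lemma SOS.cont {Θ : Set E} {u : E → ℝ} (h : SOS Θ u) : ContinuousOn u Θ := by
  obtain ⟨m, g, h1, h2⟩ := h
  rw [show u = fun x => ∑ i, ‖g i x‖ ^ 2 from funext h2]
  exact continuousOn_finsetSum _ fun i _ => ((h1 i).continuousOn.norm.pow 2)

lemma SOS.psh [FiniteDimensional ℂ E] [NormedSpace ℝ E] [IsScalarTower ℝ ℂ E] {Θ : Set E} (hΘ : IsOpen Θ)
    {u : E → ℝ} (h : SOS Θ u) {x : E} (hx : x ∈ Θ) : Psh u x := by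
  obtain ⟨m, g, h1, h2⟩ := h
  rw [show u = fun x => ∑ i, ‖g i x‖ ^ 2 from funext h2]
  exact Psh.sum _ fun i _ => Psh.normsq (hol_smooth hΘ (h1 i) hx) (hol_ev hΘ (h1 i) hx)

lemma SOS.comp {F : Type*} [NormedAddCommGroup F] [NormedSpace ℂ F] {u : F → ℝ} (h : SOS univ u)
    {H : E → F} (hH : Differentiable ℂ H) : SOS univ (u ∘ H) := by
  obtain ⟨m, g, h1, h2⟩ := h
  exact ⟨m, fun i => g i ∘ H, fun i => (h1 i).comp hH.differentiableOn (fun _ _ => mem_univ _), fun x => h2 (H x)⟩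

/-- pointwise separation of c from K -/
def SepPt (Θ K : Set E) (c : E) : Prop :=
  ∃ g : E → ℂ, DifferentiableOn ℂ g Θ ∧ ∃ s : ℝ, (∀ x ∈ K, ‖g x‖ ≤ s) ∧ s < ‖g c‖

lemma sepPt_of_hull {Θ K : Set E} (hK : IsCompact K) (hKΘ : K ⊆ Θ) {c : E} (hc : c ∈ Θ) (hn : c ∉ hullO Θ K) :
    SepPt Θ K c := by
  have : ∃ f : E → ℂ, DifferentiableOn ℂ f Θ ∧ ⨆ w ∈ K, ‖f w‖ < ‖f c‖ := by
    by_contra! hcon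
    exact hn ⟨hc, hcon⟩
  obtain ⟨g, h1, h2⟩ := this
  exact ⟨g, h1, _, fun x hx => le_sup_hull hK (h1.continuousOn.mono hKΘ) hx, h2⟩

lemma sos_of_pt {Θ K C : Set E} (hΘ : IsOpen Θ) (hC : IsCompact C) (hCΘ : C ⊆ Θ)
    (hs : ∀ c ∈ C, SepPt Θ K c) {a : ℝ} (ha : 0 < a) (b : ℝ) :
    ∃ u, SOS Θ u ∧ (∀ x ∈ K, u x < a) ∧ ∀ x ∈ C, b < u x := by
  have h1 : ∀ c ∈ C, ∃ g : E → ℂ, DifferentiableOn ℂ g Θ ∧ (∀ x ∈ K, ‖g x‖ ≤ 1 / 2) ∧ 2 < ‖g c‖ := by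
    intro c hc
    obtain ⟨g, hg, s, hs1, hs2⟩ := hs c hc
    have hs3 : max s 0 < ‖g c‖ ∨ ‖g c‖ = 0 := by
      rcases (norm_nonneg (g c)).lt_or_eq with h | h
      · exact Or.inl (max_lt hs2 h)
      · exact Or.inr h.symm
    rcases hs3 with hs3 | hs3
    · obtain ⟨t, ht1, ht2⟩ := exists_between hs3
      have ht0 : 0 < t := (le_max_right _ _).trans_lt ht1
      have e1 : Tendsto (fun j : ℕ => (max s 0 / t) ^ j) atTop (𝓝 0) :=
        tendsto_pow_atTop_nhds_zero_of_lt_one (by positivity) ((div_lt_one ht0).2 ht1)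
      have e2 : Tendsto (fun j : ℕ => (‖g c‖ / t) ^ j) atTop atTop :=
        tendsto_pow_atTop_atTop_of_one_lt ((one_lt_div ht0).2 ht2)
      obtain ⟨j, hj1, hj2⟩ := ((e1.eventually (Iic_mem_nhds (show (0:ℝ) < 1 / 2 by norm_num))).and
        (e2.eventually (eventually_gt_atTop 2))).exists
      refine ⟨fun x => (g x / t) ^ j, (by simp only [div_eq_mul_inv]; exact (hg.mul_const _).pow j), fun x hx => ?_, ?_⟩
      · rw [norm_pow, norm_div, Complex.norm_real, Real.norm_of_nonneg ht0.le]
        refine le_trans ?_ hj1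
        have := (hs1 x hx).trans (le_max_left s 0)
        gcongr
      · rw [norm_pow, norm_div, Complex.norm_real, Real.norm_of_nonneg ht0.le]
        exact hj2
    · refine ⟨fun _ => 3, differentiableOn_const _, fun x hx => ?_, by norm_num⟩
      have := (norm_nonneg _).trans (hs1 x hx)
      linarith
  choose! g hg1 hg2 hg3 using h1
  obtain ⟨t, ht⟩ := hC.elim_nhds_subcover' (fun c hc => Θ ∩ (fun x => ‖g c x‖) ⁻¹' (Ioi 2)) (fun c hc =>
    ((hg1 c hc).continuousOn.norm.isOpen_inter_preimage hΘ isOpen_Ioi).mem_nhds ⟨hCΘ hc, hg3 c hc⟩)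
  have e1 : Tendsto (fun j : ℕ => (t.card : ℝ) * (1 / 4) ^ j) atTop (𝓝 0) := by
    simpa using (tendsto_pow_atTop_nhds_zero_of_lt_one (by norm_num : (0:ℝ) ≤ 1 / 4) (by norm_num)).const_mul (t.card : ℝ)
  have e2 : Tendsto (fun j : ℕ => (4 : ℝ) ^ j) atTop atTop := tendsto_pow_atTop_atTop_of_one_lt (by norm_num)
  obtain ⟨j, hj1, hj2⟩ := ((e1.eventually (Iio_mem_nhds ha)).and (e2.eventually (eventually_gt_atTop b))).exists
  refine ⟨fun x => ∑ c ∈ t, ‖g c x ^ j‖ ^ 2, ?_, fun x hx => ?_, fun x hx => ?_⟩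
  · refine ⟨t.card, fun i x => g (t.equivFin.symm i) x ^ j, fun i => (hg1 _ (t.equivFin.symm i).1.2).pow j, fun x => ?_⟩
    refine (Finset.sum_coe_sort t (fun c : C => ‖g c x ^ j‖ ^ 2)).symm.trans ?_
    exact (t.equivFin.symm.sum_comp (fun c : t => ‖g c x ^ j‖ ^ 2)).symm
  · refine lt_of_le_of_lt ?_ hj1
    rw [← nsmul_eq_mul]
    refine Finset.sum_le_card_nsmul _ _ _ fun c hc => ?_
    have := hg2 c c.2 x hx
    rw [norm_pow, ← pow_mul, mul_comm, pow_mul]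
    have h4 : ‖g c x‖ ^ 2 ≤ 1 / 4 := by nlinarith [norm_nonneg (g c x)]
    gcongr
  · obtain ⟨c, hc, hx2⟩ := mem_iUnion₂.1 (ht hx)
    refine hj2.trans_le (le_trans ?_ (Finset.single_le_sum (f := fun c : C => ‖g c x ^ j‖ ^ 2)
      (fun c _ => by positivity) hc))
    have h2 : 2 < ‖g c x‖ := hx2.2
    rw [norm_pow, ← pow_mul, mul_comm, pow_mul]
    have h4 : 4 ≤ ‖g c x‖ ^ 2 := by nlinarith
    gcongr
end sos

section glue
open Filter

lemma small_of {E V : Type*} [TopologicalSpace E] [NormedAddCommGroup V] {X O : Set E} (hX : IsCompact X)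
    {w : E → V} (hw : Continuous w) (hO : IsOpen O) (h : ∀ x ∈ X, w x = 0 → x ∈ O) :
    ∃ ε > 0, ∀ x ∈ X, ‖w x‖ ≤ ε → x ∈ O := by
  rcases (X \ O).eq_empty_or_nonempty with he | hne
  · exact ⟨1, one_pos, fun x hx _ => by_contra fun hxO => (he ▸ (⟨hx, hxO⟩ : x ∈ X \ O) : x ∈ (∅ : Set E))⟩
  · obtain ⟨y, hy, hmin⟩ := (hX.diff hO).exists_isMinOn hne hw.norm.continuousOn
    have hy0 : 0 < ‖w y‖ := norm_pos_iff.2 fun h0 => hy.2 (h y hy.1 h0)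
    refine ⟨‖w y‖ / 2, by positivity, fun x hx hxw => by_contra fun hxO => ?_⟩
    have : ‖w y‖ ≤ ‖w x‖ := hmin (⟨hx, hxO⟩ : x ∈ X \ O)
    linarith

variable {E F V : Type*} [NormedAddCommGroup E] [NormedSpace ℂ E] [NormedSpace ℝ E] [IsScalarTower ℝ ℂ E]
  [FiniteDimensional ℂ E] [NormedAddCommGroup F] [NormedSpace ℂ F] [FiniteDimensional ℂ F]
  [NormedAddCommGroup V]

theorem glue {H : E → F} (hH : Differentiable ℂ H) {w : E → V} (hw : Continuous w) {γ : F → E} (hγ : Continuous γ)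
    (hprop : ∀ B : Set F, IsCompact B → IsCompact {q | ‖w q‖ ≤ 1 ∧ H q ∈ B})
    (hγw : ∀ q, w q = 0 → q = γ (H q)) {Kt T : Set F} (hKt : IsCompact Kt) (hTK : T ⊆ Kt)
    {Θ U S : Set E} (hΘ : IsOpen Θ) (hU : IsOpen U) (hS : IsCompact S) (hSΘ : S ⊆ Θ) (hSU : S ⊆ U)
    (hKU : ∀ y ∈ Kt, γ y ∈ U) (hST : ∀ q ∈ S, w q = 0 → H q ∈ T) (hTS : ∀ y ∈ T, γ y ∈ S)
    (sepS : ∀ c ∈ Θ, c ∉ S → SepPt Θ S c) (sepK : ∀ c ∉ Kt, SepPt univ Kt c) (sepT : ∀ c ∉ T, SepPt univ T c) :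
    ∃ (C : Set E) (R R2 : E → ℝ), IsCompact C ∧ C ⊆ U ∧ S ⊆ interior C ∧ {q | w q = 0 ∧ H q ∈ Kt} ⊆ interior C ∧
      (∀ x ∈ C, Psh R x) ∧ (∀ x ∈ C, Psh R2 x) ∧ (∀ x ∈ C, 0 ≤ R2 x) ∧ (∀ x ∈ S, R x < 0) ∧ (∀ x ∈ S, R2 x = 0) ∧
      (∀ x, w x = 0 → H x ∈ Kt → R2 x = 0) ∧ ∀ x ∈ frontier C, R2 x ≤ 2 → 0 < R x ∧ w x ≠ 0 := by
  classical
  haveI : ProperSpace E := FiniteDimensional.proper ℂ E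
  haveI : ProperSpace F := FiniteDimensional.proper ℂ F
  have hHc := hH.continuous
  obtain ⟨χ, x1, x2, x3, x4, x5, x6, x7, x8⟩ := exists_chi
  -- W
  obtain ⟨W, hW, hSW, hWΘ, hWc⟩ := exists_open_between_and_isCompact_closure hS (hΘ.inter hU) (subset_inter hSΘ hSU)
  -- v
  obtain ⟨v, v1, v2, v3⟩ := sos_of_pt (K := T) (C := Kt \ γ ⁻¹' W) isOpen_univ (hKt.diff (hW.preimage hγ)) (subset_univ _)
    (fun c hc => sepT c fun hcT => hc.2 (hSW (hTS c hcT))) (show (0:ℝ) < 1 / 4 by norm_num) 3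
  have hvc : Continuous v := continuousOn_univ.1 v1.cont
  -- Q
  have hO1 : IsOpen (γ ⁻¹' U ∩ (γ ⁻¹' W ∪ v ⁻¹' Ioi 2)) :=
    (hU.preimage hγ).inter ((hW.preimage hγ).union (isOpen_Ioi.preimage hvc))
  obtain ⟨Q, hQ, hKQ, hQO, hQc⟩ := exists_open_between_and_isCompact_closure hKt hO1 (fun y hy => ⟨hKU y hy, by
    by_cases hyW : γ y ∈ W
    · exact Or.inl hyW
    · refine Or.inr ?_
      have := v3 y ⟨hy, hyW⟩
      show 2 < v y
      linarith⟩)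
  obtain ⟨Q1, hQ1, hKQ1, hQ1Q, hQ1c⟩ := exists_open_between_and_isCompact_closure hKt hQ hKQ
  -- kappa
  obtain ⟨κ, k1, k2, k3⟩ := sos_of_pt (K := Kt) (C := closure Q \ Q1) isOpen_univ (hQc.diff hQ1) (subset_univ _)
    (fun c hc => sepK c fun hcK => hc.2 (hKQ1 hcK)) (show (0:ℝ) < 1 / 2 by norm_num) 5
  have hκc : Continuous κ := continuousOn_univ.1 k1.cont
  set G : Set F := v ⁻¹' Iio (1 / 2) ∩ κ ⁻¹' Iio 1 with hG
  have hGo : IsOpen G := (isOpen_Iio.preimage hvc).inter (isOpen_Iio.preimage hκc)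
  have hTG : T ⊆ G := fun y hy => ⟨by have := v2 y hy; show v y < 1 / 2; linarith,
    by have := k2 y (hTK hy); show κ y < 1; linarith⟩
  -- epsilon
  obtain ⟨ε1, he1, hε1⟩ := small_of (hprop _ hQc) hw (hU.inter (hW.union (isOpen_Ioi.preimage (hvc.comp hHc)) :
    IsOpen (W ∪ (v ∘ H) ⁻¹' Ioi 2))) (fun q hq hq0 => by
      have := hQO hq.2
      rw [mem_inter_iff, mem_union, mem_preimage, mem_preimage, ← hγw q hq0] at this
      exact this)
  obtain ⟨ε2, he2, hε2⟩ := small_of hS hw (hGo.preimage hHc) (fun q hq hq0 => hTG (hST q hq hq0))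
  obtain ⟨ε, hε0, hεe1, hεe2, hεle⟩ : ∃ ε : ℝ, 0 < ε ∧ ε ≤ ε1 ∧ ε ≤ ε2 ∧ ε ≤ 1 :=
    ⟨min (min ε1 ε2) 1, by positivity, (min_le_left _ _).trans (min_le_left _ _),
      (min_le_left _ _).trans (min_le_right _ _), min_le_right _ _⟩
  have hFU : ∀ q, ‖w q‖ ≤ ε → H q ∈ closure Q → q ∈ U ∧ (q ∈ W ∨ 2 < v (H q)) := fun q h1 h2 =>
    hε1 q ⟨h1.trans hεle, h2⟩ (h1.trans hεe1)
  have hSG : ∀ q ∈ S, ‖w q‖ ≤ ε → H q ∈ G := fun q hq h1 => hε2 q hq (h1.trans hεe2)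
  -- L
  have hO2 : IsOpen (W ∩ ((fun q => ‖w q‖) ⁻¹' Ioi ε ∪ H ⁻¹' G) ∩ ((fun q => ‖w q‖) ⁻¹' Ioi 0 ∪ H ⁻¹' Q)) :=
    (hW.inter ((isOpen_Ioi.preimage hw.norm).union (hGo.preimage hHc))).inter
      ((isOpen_Ioi.preimage hw.norm).union (hQ.preimage hHc))
  obtain ⟨L, hL, hSL, hLO⟩ := exists_compact_between hS hO2 (fun q hq => ⟨⟨hSW hq, by
      by_cases h : ε < ‖w q‖
      · exact Or.inl h
      · exact Or.inr (hSG q hq (not_lt.1 h))⟩, by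
      by_cases h : w q = 0
      · exact Or.inr (hKQ (hTK (hST q hq h)))
      · exact Or.inl (norm_pos_iff.2 h)⟩)
  have hLW : L ⊆ W := fun q hq => (hLO hq).1.1
  have hLG : ∀ q ∈ L, ‖w q‖ ≤ ε → H q ∈ G := fun q hq h => (hLO hq).1.2.resolve_left (not_lt.2 h)
  have hLQ : ∀ q ∈ L, w q = 0 → H q ∈ Q := fun q hq h => (hLO hq).2.resolve_left (by simp [h])
  -- B
  obtain ⟨B0, b1, b2, b3⟩ := sos_of_pt (K := S) (C := closure W \ interior L) hΘ (hWc.diff isOpen_interior)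
    (fun q hq => (hWΘ hq.1).1) (fun c hc => sepS c (hWΘ hc.1).1 fun hcS => hc.2 (hSL hcS)) one_pos 1
  obtain ⟨b, hb⟩ := hWc.exists_bound_of_continuousOn (b1.cont.mono fun q hq => (hWΘ hq).1)
  set B : E → ℝ := fun q => B0 q + (-1) with hB
  have hBge : ∀ q, -1 ≤ B q := fun q => by have := b1.nonneg q; simp only [hB]; linarith
  have hBle : ∀ q ∈ W, B q ≤ b - 1 := fun q hq => by
    have := (le_abs_self _).trans (hb q (subset_closure hq)); simp only [hB]; linarith
  have hBp : ∀ q ∈ W, Psh B q := fun q hq => (b1.psh hΘ (hWΘ (subset_closure hq)).1).add (Psh.const _ q)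
  set l := max 6 (b + 2) with hl
  have hl6 : 6 ≤ l := le_max_left _ _
  have hlb : b + 2 ≤ l := le_max_right _ _
  set D : E → ℝ := fun q => l * v (H q) + (-l) with hD
  have hDp : ∀ q, Psh D q := fun q =>
    (((v1.comp hH).psh isOpen_univ (mem_univ q)).const_mul (by linarith : 0 ≤ l)).add (Psh.const _ q)
  have hDG : ∀ q, v (H q) < 1 / 2 → D q ≤ -3 := fun q hq => by simp only [hD]; nlinarith
  have hD2 : ∀ q, 2 < v (H q) → l ≤ D q := fun q hq => by simp only [hD]; nlinarith
  set N : Set E := (fun q => ‖w q‖) ⁻¹' Iio ε ∩ H ⁻¹' Q with hN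
  have hNo : IsOpen N := (isOpen_Iio.preimage hw.norm).inter (hQ.preimage hHc)
  set Ff : Set E := (fun q => ‖w q‖) ⁻¹' Iic ε ∩ H ⁻¹' closure Q with hFf
  have hFc : IsClosed Ff := (isClosed_Iic.preimage hw.norm).inter (isClosed_closure.preimage hHc)
  have hNF : N ⊆ Ff := fun q hq =>
    ⟨(show ‖w q‖ < ε from hq.1).le, subset_closure hq.2⟩
  set C1 : Set E := {q | ‖w q‖ ≤ ε / 2 ∧ H q ∈ closure Q1} with hC1
  have hC1N : C1 ⊆ N := fun q hq => ⟨lt_of_le_of_lt hq.1 (by linarith), hQ1Q hq.2⟩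
  have hC1c : IsCompact C1 := (hprop _ hQ1c).of_isClosed_subset
    ((isClosed_le hw.norm continuous_const).inter (isClosed_closure.preimage hHc))
    (fun q hq => ⟨hq.1.trans (by linarith), hq.2⟩)
  have hC1i : (fun q => ‖w q‖) ⁻¹' Iio (ε / 2) ∩ H ⁻¹' Q1 ⊆ interior (C1 ∪ L) :=
    interior_maximal (fun q hq => Or.inl ⟨(show ‖w q‖ < ε / 2 from hq.1).le, subset_closure hq.2⟩)
      ((isOpen_Iio.preimage hw.norm).inter (hQ1.preimage hHc))
  set R : E → ℝ := fun q => if q ∈ N then (if q ∈ W then D q + χ (B q - D q) else D q) else B q with hR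
  set R2 : E → ℝ := fun q => if q ∈ N then χ (κ (H q) + (-2)) else 0 with hR2
  have hRG : ∀ q ∈ W, v (H q) < 1 / 2 → R q = B q := by
    intro q hq hv
    simp only [hR, if_pos hq]
    split_ifs with hqN
    · rw [x6 _ (by linarith [hDG q hv, hBge q])]; ring
    · rfl
  have hRV : ∀ q ∈ N, 2 < v (H q) → R q = D q := by
    intro q hq hv
    simp only [hR, if_pos hq]
    split_ifs with hqW
    · rw [x5 _ (by linarith [hD2 q hv, hBle q hqW]), add_zero]
    · rfl
  have hR2G : ∀ q, κ (H q) < 1 → R2 q = 0 := by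
    intro q hq
    simp only [hR2]
    split_ifs
    · exact x5 _ (by linarith)
    · rfl
  have hvHo : ∀ {s : Set ℝ}, IsOpen s → IsOpen {q | v (H q) ∈ s} := fun hs => hs.preimage (hvc.comp hHc)
  have hκHo : ∀ {s : Set ℝ}, IsOpen s → IsOpen {q | κ (H q) ∈ s} := fun hs => hs.preimage (hκc.comp hHc)
  refine ⟨C1 ∪ L, R, R2, hC1c.union hL, union_subset (fun q hq => (hFU q (hNF (hC1N hq)).1 (hNF (hC1N hq)).2).1)
    (fun q hq => (hWΘ (subset_closure (hLW hq))).2), fun q hq => interior_mono subset_union_right (hSL hq),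
    fun q hq => hC1i ⟨by simp [hq.1, hε0], hKQ1 hq.2⟩, fun q hq => ?_, fun q hq => ?_, fun q hq => ?_,
    fun q hq => ?_, fun q hq => ?_, fun q hq hq2 => ?_, fun q hq hq2 => ?_⟩
  · -- Psh R
    by_cases hqN : q ∈ N
    · by_cases hqW : q ∈ W
      · refine ((hBp q hqW).rmax (hDp q) x1 x2 x3 x4).congr ?_
        filter_upwards [hNo.mem_nhds hqN, hW.mem_nhds hqW] with y hy1 hy2
        simp only [hR, if_pos hy1, if_pos hy2]
      · have hv := (hFU q (hNF hqN).1 (hNF hqN).2).2.resolve_left hqW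
        refine (hDp q).congr ?_
        filter_upwards [hNo.mem_nhds hqN, (hvHo isOpen_Ioi).mem_nhds hv] with y hy1 hy2 using hRV y hy1 hy2
    · have hqL : q ∈ L := hq.resolve_left fun h => hqN (hC1N h)
      refine (hBp q (hLW hqL)).congr ?_
      by_cases hqF : q ∈ Ff
      · have hg := hLG q hqL hqF.1
        filter_upwards [hW.mem_nhds (hLW hqL), (hvHo isOpen_Iio).mem_nhds hg.1] with y hy1 hy2 using hRG y hy1 hy2
      · filter_upwards [hFc.isOpen_compl.mem_nhds hqF] with y hy
        simp only [hR, if_neg fun h => hy (hNF h)]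
  · -- Psh R2
    by_cases hqN : q ∈ N
    · have hk : Psh (fun y => κ (H y) + (-2)) q := ((k1.comp hH).psh isOpen_univ (mem_univ q)).add (Psh.const _ q)
      refine (hk.comp x1.contDiffAt (x2 _) (x4 _)).congr ?_
      filter_upwards [hNo.mem_nhds hqN] with y hy1
      simp only [hR2, if_pos hy1]
    · have hqL : q ∈ L := hq.resolve_left fun h => hqN (hC1N h)
      refine (Psh.const 0 q).congr ?_
      by_cases hqF : q ∈ Ff
      · have hg := hLG q hqL hqF.1
        filter_upwards [(hκHo isOpen_Iio).mem_nhds hg.2] with y hy2 using hR2G y hy2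
      · filter_upwards [hFc.isOpen_compl.mem_nhds hqF] with y hy
        simp only [hR2, if_neg fun h => hy (hNF h)]
  · simp only [hR2]
    split_ifs
    · exact x7 _
    · exact le_rfl
  · have hBq : B q < 0 := by have := b2 q hq; simp only [hB]; linarith
    by_cases hqN : q ∈ N
    · rw [hRG q (hSW hq) (hSG q hq (le_of_lt hqN.1)).1]; exact hBq
    · simp only [hR, if_neg hqN]; exact hBq
  · by_cases hqN : q ∈ N
    · exact hR2G q (hSG q hq (le_of_lt hqN.1)).2
    · simp only [hR2, if_neg hqN]
  · exact hR2G q (by linarith [k2 _ hq2])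
  · have hqC : q ∈ C1 ∪ L := (hC1c.union hL).isClosed.frontier_subset hq
    have hqL : q ∉ interior L := fun h => hq.2 (interior_mono subset_union_right h)
    have hBpos : q ∈ W → 0 < B q := fun h => by
      have := b3 q ⟨subset_closure h, hqL⟩; simp only [hB]; linarith
    constructor
    · by_cases hqN : q ∈ N
      · by_cases hqW : q ∈ W
        · simp only [hR, if_pos hqN, if_pos hqW]
          have := x8 (B q - D q)
          linarith [hBpos hqW]
        · have hv := (hFU q (hNF hqN).1 (hNF hqN).2).2.resolve_left hqW
          rw [hRV q hqN hv]
          linarith [hD2 q hv]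
      · have hqL : q ∈ L := hqC.resolve_left fun h => hqN (hC1N h)
        simp only [hR, if_neg hqN]
        exact hBpos (hLW hqL)
    · intro h0
      have hqQ : H q ∈ Q := by
        rcases hqC with h | h
        · exact hQ1Q h.2
        · exact hLQ q h h0
      have hqN : q ∈ N := ⟨by simp [h0, hε0], hqQ⟩
      by_cases hqQ1 : H q ∈ Q1
      · exact hq.2 (hC1i ⟨by simp [h0, hε0], hqQ1⟩)
      · have e1 := k3 _ ⟨subset_closure hqQ, hqQ1⟩
        have e2 := x8 (κ (H q) + (-2))
        simp only [hR2, if_pos hqN] at hq2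
        linarith
end glue

section approx
open Filter

lemma gauss {n : ℕ} (a : EuclideanSpace ℂ (Fin n)) : ∃ g : EuclideanSpace ℂ (Fin n) → ℂ, Differentiable ℂ g ∧
    ‖g a‖ = 1 ∧ ∀ p ∈ realSlice n, ‖g p‖ = Real.exp (-‖p - a‖ ^ 2) := by
  set τ : ℝ := ∑ i, (a i).im ^ 2 with hτ
  refine ⟨fun p => Complex.exp (-(∑ i, (p i - ((a i).re : ℂ)) ^ 2) - (τ : ℂ)), by fun_prop, ?_, ?_⟩
  · rw [Complex.norm_exp, Real.exp_eq_one_iff]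
    have : ∀ i, ((a i - ((a i).re : ℂ)) ^ 2) = ((-(a i).im ^ 2 : ℝ) : ℂ) := by
      intro i
      apply Complex.ext <;> simp [pow_two]
    simp only [this]
    rw [← Complex.ofReal_sum, ← Complex.ofReal_neg, ← Complex.ofReal_sub, Complex.ofReal_re]
    simp [hτ]
  · intro p hp
    rw [Complex.norm_exp]
    congr 1
    have h1 : ∀ i, ((p i - ((a i).re : ℂ)) ^ 2) = ((((p i).re - (a i).re) ^ 2 : ℝ) : ℂ) := by
      intro i
      have := hp i
      apply Complex.ext <;> simp [pow_two, this]
    simp only [h1]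
    rw [← Complex.ofReal_sum, ← Complex.ofReal_neg, ← Complex.ofReal_sub, Complex.ofReal_re,
      EuclideanSpace.norm_sq_eq]
    have h2 : ∀ i, ‖(p - a) i‖ ^ 2 = ((p i).re - (a i).re) ^ 2 + (a i).im ^ 2 := by
      intro i
      have := hp i
      rw [Complex.sq_norm, Complex.normSq_apply]
      simp [this]; ring
    simp only [h2, Finset.sum_add_distrib, hτ]
    ring

lemma sep_real {n : ℕ} {P : Set (EuclideanSpace ℂ (Fin n))} (hP : IsCompact P) (hr : P ⊆ realSlice n)
    {a : EuclideanSpace ℂ (Fin n)} (ha : a ∉ P) : SepPt univ P a := by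
  obtain ⟨g, g1, g2, g3⟩ := gauss a
  obtain ⟨δ, hδ, hb⟩ := Metric.mem_nhds_iff.1 (hP.isClosed.isOpen_compl.mem_nhds ha)
  refine ⟨g, g1.differentiableOn, Real.exp (-δ ^ 2), fun p hp => ?_, ?_⟩
  · rw [g3 p (hr hp), Real.exp_le_exp]
    have : δ ≤ ‖p - a‖ := by
      by_contra! h
      exact hb (show p ∈ Metric.ball a δ by rwa [Metric.mem_ball, dist_eq_norm]) hp
    nlinarith
  · rw [g2, Real.exp_lt_one_iff]; simpa using pow_pos hδ 2

lemma sep_fiber {n : ℕ} {F : Type*} [NormedAddCommGroup F] [NormedSpace ℂ F]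
    {L : Set (EuclideanSpace ℂ (Fin n) × F)} (hL : IsCompact L) (hr : ∀ q ∈ L, q.1 ∈ realSlice n)
    {a : EuclideanSpace ℂ (Fin n)} {b : F} (hs : SepPt univ (fiberOf L a) b) : SepPt univ L (a, b) := by
  have : ∃ g : F → ℂ, Differentiable ℂ g ∧ ∃ s : ℝ, 0 < s ∧ (∀ x ∈ fiberOf L a, ‖g x‖ < s) ∧ s < ‖g b‖ := by
    obtain ⟨g, hg, s, h1, h2⟩ := hs
    rcases (norm_nonneg (g b)).lt_or_eq with h | h
    · have h3 : max s 0 < ‖g b‖ := max_lt h2 h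
      refine ⟨g, differentiableOn_univ.1 hg, (max s 0 + ‖g b‖) / 2, ?_, fun x hx => ?_, by linarith⟩
      · linarith [le_max_right s 0]
      · linarith [le_max_left s 0, h1 x hx]
    · refine ⟨fun _ => 1, by fun_prop, 1 / 2, by norm_num, fun x hx => ?_, by norm_num⟩
      linarith [h1 x hx, norm_nonneg (g x)]
  obtain ⟨g, g1, s, hs0, g2, g3⟩ := this
  obtain ⟨e, e1, e2, e3⟩ := gauss a
  have hL1 : IsCompact (L ∩ {q | s ≤ ‖g q.2‖}) :=
    hL.inter_right (isClosed_le continuous_const (g1.continuous.comp continuous_snd).norm)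
  have ha : a ∉ Prod.fst '' (L ∩ {q | s ≤ ‖g q.2‖}) := by
    rintro ⟨⟨p, x⟩, ⟨hq, hx⟩, rfl⟩
    exact absurd (g2 x hq) (not_lt.2 hx)
  obtain ⟨δ, hδ, hb⟩ := Metric.mem_nhds_iff.1 ((hL1.image continuous_fst).isClosed.isOpen_compl.mem_nhds ha)
  obtain ⟨M, hM⟩ := hL.exists_bound_of_continuousOn (f := fun q => g q.2) (g1.continuous.comp continuous_snd).continuousOn
  have hlt : Real.exp (-δ ^ 2) < 1 := by rw [Real.exp_lt_one_iff]; simpa using pow_pos hδ 2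
  have ht := (tendsto_pow_atTop_nhds_zero_of_lt_one (Real.exp_nonneg (-δ ^ 2)) hlt).const_mul (|M|)
  rw [mul_zero] at ht
  obtain ⟨m, hm⟩ := (ht.eventually (gt_mem_nhds hs0)).exists
  refine ⟨fun q => g q.2 * e q.1 ^ m, Differentiable.differentiableOn ?_, s, fun q hq => ?_, ?_⟩
  · exact (g1.comp differentiable_snd).mul ((e1.comp differentiable_fst).pow m)
  · rw [norm_mul, norm_pow, e3 _ (hr q hq)]
    by_cases hqs : s ≤ ‖g q.2‖
    · have : δ ≤ ‖q.1 - a‖ := by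
        by_contra! h
        exact hb (show q.1 ∈ Metric.ball a δ by rwa [Metric.mem_ball, dist_eq_norm]) ⟨q, ⟨hq, hqs⟩, rfl⟩
      have h1 : Real.exp (-‖q.1 - a‖ ^ 2) ≤ Real.exp (-δ ^ 2) := by
        rw [Real.exp_le_exp]; nlinarith
      have h2 : ‖g q.2‖ ≤ |M| := (hM q hq).trans (le_abs_self M)
      have := mul_le_mul h2 (pow_le_pow_left₀ (Real.exp_nonneg _) h1 m) (by positivity) (by positivity)
      linarith
    · have h1 : Real.exp (-‖q.1 - a‖ ^ 2) ^ m ≤ 1 := pow_le_one₀ (Real.exp_nonneg _) (by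
        rw [Real.exp_le_one_iff]; nlinarith [sq_nonneg ‖q.1 - a‖])
      have := mul_le_mul (not_le.1 hqs).le h1 (by positivity) hs0.le
      linarith
  · simpa [e2] using g3

/-- restrictions to `P` of entire functions, real valued on `P` -/
def entAlg {n : ℕ} (P : Set (EuclideanSpace ℂ (Fin n))) : Subalgebra ℝ C(P, ℝ) where
  carrier := {φ | ∃ g : EuclideanSpace ℂ (Fin n) → ℂ, Differentiable ℂ g ∧ ∀ p : P, g p = (φ p : ℂ)}
  mul_mem' := by
    rintro φ ψ ⟨g, g1, g2⟩ ⟨k, k1, k2⟩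
    exact ⟨fun p => g p * k p, g1.mul k1, fun p => by simp [g2, k2]⟩
  add_mem' := by
    rintro φ ψ ⟨g, g1, g2⟩ ⟨k, k1, k2⟩
    exact ⟨fun p => g p + k p, g1.add k1, fun p => by simp [g2, k2]⟩
  algebraMap_mem' := fun r => ⟨fun _ => (r : ℂ), by fun_prop, fun p => by simp⟩

lemma ent_approx {n : ℕ} {P : Set (EuclideanSpace ℂ (Fin n))} (hP : IsCompact P) (hr : P ⊆ realSlice n)
    (φ : C(P, ℝ)) {ε : ℝ} (hε : 0 < ε) :
    ∃ g : EuclideanSpace ℂ (Fin n) → ℂ, Differentiable ℂ g ∧ ∀ p : P, ‖g p - (φ p : ℂ)‖ < ε := by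
  haveI : CompactSpace P := isCompact_iff_compactSpace.1 hP
  have hsep : (entAlg P).SeparatesPoints := by
    intro p q hpq
    have : ∃ i, (p : EuclideanSpace ℂ (Fin n)) i ≠ (q : EuclideanSpace ℂ (Fin n)) i := by
      by_contra! hc
      exact hpq (Subtype.ext (PiLp.ext hc))
    obtain ⟨i, hi⟩ := this
    refine ⟨fun p : P => ((p : EuclideanSpace ℂ (Fin n)) i).re,
      ⟨⟨fun p : P => ((p : EuclideanSpace ℂ (Fin n)) i).re, by fun_prop⟩, ⟨fun p => p i, by fun_prop, fun p => ?_⟩, rfl⟩, ?_⟩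
    · apply Complex.ext <;> simp [hr p.2 i]
    · intro h
      exact hi (Complex.ext h (by rw [hr p.2 i, hr q.2 i]))
  obtain ⟨⟨ψ, g, g1, g2⟩, hψ⟩ := ContinuousMap.exists_mem_subalgebra_near_continuousMap_of_separatesPoints (entAlg P) hsep φ ε hε
  refine ⟨g, g1, fun p => ?_⟩
  rw [g2, ← Complex.ofReal_sub, Complex.norm_real]
  exact (ContinuousMap.norm_coe_le_norm (ψ - φ) p).trans_lt hψ

lemma fam_approx {n : ℕ} {F V : Type*} [NormedAddCommGroup F] [NormedSpace ℂ F] [NormedAddCommGroup V] [NormedSpace ℂ V]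
    {P : Set (EuclideanSpace ℂ (Fin n))} (hP : IsCompact P) (hr : P ⊆ realSlice n)
    {f : EuclideanSpace ℂ (Fin n) → F → V}
    (hfc : ContinuousOn (fun q : EuclideanSpace ℂ (Fin n) × F => f q.1 q.2) (P ×ˢ univ))
    (hfh : ∀ p ∈ P, Differentiable ℂ (f p)) {X : Set F} (hX : IsCompact X) {ε : ℝ} (hε : 0 < ε) :
    ∃ G : EuclideanSpace ℂ (Fin n) × F → V, Differentiable ℂ G ∧ ∀ p ∈ P, ∀ x ∈ X, ‖G (p, x) - f p x‖ < ε := by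
  classical
  have hPX : IsCompact (P ×ˢ X) := hP.prod hX
  have hfc' := hfc.mono (prod_mono_right (subset_univ X))
  obtain ⟨δ, hδ, hu⟩ := Metric.uniformContinuousOn_iff.1 (hPX.uniformContinuousOn_of_continuous hfc') (ε / 2) (by positivity)
  obtain ⟨M, hM⟩ := hPX.exists_bound_of_continuousOn hfc'
  obtain ⟨t, htP, htf, ht⟩ := hP.finite_cover_balls hδ
  lift t to Finset (EuclideanSpace ℂ (Fin n)) using htf
  set b : EuclideanSpace ℂ (Fin n) → EuclideanSpace ℂ (Fin n) → ℝ := fun j p => max 0 (δ - dist p j) with hb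
  have hb0 : ∀ j p, 0 ≤ b j p := fun j p => le_max_left _ _
  have hbs : ∀ p ∈ P, 0 < ∑ j ∈ t, b j p := by
    intro p hp
    obtain ⟨j, hj, hpj⟩ := mem_iUnion₂.1 (ht hp)
    exact Finset.sum_pos' (fun j _ => hb0 j p) ⟨j, hj, lt_max_of_lt_right (by linarith [Metric.mem_ball.1 hpj])⟩
  have hbc : ∀ j, Continuous (b j) := fun j => by simp only [hb]; fun_prop
  set φ : EuclideanSpace ℂ (Fin n) → C(P, ℝ) := fun j => ⟨fun p => b j p / ∑ i ∈ t, b i p,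
    ((hbc j).comp continuous_subtype_val).div (continuous_finsetSum _ fun i _ => (hbc i).comp continuous_subtype_val)
      (fun p => (hbs p p.2).ne')⟩ with hφ
  set η : ℝ := ε / 2 / ((t.card + 1) * (|M| + 1)) with hη
  have hη0 : 0 < η := by positivity
  choose g g1 g2 using fun j => ent_approx hP hr (φ j) hη0
  refine ⟨fun q => ∑ j ∈ t, g j q.1 • f j q.2, ?_, ?_⟩
  · apply Differentiable.fun_sum
    intro j hj
    exact ((g1 j).comp differentiable_fst).smul ((hfh j (htP hj)).comp differentiable_snd)
  · intro p hp x hx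
    have hsum : ∑ j ∈ t, (φ j ⟨p, hp⟩ : ℝ) = 1 := by
      simp only [hφ, ContinuousMap.coe_mk]
      rw [← Finset.sum_div, div_self (hbs p hp).ne']
    have e1 : (∑ j ∈ t, g j p • f j x) - f p x =
        ∑ j ∈ t, ((g j p - (φ j ⟨p, hp⟩ : ℂ)) • f j x + (φ j ⟨p, hp⟩ : ℂ) • (f j x - f p x)) := by
      have : f p x = ∑ j ∈ t, (φ j ⟨p, hp⟩ : ℂ) • f p x := by
        rw [← Finset.sum_smul, ← Complex.ofReal_sum, hsum]; simp
      conv_lhs => rw [this]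
      rw [← Finset.sum_sub_distrib]
      refine Finset.sum_congr rfl fun j _ => ?_
      module
    have e2 : ∀ j ∈ t, ‖(g j p - (φ j ⟨p, hp⟩ : ℂ)) • f j x + (φ j ⟨p, hp⟩ : ℂ) • (f j x - f p x)‖
        ≤ η * |M| + φ j ⟨p, hp⟩ * (ε / 2) := by
      intro j hj
      refine (norm_add_le _ _).trans (add_le_add ?_ ?_)
      · rw [norm_smul]
        exact mul_le_mul (g2 j ⟨p, hp⟩).le ((hM (j, x) ⟨htP hj, hx⟩).trans (le_abs_self M)) (norm_nonneg _) hη0.le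
      · have h0 : 0 ≤ φ j ⟨p, hp⟩ := div_nonneg (hb0 _ _) (hbs p hp).le
        rw [norm_smul, Complex.norm_real, Real.norm_of_nonneg h0]
        by_cases hd : dist p j < δ
        · refine mul_le_mul_of_nonneg_left ?_ h0
          have := hu (j, x) ⟨htP hj, hx⟩ (p, x) ⟨hp, hx⟩ (by simpa [Prod.dist_eq, dist_comm] using hd)
          rw [dist_eq_norm] at this
          exact this.le
        · have : φ j ⟨p, hp⟩ = 0 := by
            simp only [hφ, hb, ContinuousMap.coe_mk]
            rw [max_eq_left (by linarith), zero_div]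
          rw [this]; simp
    show ‖(∑ j ∈ t, g j p • f j x) - f p x‖ < ε
    rw [e1]
    refine ((norm_sum_le _ _).trans (Finset.sum_le_sum e2)).trans_lt ?_
    rw [Finset.sum_add_distrib, Finset.sum_const, nsmul_eq_mul, ← Finset.sum_mul, hsum]
    have : (t.card : ℝ) * (η * |M|) < ε / 2 := by
      rw [hη, ← sub_pos]
      have hc : (0 : ℝ) ≤ t.card := by positivity
      have : ε / 2 - t.card * (ε / 2 / ((t.card + 1) * (|M| + 1)) * |M|) =
        ε / 2 * ((t.card + |M| + 1) / ((t.card + 1) * (|M| + 1))) := by field_simp; ring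
      rw [this]; positivity
    linarith
end approx

section final
open Filter

lemma pos_lb {E : Type*} [TopologicalSpace E] {Y : Set E} (hY : IsCompact Y) {φ : E → ℝ} (hφ : ContinuousOn φ Y)
    (h : ∀ y ∈ Y, 0 < φ y) : ∃ c > 0, ∀ y ∈ Y, c ≤ φ y := by
  rcases Y.eq_empty_or_nonempty with rfl | hne
  · exact ⟨1, one_pos, fun y hy => hy.elim⟩
  · obtain ⟨y, hy, hm⟩ := hY.exists_isMinOn hne hφ
    exact ⟨φ y, h y hy, fun z hz => hm hz⟩

lemma final_step {n k N : ℕ}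
    {h : EuclideanSpace ℂ (Fin N) → EuclideanSpace ℂ (Fin k)} (hh : Differentiable ℂ h)
    {P : Set (EuclideanSpace ℂ (Fin n))} (hPc : IsCompact P) (hPreal : P ⊆ realSlice n)
    {f : EuclideanSpace ℂ (Fin n) → EuclideanSpace ℂ (Fin k) → EuclideanSpace ℂ (Fin N)}
    (hfcont : ContinuousOn
      (fun q : EuclideanSpace ℂ (Fin n) × EuclideanSpace ℂ (Fin k) => f q.1 q.2)
      (P ×ˢ (univ : Set (EuclideanSpace ℂ (Fin k)))))
    (hfhol : ∀ p ∈ P, Differentiable ℂ (f p))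
    {w : EuclideanSpace ℂ (Fin n) × EuclideanSpace ℂ (Fin N) → EuclideanSpace ℂ (Fin N)} (hw : Continuous w)
    (hwf : ∀ q, q.1 ∈ P → w q = q.2 - f q.1 (h q.2))
    {C A : Set (EuclideanSpace ℂ (Fin n) × EuclideanSpace ℂ (Fin N))}
    {R R2 : EuclideanSpace ℂ (Fin n) × EuclideanSpace ℂ (Fin N) → ℝ}
    (hC : IsCompact C) (hA : IsCompact A) (hAC : A ⊆ interior C) (hAP : ∀ q ∈ A, q.1 ∈ P)
    (hR : ∀ x ∈ C, Psh R x) (hR2 : ∀ x ∈ C, Psh R2 x) (hR20 : ∀ x ∈ C, 0 ≤ R2 x)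
    (hA2 : ∀ x ∈ A, R2 x = 0) {S : Set (EuclideanSpace ℂ (Fin n) × EuclideanSpace ℂ (Fin N))} (hS : IsCompact S)
    (hSA : S ⊆ A) (hSR : ∀ x ∈ S, R x < 0) (hAS : ∀ x ∈ A, x ∉ S → w x = 0)
    (hfr : ∀ x ∈ frontier C, R2 x ≤ 2 → 0 < R x ∧ w x ≠ 0) :
    ∃ Ω, IsSteinOpen Ω ∧ A ⊆ Ω ∧ Ω ⊆ C := by
  have hRc : ContinuousOn R C := fun x hx => (hR x hx).1.continuousAt.continuousWithinAt
  have hR2c : ContinuousOn R2 C := fun x hx => (hR2 x hx).1.continuousAt.continuousWithinAt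
  have hACs : A ⊆ C := hAC.trans interior_subset
  have hfC : frontier C ⊆ C := hC.isClosed.frontier_subset
  have hfc : IsCompact (frontier C) := hC.of_isClosed_subset isClosed_frontier hfC
  set Y := frontier C ∩ R2 ⁻¹' Iic 2 with hYdef
  have hY : IsCompact Y := hfc.of_isClosed_subset
    ((hR2c.mono hfC).preimage_isClosed_of_isClosed isClosed_frontier isClosed_Iic) inter_subset_left
  have hYC : Y ⊆ C := inter_subset_left.trans hfC
  obtain ⟨r0, hr0, hr0'⟩ := pos_lb hY (hRc.mono hYC) (fun y hy => (hfr y hy.1 hy.2).1)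
  obtain ⟨w0, hw0, hw0'⟩ := pos_lb hY hw.norm.continuousOn (fun y hy => norm_pos_iff.2 (hfr y hy.1 hy.2).2)
  obtain ⟨r1, hr1, hr1'⟩ := pos_lb hS (hRc.mono (hSA.trans hACs)).neg (fun y hy => neg_pos.2 (hSR y hy))
  obtain ⟨M, hM⟩ := hA.exists_bound_of_continuousOn (hRc.mono hACs)
  obtain ⟨W1, hW1⟩ := hS.exists_bound_of_continuousOn hw.continuousOn
  have ht1 : Tendsto (fun s : ℝ => w0 ^ 2 * Real.exp (s * r0)) atTop atTop :=
    (Real.tendsto_exp_atTop.comp (tendsto_id.atTop_mul_const hr0)).const_mul_atTop (by positivity)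
  have ht2 : Tendsto (fun s : ℝ => W1 ^ 2 * Real.exp (-(s * r1))) atTop (𝓝 (W1 ^ 2 * 0)) :=
    ((Real.tendsto_exp_neg_atTop_nhds_zero).comp (tendsto_id.atTop_mul_const hr1)).const_mul _
  rw [mul_zero] at ht2
  obtain ⟨s, hs1, hs2, hs0⟩ := ((ht1.eventually (eventually_ge_atTop 8)).and
    ((ht2.eventually (ge_mem_nhds (show (0:ℝ) < 1 / 16 by norm_num))).and (eventually_ge_atTop 0))).exists
  set B : ℝ := Real.exp (s * M) with hB
  have hB0 : 0 < B := Real.exp_pos _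
  have hAB : ∀ x ∈ A, Real.exp (s * R x) ≤ B := fun x hx => Real.exp_le_exp.2
    (mul_le_mul_of_nonneg_left ((le_abs_self _).trans (hM x hx)) hs0)
  have hAw : ∀ x ∈ A, ‖w x‖ ^ 2 * Real.exp (s * R x) ≤ 1 / 16 := by
    intro x hx
    by_cases hxS : x ∈ S
    · have h1 : ‖w x‖ ^ 2 ≤ W1 ^ 2 := pow_le_pow_left₀ (norm_nonneg _) (hW1 x hxS) 2
      have h2 : Real.exp (s * R x) ≤ Real.exp (-(s * r1)) := Real.exp_le_exp.2 (by
        have := hr1' x hxS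
        simp only [Pi.neg_apply] at this
        nlinarith)
      exact (mul_le_mul h1 h2 (Real.exp_nonneg _) (sq_nonneg _)).trans hs2
    · rw [hAS x hx hxS]; norm_num
  obtain ⟨ε, hε0, hεw, hεB⟩ : ∃ ε : ℝ, 0 < ε ∧ ε ≤ w0 / 2 ∧ ε ^ 2 * B ≤ 1 / 16 := by
    refine ⟨min (w0 / 2) (min 1 (1 / (16 * B))), by positivity, min_le_left _ _, ?_⟩
    set ε := min (w0 / 2) (min 1 (1 / (16 * B)))
    have e0 : 0 < ε := by positivity
    have e1 : ε ≤ 1 := (min_le_right _ _).trans (min_le_left _ _)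
    have e2 : ε ≤ 1 / (16 * B) := (min_le_right _ _).trans (min_le_right _ _)
    have e3 : ε * B ≤ 1 / 16 := by
      calc ε * B ≤ 1 / (16 * B) * B := mul_le_mul_of_nonneg_right e2 hB0.le
        _ = 1 / 16 := by field_simp
    nlinarith
  have hX : IsCompact ((fun q : EuclideanSpace ℂ (Fin n) × EuclideanSpace ℂ (Fin N) => h q.2) '' (A ∪ Y)) :=
    (hA.union hY).image (hh.continuous.comp continuous_snd)
  obtain ⟨G, hG, hGf⟩ := fam_approx hPc hPreal hfcont hfhol hX hε0
  set v : EuclideanSpace ℂ (Fin n) × EuclideanSpace ℂ (Fin N) → EuclideanSpace ℂ (Fin N) :=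
    fun q => q.2 - G (q.1, h q.2) with hv
  have hvd : Differentiable ℂ v := differentiable_snd.sub
    (hG.comp (differentiable_fst.prodMk (hh.comp differentiable_snd)))
  have hvw : ∀ q ∈ A ∪ Y, q.1 ∈ P → ‖v q - w q‖ < ε := by
    intro q hq hqP
    rw [hwf q hqP, norm_sub_rev]
    have := hGf q.1 hqP (h q.2) ⟨q, hq, rfl⟩
    simpa [hv] using this
  set δ : ℝ := 1 / (8 * B) with hδ
  have hδ0 : 0 < δ := by positivity
  have hδB : δ * B = 1 / 8 := by rw [hδ]; field_simp
  have hvc : ContinuousOn (fun q => ‖v q‖ ^ 2 * Real.exp (s * R q)) Y :=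
    (hvd.continuous.norm.pow 2).continuousOn.mul
      (Real.continuous_exp.comp_continuousOn (continuousOn_const.mul (hRc.mono hYC)))
  have hZ : IsCompact (Y ∩ (fun q => ‖v q‖ ^ 2 * Real.exp (s * R q)) ⁻¹' Iic 1) :=
    hY.of_isClosed_subset (hvc.preimage_isClosed_of_isClosed hY.isClosed isClosed_Iic) inter_subset_left
  set Z := Y ∩ (fun q => ‖v q‖ ^ 2 * Real.exp (s * R q)) ⁻¹' Iic 1 with hZdef
  have hZP : ∀ q ∈ Z, q.1 ∉ P := by
    intro q hq hqP
    have h1 := hvw q (Or.inr hq.1) hqP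
    have h2 := hw0' q hq.1
    have h3 : ‖w q‖ ≤ ‖v q‖ + ‖v q - w q‖ := by
      have := norm_sub_le (v q) (v q - w q)
      simpa using this
    have h4 : w0 / 2 ≤ ‖v q‖ := by linarith
    have h5 : (w0 / 2) ^ 2 ≤ ‖v q‖ ^ 2 := pow_le_pow_left₀ (by positivity) h4 2
    have h6 : Real.exp (s * r0) ≤ Real.exp (s * R q) :=
      Real.exp_le_exp.2 (mul_le_mul_of_nonneg_left (hr0' q hq.1) hs0)
    have h7 := mul_le_mul h5 h6 (Real.exp_nonneg _) (sq_nonneg _)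
    have h8 : ‖v q‖ ^ 2 * Real.exp (s * R q) ≤ 1 := hq.2
    nlinarith
  obtain ⟨κ, κ1, κ2, κ3⟩ := sos_of_pt (K := P) isOpen_univ (hZ.image continuous_fst) (subset_univ _)
    (fun c hc => by
      obtain ⟨q, hq, rfl⟩ := hc
      exact sep_real hPc hPreal (hZP q hq)) (show (0:ℝ) < 1 / 4 by norm_num) 1
  have hκ := κ1.comp (differentiable_fst (𝕜 := ℂ) (E := EuclideanSpace ℂ (Fin n)) (F := EuclideanSpace ℂ (Fin N)))
  have hexp : ∀ q, Real.exp (s * R q + Real.log ((∑ i, ‖v q i‖ ^ 2) + δ)) =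
      (‖v q‖ ^ 2 + δ) * Real.exp (s * R q) := by
    intro q
    rw [Real.exp_add, Real.exp_log (by positivity), EuclideanSpace.norm_sq_eq, mul_comm]
  refine stein_crit (ρ := fun q => Real.exp (s * R q + Real.log ((∑ i, ‖v q i‖ ^ 2) + δ)) + R2 q + (κ ∘ Prod.fst) q)
    hC hA hAC ?_ ?_ ?_ ?_
  · intro x hx
    have hvi : ∀ i, Differentiable ℂ fun q => v q i := fun i =>
      (EuclideanSpace.proj i : EuclideanSpace ℂ (Fin N) →L[ℂ] ℂ).differentiable.comp hvd
    exact ((((hR x hx).const_mul hs0).add (Psh.log (g := fun i q => v q i)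
      (fun i => hol_smooth isOpen_univ (hvi i).differentiableOn (mem_univ x))
      (fun i => hol_ev isOpen_univ (hvi i).differentiableOn (mem_univ x)) hδ0)).exp.add (hR2 x hx)).add
      (hκ.psh isOpen_univ (mem_univ x))
  · intro x hx
    exact add_nonneg (add_nonneg (Real.exp_nonneg _) (hR20 x hx)) (hκ.nonneg x)
  · intro x hx
    have h1 := hvw x (Or.inl hx) (hAP x hx)
    have h2 : ‖v x‖ ≤ ‖w x‖ + ‖v x - w x‖ := by
      have := norm_add_le (w x) (v x - w x)
      simpa using this
    have h3 : ‖v x‖ ^ 2 ≤ 2 * ‖w x‖ ^ 2 + 2 * ε ^ 2 := by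
      have : ‖v x‖ ^ 2 ≤ (‖w x‖ + ε) ^ 2 := pow_le_pow_left₀ (norm_nonneg _) (by linarith) 2
      nlinarith [sq_nonneg (‖w x‖ - ε)]
    have h4 := hAw x hx
    have h5 := hAB x hx
    have h6 : κ x.1 < 1 / 4 := κ2 _ (hAP x hx)
    have h7 : (‖v x‖ ^ 2 + δ) * Real.exp (s * R x) ≤
        2 * (‖w x‖ ^ 2 * Real.exp (s * R x)) + 2 * (ε ^ 2 * B) + δ * B := by
      have a1 := mul_le_mul_of_nonneg_right h3 (Real.exp_nonneg (s * R x))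
      have a2 := mul_le_mul_of_nonneg_left h5 (sq_nonneg ε)
      have a3 := mul_le_mul_of_nonneg_left h5 hδ0.le
      nlinarith
    show Real.exp _ + R2 x + κ x.1 < 1
    rw [hexp, hA2 x hx]
    linarith
  · intro x hx
    show 1 ≤ Real.exp _ + R2 x + κ x.1
    have b1 := hR20 x (hfC hx)
    have b2 : 0 ≤ κ x.1 := κ1.nonneg x.1
    rw [hexp]
    have b3 : ‖v x‖ ^ 2 * Real.exp (s * R x) ≤ (‖v x‖ ^ 2 + δ) * Real.exp (s * R x) :=
      mul_le_mul_of_nonneg_right (by linarith) (Real.exp_nonneg _)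
    have b4 : 0 ≤ ‖v x‖ ^ 2 * Real.exp (s * R x) := by positivity
    by_cases hx2 : R2 x ≤ 2
    · by_cases hxZ : ‖v x‖ ^ 2 * Real.exp (s * R x) ≤ 1
      · have := κ3 x.1 ⟨x, ⟨⟨hx, hx2⟩, hxZ⟩, rfl⟩
        linarith
      · linarith
    · linarith
end final

/-- Corollary 2.6 (parametric version of Theorem 2.2): if `S ⊆ P × ℂᴺ` is a compact set,
`𝒪(Θ)`-convex in some Stein open `Θ`, whose fibers meet the graphs `V_p = f_p(ℂᵏ)` inside
`Σ_p = f_p(K)` in fiberwise holomorphically convex sets, then `Σ ∪ S` is a Stein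
compactum in `ℂⁿ × ℂᴺ`. -/
theorem union_laminated_graph_stein_compactum {n k N : ℕ}
    (h : EuclideanSpace ℂ (Fin N) → EuclideanSpace ℂ (Fin k))
    (hh : Differentiable ℂ h)
    (hsub : ∀ z, Function.Surjective (fderiv ℂ h z))
    (K : Set (EuclideanSpace ℂ (Fin k))) (hK : IsCompact K)
    (hKconv : hullO univ K = K)
    (P : Set (EuclideanSpace ℂ (Fin n))) (hPc : IsCompact P) (hPreal : P ⊆ realSlice n)
    (f : EuclideanSpace ℂ (Fin n) → EuclideanSpace ℂ (Fin k) → EuclideanSpace ℂ (Fin N))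
    (hfcont : ContinuousOn
      (fun q : EuclideanSpace ℂ (Fin n) × EuclideanSpace ℂ (Fin k) => f q.1 q.2)
      (P ×ˢ (univ : Set (EuclideanSpace ℂ (Fin k)))))
    (hfsec : ∀ p ∈ P, ∀ x, h (f p x) = x)
    (hfhol : ∀ p ∈ P, Differentiable ℂ (f p))
    (S : Set (EuclideanSpace ℂ (Fin n) × EuclideanSpace ℂ (Fin N)))
    (hScpt : IsCompact S)
    (hSsub : S ⊆ P ×ˢ (univ : Set (EuclideanSpace ℂ (Fin N))))
    (hi : ∀ p ∈ P,
      fiberOf S p ∩ (f p '' univ) ⊆ f p '' K ∧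
      hullO univ (h '' (fiberOf S p ∩ (f p '' univ))) =
        h '' (fiberOf S p ∩ (f p '' univ)))
    (hii : ∃ Θ : Set (EuclideanSpace ℂ (Fin n) × EuclideanSpace ℂ (Fin N)),
      IsSteinOpen Θ ∧ S ⊆ Θ ∧ hullO Θ S = S) :
    IsSteinCompactum
      ({q : EuclideanSpace ℂ (Fin n) × EuclideanSpace ℂ (Fin N) |
        ∃ p ∈ P, ∃ x ∈ K, q = (p, f p x)} ∪ S) := by
  classical
  obtain ⟨Θ, hΘ, hSΘ, hΘS⟩ := hii
  intro U hU hAU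
  obtain ⟨fb, hfb⟩ : ∃ fb : EuclideanSpace ℂ (Fin n) × EuclideanSpace ℂ (Fin k) → EuclideanSpace ℂ (Fin N),
      Continuous fb ∧ ∀ q, q.1 ∈ P → fb q = f q.1 q.2 := by
    haveI : TietzeExtension.{0, 0} (EuclideanSpace ℂ (Fin N)) := TietzeExtension.of_tvs ℂ
    have hcl : IsClosed (P ×ˢ (univ : Set (EuclideanSpace ℂ (Fin k)))) := hPc.isClosed.prod isClosed_univ
    obtain ⟨g, hg⟩ := ContinuousMap.exists_restrict_eq hcl
      (⟨_, continuousOn_iff_continuous_restrict.1 hfcont⟩ : C(_, EuclideanSpace ℂ (Fin N)))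
    refine ⟨g, g.continuous, fun q hq => ?_⟩
    exact DFunLike.congr_fun hg ⟨q, hq, mem_univ _⟩
  obtain ⟨hfbc, hfbf⟩ := hfb
  set H : EuclideanSpace ℂ (Fin n) × EuclideanSpace ℂ (Fin N) → EuclideanSpace ℂ (Fin n) × EuclideanSpace ℂ (Fin k) :=
    fun q => (q.1, h q.2) with hH
  have hHd : Differentiable ℂ H := differentiable_fst.prodMk (hh.comp differentiable_snd)
  set w : EuclideanSpace ℂ (Fin n) × EuclideanSpace ℂ (Fin N) → EuclideanSpace ℂ (Fin N) :=
    fun q => q.2 - fb (H q) with hw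
  have hwc : Continuous w := continuous_snd.sub (hfbc.comp hHd.continuous)
  set γ : EuclideanSpace ℂ (Fin n) × EuclideanSpace ℂ (Fin k) → EuclideanSpace ℂ (Fin n) × EuclideanSpace ℂ (Fin N) :=
    fun y => (y.1, fb y) with hγ
  have hγc : Continuous γ := continuous_fst.prodMk hfbc
  have hγw : ∀ q, w q = 0 → q = γ (H q) := fun q hq => Prod.ext rfl (sub_eq_zero.1 hq)
  have hwf : ∀ q, q.1 ∈ P → w q = q.2 - f q.1 (h q.2) := fun q hq => by
    simp only [hw]; rw [hfbf _ (show (H q).1 ∈ P from hq)]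
  have hKt : IsCompact (P ×ˢ K) := hPc.prod hK
  set T : Set (EuclideanSpace ℂ (Fin n) × EuclideanSpace ℂ (Fin k)) := P ×ˢ K ∩ γ ⁻¹' S with hT
  have hTc : IsCompact T := hKt.inter_right (hScpt.isClosed.preimage hγc)
  have hSig : ∀ p ∈ P, ∀ x, w (p, f p x) = 0 ∧ H (p, f p x) = (p, x) := fun p hp x => by
    rw [hwf _ hp]; simp [hH, hfsec p hp]
  have hSP : ∀ q ∈ S, q.1 ∈ P := fun q hq => (hSsub hq).1
  have hST : ∀ q ∈ S, w q = 0 → H q ∈ T := by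
    rintro ⟨p, z⟩ hq h0
    have hp := hSP _ hq
    have hz : z = f p (h z) := by
      rw [hwf _ hp] at h0; exact sub_eq_zero.1 h0
    obtain ⟨x, hx, hxz⟩ := (hi p hp).1 ⟨hq, ⟨h z, mem_univ _, hz.symm⟩⟩
    have hzx : h z = x := by rw [← hxz, hfsec p hp]
    refine ⟨⟨hp, ?_⟩, ?_⟩
    · show h z ∈ K
      rw [hzx]; exact hx
    · show γ (H (p, z)) ∈ S
      rw [← hγw _ h0]; exact hq
  have hprop : ∀ B : Set (EuclideanSpace ℂ (Fin n) × EuclideanSpace ℂ (Fin k)), IsCompact B →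
      IsCompact {q | ‖w q‖ ≤ 1 ∧ H q ∈ B} := by
    intro B hB
    obtain ⟨M, hM⟩ := hB.exists_bound_of_continuousOn hfbc.continuousOn
    refine ((hB.image continuous_fst).prod (isCompact_closedBall (0 : EuclideanSpace ℂ (Fin N)) (1 + M))).of_isClosed_subset
      ((isClosed_le hwc.norm continuous_const).inter (hB.isClosed.preimage hHd.continuous)) ?_
    rintro q ⟨h1, h2⟩
    refine ⟨⟨H q, h2, rfl⟩, ?_⟩
    rw [mem_closedBall_zero_iff]
    have h3 := hM _ h2
    have h4 : ‖q.2‖ ≤ ‖w q‖ + ‖fb (H q)‖ := by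
      have := norm_add_le (w q) (fb (H q))
      simpa [hw] using this
    linarith
  have sepE : ∀ b : EuclideanSpace ℂ (Fin k), SepPt univ (∅ : Set (EuclideanSpace ℂ (Fin k))) b := fun b =>
    ⟨fun _ => 1, (differentiable_const _).differentiableOn, 0, fun x hx => hx.elim, by norm_num⟩
  have sepK : ∀ c ∉ P ×ˢ K, SepPt univ (P ×ˢ K) c := by
    rintro ⟨a, b⟩ hc
    refine sep_fiber hKt (fun q hq => hPreal hq.1) ?_
    by_cases ha : a ∈ P
    · have e : fiberOf (P ×ˢ K) a = K := by ext x; simp [fiberOf, ha]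
      rw [e]
      exact sepPt_of_hull hK (subset_univ _) (mem_univ _) (by rw [hKconv]; exact fun hb => hc ⟨ha, hb⟩)
    · have e : fiberOf (P ×ˢ K) a = ∅ := by ext x; simp [fiberOf, ha]
      rw [e]; exact sepE b
  have sepT : ∀ c ∉ T, SepPt univ T c := by
    rintro ⟨a, b⟩ hc
    refine sep_fiber hTc (fun q hq => hPreal hq.1.1) ?_
    by_cases ha : a ∈ P
    · have e : h '' (fiberOf S a ∩ (f a '' univ)) = fiberOf T a := by
        ext x
        constructor
        · rintro ⟨z, ⟨hz, x', -, hx'⟩, rfl⟩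
          have hw0 := (hSig a ha x').1
          rw [hx'] at hw0
          exact hST (a, z) hz hw0
        · rintro ⟨⟨_, hx⟩, hS⟩
          have hS' : (a, f a x) ∈ S := by
            have : γ (a, x) = (a, f a x) := by simp only [hγ]; rw [hfbf _ ha]
            rw [← this]; exact hS
          exact ⟨f a x, ⟨hS', x, mem_univ _, rfl⟩, hfsec a ha x⟩
      have hfc : IsCompact (fiberOf T a) := by
        have : fiberOf T a = Prod.snd '' (T ∩ Prod.fst ⁻¹' {a}) := by
          ext x
          constructor
          · intro hx; exact ⟨(a, x), ⟨hx, rfl⟩, rfl⟩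
          · rintro ⟨⟨a', x'⟩, ⟨h1, h2⟩, rfl⟩
            obtain rfl : a' = a := h2
            exact h1
        rw [this]
        exact (hTc.inter_right (isClosed_singleton.preimage continuous_fst)).image continuous_snd
      have hcv := (hi a ha).2
      rw [e] at hcv
      exact sepPt_of_hull hfc (subset_univ _) (mem_univ _) (by rw [hcv]; exact hc)
    · have e : fiberOf T a = ∅ := by ext x; simp [fiberOf, hT, ha]
      rw [e]; exact sepE b
  obtain ⟨C, R, R2, c1, c2, c3, c4, c5, c6, c7, c8, c9, c10, c11⟩ := glue hHd hwc hγc hprop hγw hKt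
    (inter_subset_left : T ⊆ P ×ˢ K) hΘ.1 hU hScpt hSΘ (fun q hq => hAU (Or.inr hq))
    (fun y hy => hAU (Or.inl ⟨y.1, hy.1, y.2, hy.2, by simp only [hγ]; rw [hfbf _ hy.1]⟩))
    hST (fun y hy => hy.2)
    (fun c hc hcS => sepPt_of_hull hScpt hSΘ hc (by rw [hΘS]; exact hcS)) sepK sepT
  have hSigc : IsCompact {q : EuclideanSpace ℂ (Fin n) × EuclideanSpace ℂ (Fin N) |
        ∃ p ∈ P, ∃ x ∈ K, q = (p, f p x)} := by
    have : {q : EuclideanSpace ℂ (Fin n) × EuclideanSpace ℂ (Fin N) |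
        ∃ p ∈ P, ∃ x ∈ K, q = (p, f p x)} = γ '' (P ×ˢ K) := by
      ext q
      constructor
      · rintro ⟨p, hp, x, hx, rfl⟩
        exact ⟨(p, x), ⟨hp, hx⟩, by simp only [hγ]; rw [hfbf _ hp]⟩
      · rintro ⟨y, hy, rfl⟩
        exact ⟨y.1, hy.1, y.2, hy.2, by simp only [hγ]; rw [hfbf _ hy.1]⟩
    rw [this]; exact hKt.image hγc
  have hSigw : ∀ q : EuclideanSpace ℂ (Fin n) × EuclideanSpace ℂ (Fin N), (∃ p ∈ P, ∃ x ∈ K, q = (p, f p x)) →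
      w q = 0 ∧ H q ∈ P ×ˢ K := by
    rintro q ⟨p, hp, x, hx, rfl⟩
    exact ⟨(hSig p hp x).1, by rw [(hSig p hp x).2]; exact ⟨hp, hx⟩⟩
  obtain ⟨Ω, o1, o2, o3⟩ := final_step hh hPc hPreal hfcont hfhol hwc hwf c1 (hSigc.union hScpt)
    (union_subset (fun q hq => c4 (hSigw q hq)) c3)
    (by
      rintro q (hq | hq)
      · exact (hSigw q hq).2.1
      · exact hSP q hq) c5 c6 c7
    (by
      rintro q (hq | hq)
      · exact c10 q (hSigw q hq).1 (hSigw q hq).2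
      · exact c9 q hq) hScpt subset_union_right c8
    (fun q hq hqS => (hSigw q (hq.resolve_right hqS)).1) c11
  exact ⟨Ω, o1, o2, o3.trans c2⟩
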